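/- For every integer l ≥ 4, every 4-vertex-critical graph in 𝒢_l contains no odd K4-subdivision. -/

import Mathlib

open SimpleGraph

variable {V : Type*}

/-- The set of internal vertices of a walk from `x` to `y`. -/
def wInterior {G : SimpleGraph V} {x y : V} (P : G.Walk x y) : Set V :=
  {a | a ∈ P.support ∧ a ≠ x ∧ a ≠ y}

/-- `P` is an induced path of `G`. -/
def IsInducedPath (G : SimpleGraph V) {x y : V} (P : G.Walk x y) : Prop :=
  P.IsPath ∧ ∀ a ∈ P.support, ∀ b ∈ P.support, G.Adj a b → s(a, b) ∈ P.edges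

/-- A hole of `G`: an induced cycle of length at least 4. -/
def IsHole (G : SimpleGraph V) {v : V} (w : G.Walk v v) : Prop :=
  w.IsCycle ∧ 4 ≤ w.length ∧
    ∀ a ∈ w.support, ∀ b ∈ w.support, G.Adj a b → s(a, b) ∈ w.edges

/-- An odd hole of `G`. -/
def IsOddHole (G : SimpleGraph V) {v : V} (w : G.Walk v v) : Prop :=
  IsHole G w ∧ Odd w.length

/-- `G` belongs to the family `𝒢ₗ`: it has girth `2l+1` and
no odd hole of length at least `2l+3`. -/
def MemGFam (G : SimpleGraph V) (l : ℕ) : Prop :=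
  G.girth = (2 * l + 1 : ℕ) ∧
    ∀ (v : V) (w : G.Walk v v), IsOddHole G w → w.length < 2 * l + 3

/-- `G` is `k`-vertex-critical. -/
def IsVertexCritical (G : SimpleGraph V) (k : ℕ) : Prop :=
  G.chromaticNumber = k ∧
    ∀ v : V, (G.induce {u | u ≠ v}).chromaticNumber < k

/-- `S` is a vertex cut of `G`: deleting `S` leaves a disconnected graph. -/
def IsVertexCut (G : SimpleGraph V) (S : Set V) : Prop :=
  ¬ (G.induce Sᶜ).Preconnected

/-- `G` has a `K2`-cut. -/
def HasK2Cut (G : SimpleGraph V) : Prop :=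
  ∃ u v : V, G.Adj u v ∧ IsVertexCut G {u, v}

/-- `G` has a `P3`-cut. -/
def HasP3Cut (G : SimpleGraph V) : Prop :=
  ∃ u v w : V, u ≠ w ∧ G.Adj u v ∧ G.Adj v w ∧ ¬ G.Adj u w ∧ IsVertexCut G {u, v, w}

/-- `G` has a 2-edge-cut: two edges whose removal disconnects the graph. -/
def Has2EdgeCut (G : SimpleGraph V) : Prop :=
  ∃ e f : Sym2 V, e ≠ f ∧ e ∈ G.edgeSet ∧ f ∈ G.edgeSet ∧
    ¬ (G.deleteEdges {e, f}).Preconnected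

/-- `Q1`, `Q2` are the two internally disjoint `(x,y)`-paths of the cycle `w`. -/
def ArcsOf (G : SimpleGraph V) {v x y : V} (w : G.Walk v v) (Q1 Q2 : G.Walk x y) : Prop :=
  x ∈ w.support ∧ y ∈ w.support ∧ x ≠ y ∧ Q1.IsPath ∧ Q2.IsPath ∧
    ({a | a ∈ Q1.support} ∩ {a | a ∈ Q2.support} = {x, y}) ∧
    ({e | e ∈ w.edges} = {e | e ∈ Q1.edges} ∪ {e | e ∈ Q2.edges})

/-- `P` is a chordal path of the hole `w`: `w ∪ P` is an induced theta-subgraph of `G`. -/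
def IsChordalPath (G : SimpleGraph V) {v x y : V} (w : G.Walk v v) (P : G.Walk x y) : Prop :=
  IsHole G w ∧ P.IsPath ∧ 2 ≤ P.length ∧ x ∈ w.support ∧ y ∈ w.support ∧ x ≠ y ∧
    (∀ a ∈ wInterior P, a ∉ w.support) ∧
    (∀ a, (a ∈ w.support ∨ a ∈ P.support) → ∀ b, (b ∈ w.support ∨ b ∈ P.support) →
      G.Adj a b → (s(a, b) ∈ w.edges ∨ s(a, b) ∈ P.edges))

/-- `P` is an `(s,t)`-jump over the hole `w`. -/
def IsJump (G : SimpleGraph V) {v s t : V} (w : G.Walk v v) (P : G.Walk s t) : Prop :=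
  IsHole G w ∧ s ∈ w.support ∧ t ∈ w.support ∧ s ≠ t ∧ ¬ G.Adj s t ∧
    IsInducedPath G P ∧ ∀ a ∈ wInterior P, a ∉ w.support

/-- `P` is a local jump over `w` across the interior of the arc `Q1`
(`Q1`, `Q2` being the two arcs of `w` between the ends of `P`). -/
def IsLocalJumpAcross (G : SimpleGraph V) {v s t : V} (w : G.Walk v v)
    (P Q1 Q2 : G.Walk s t) : Prop :=
  IsJump G w P ∧ ArcsOf G w Q1 Q2 ∧
    (∃ a ∈ wInterior Q1, ∃ b ∈ wInterior P, G.Adj a b) ∧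
    (∀ a ∈ wInterior Q2, ∀ b ∈ wInterior P, ¬ G.Adj a b)

/-- `P` is a local jump over `w`. -/
def IsLocalJump (G : SimpleGraph V) {v s t : V} (w : G.Walk v v) (P : G.Walk s t) : Prop :=
  ∃ Q1 Q2 : G.Walk s t, IsLocalJumpAcross G w P Q1 Q2

/-- `P` is a local jump over `w` across one vertex. -/
def IsLocalJumpAcrossOne (G : SimpleGraph V) {v s t : V} (w : G.Walk v v)
    (P : G.Walk s t) : Prop :=
  ∃ Q1 Q2 : G.Walk s t, IsLocalJumpAcross G w P Q1 Q2 ∧ Q1.length = 2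

/-- `P` is a short jump over `w`: no internal vertex of either arc of `w`
has a neighbour among the internal vertices of `P`. -/
def IsShortJump (G : SimpleGraph V) {v s t : V} (w : G.Walk v v) (P : G.Walk s t) : Prop :=
  IsJump G w P ∧
    ∀ a ∈ w.support, a ≠ s → a ≠ t → ∀ b ∈ wInterior P, ¬ G.Adj a b

/-- `P` is a short jump over `w` across the interior of `Q1`, i.e. `P ∪ Q1` is an
odd hole (a jump hole over `w`). -/
def IsShortJumpAcross (G : SimpleGraph V) {v s t : V} (w : G.Walk v v)
    (P Q1 Q2 : G.Walk s t) : Prop :=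
  IsShortJump G w P ∧ ArcsOf G w Q1 Q2 ∧ IsOddHole G (P.append Q1.reverse)

/-- `x` lies in some jump hole over `w`. -/
def InJumpHoleOver (G : SimpleGraph V) {v : V} (w : G.Walk v v) (x : V) : Prop :=
  ∃ (s t : V) (P Q1 Q2 : G.Walk s t),
    IsShortJumpAcross G w P Q1 Q2 ∧ (x ∈ P.support ∨ x ∈ Q1.support)

/-- `a`, `b`, `c`, `d` appear on the cycle `w` in this cyclic order. -/
def CyclicOrder4 (G : SimpleGraph V) {v : V} (w : G.Walk v v) (a b c d : V) : Prop :=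
  ∃ n : ℕ, List.Sublist [a, b, c, d] (w.support.tail.rotate n)

/-- A `K4`-subdivision in `G`: four distinct branch vertices joined by six
internally disjoint paths (the arrises). -/
structure K4Sub (G : SimpleGraph V) where
  u1 : V
  u2 : V
  u3 : V
  u4 : V
  P1 : G.Walk u1 u2
  P2 : G.Walk u3 u4
  Q1 : G.Walk u2 u3
  Q2 : G.Walk u1 u4
  L1 : G.Walk u1 u3
  L2 : G.Walk u2 u4
  hu : List.Nodup [u1, u2, u3, u4]
  hP1 : P1.IsPath
  hP2 : P2.IsPath
  hQ1 : Q1.IsPath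
  hQ2 : Q2.IsPath
  hL1 : L1.IsPath
  hL2 : L2.IsPath
  hP : ∀ a ∈ P1.support, a ∉ P2.support
  hQ : ∀ a ∈ Q1.support, a ∉ Q2.support
  hL : ∀ a ∈ L1.support, a ∉ L2.support

namespace K4Sub

variable {G : SimpleGraph V}

/-- The face cycle `C1 = P1 ∪ Q1 ∪ L1`. -/
def C1 (H : K4Sub G) : G.Walk H.u1 H.u1 := (H.P1.append H.Q1).append H.L1.reverse
/-- The face cycle `C2 = P1 ∪ Q2 ∪ L2`. -/
def C2 (H : K4Sub G) : G.Walk H.u1 H.u1 := (H.P1.append H.L2).append H.Q2.reverse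
/-- The face cycle `C3 = P2 ∪ Q1 ∪ L2`. -/
def C3 (H : K4Sub G) : G.Walk H.u2 H.u2 := (H.Q1.append H.P2).append H.L2.reverse
/-- The face cycle `C4 = C1 △ C2 △ C3 = P2 ∪ Q2 ∪ L1`. -/
def C4 (H : K4Sub G) : G.Walk H.u1 H.u1 := (H.L1.append H.P2).append H.Q2.reverse

/-- The vertex set of the subdivision. -/
def verts (H : K4Sub G) : Set V :=
  {a | a ∈ H.P1.support ∨ a ∈ H.P2.support ∨ a ∈ H.Q1.support ∨
       a ∈ H.Q2.support ∨ a ∈ H.L1.support ∨ a ∈ H.L2.support}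

/-- The edge set of the subdivision. -/
def edges (H : K4Sub G) : Set (Sym2 V) :=
  {e | e ∈ H.P1.edges ∨ e ∈ H.P2.edges ∨ e ∈ H.Q1.edges ∨
       e ∈ H.Q2.edges ∨ e ∈ H.L1.edges ∨ e ∈ H.L2.edges}

end K4Sub

/-- `H` is an odd `K4`-subdivision: all four face cycles are odd holes. -/
def IsOddK4 (G : SimpleGraph V) (H : K4Sub G) : Prop :=
  IsOddHole G H.C1 ∧ IsOddHole G H.C2 ∧ IsOddHole G H.C3 ∧ IsOddHole G H.C4

/-- `G` has an odd `K4`-subdivision. -/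
def HasOddK4 (G : SimpleGraph V) : Prop := ∃ H : K4Sub G, IsOddK4 G H

/-- `H` is a balanced `K4`-subdivision of type `(1,2)`. -/
def IsBalancedK4 (G : SimpleGraph V) (H : K4Sub G) : Prop :=
  IsOddHole G H.C1 ∧ IsOddHole G H.C2 ∧
    IsHole G H.C3 ∧ Even H.C3.length ∧ IsHole G H.C4 ∧ Even H.C4.length ∧
    H.Q1.length = 1 ∧ 2 ≤ H.L2.length

/-- `G` contains a balanced `K4`-subdivision of type `(1,2)`. -/
def HasBalancedK4 (G : SimpleGraph V) : Prop := ∃ H : K4Sub G, IsBalancedK4 G H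

/-- `P` is a direct connection linking the (vertex sets of) two disjoint induced
subgraphs `S1` and `S2`. -/
def IsDirectConnection (G : SimpleGraph V) (S1 S2 : Set V) {v1 v2 : V}
    (P : G.Walk v1 v2) : Prop :=
  IsInducedPath G P ∧ (∀ x ∈ P.support, x ∉ S1 ∧ x ∉ S2) ∧
    (∃ y ∈ S1, G.Adj v1 y) ∧ (∃ y ∈ S2, G.Adj v2 y) ∧
    (∀ x ∈ P.support, (∃ y ∈ S1, G.Adj x y) → x = v1) ∧
    (∀ x ∈ P.support, (∃ y ∈ S2, G.Adj x y) → x = v2)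

/-- `P` is a minimal direct connection linking `S1` and `S2`. -/
def IsMinimalDirectConnection (G : SimpleGraph V) (S1 S2 : Set V) {v1 v2 : V}
    (P : G.Walk v1 v2) : Prop :=
  IsDirectConnection G S1 S2 P ∧
    ∀ (w1 w2 : V) (P' : G.Walk w1 w2), IsDirectConnection G S1 S2 P' →
      (∀ x ∈ P'.support, x ∈ P.support) → ∀ x ∈ P.support, x ∈ P'.support

abbrev EdgeIn (es : List (ℕ × ℕ)) (x y : ℕ) : Prop := (x, y) ∈ es ∨ (y, x) ∈ es

def IsEnd (L : ℕ → ℕ → ℕ) (c x y k : ℕ) : Prop := (k = 0 ∧ c = x) ∨ (k = L x y ∧ c = y)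

structure Frame (G : SimpleGraph V) (es : List (ℕ × ℕ)) (S : Set V) (φ : ℕ → V)
    (f : ℕ → ℕ → ℕ → V) (L : ℕ → ℕ → ℕ) : Prop where
  asymm : ∀ x y, (x, y) ∈ es → (y, x) ∉ es
  ne : ∀ x y, EdgeIn es x y → x ≠ y
  Lsymm : ∀ x y, EdgeIn es x y → L y x = L x y
  Lpos : ∀ x y, EdgeIn es x y → 1 ≤ L x y
  symm : ∀ x y k, EdgeIn es x y → k ≤ L x y → f y x k = f x y (L x y - k)
  start : ∀ x y, EdgeIn es x y → f x y 0 = φ x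
  adj : ∀ x y k, EdgeIn es x y → k < L x y → G.Adj (f x y k) (f x y (k + 1))
  inter : ∀ x y k x' y' k', EdgeIn es x y → EdgeIn es x' y' → k ≤ L x y → k' ≤ L x' y' →
    f x y k = f x' y' k' → (x = x' ∧ y = y' ∧ k = k') ∨ (x = y' ∧ y = x' ∧ k + k' = L x y) ∨
      ∃ c, IsEnd L c x y k ∧ IsEnd L c x' y' k'
  verts : ∀ v, v ∈ S ↔ ∃ x y k, EdgeIn es x y ∧ k ≤ L x y ∧ v = f x y k

namespace Frame

variable {G : SimpleGraph V} {es : List (ℕ × ℕ)} {S : Set V} {φ : ℕ → V}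
    {f : ℕ → ℕ → ℕ → V} {L : ℕ → ℕ → ℕ}

theorem of_oriented (asymm : ∀ x y, (x, y) ∈ es → (y, x) ∉ es) (ne : ∀ x y, (x, y) ∈ es → x ≠ y)
    (Lsymm : ∀ x y, (x, y) ∈ es → L y x = L x y)
    (Lpos : ∀ x y, (x, y) ∈ es → 1 ≤ L x y)
    (symm : ∀ x y k, (x, y) ∈ es → k ≤ L x y → f y x k = f x y (L x y - k))
    (start : ∀ x y, (x, y) ∈ es → f x y 0 = φ x)
    (finish : ∀ x y, (x, y) ∈ es → f x y (L x y) = φ y)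
    (adj : ∀ x y k, (x, y) ∈ es → k < L x y → G.Adj (f x y k) (f x y (k + 1)))
    (inter : ∀ x y k x' y' k', (x, y) ∈ es → (x', y') ∈ es → k ≤ L x y → k' ≤ L x' y' →
      f x y k = f x' y' k' → (x = x' ∧ y = y' ∧ k = k') ∨
        ∃ c, IsEnd L c x y k ∧ IsEnd L c x' y' k')
    (verts : ∀ v, v ∈ S ↔ ∃ x y k, (x, y) ∈ es ∧ k ≤ L x y ∧ v = f x y k) :
    Frame G es S φ f L where
  asymm := asymm
  ne := by
    rintro x y (h | h)
    · exact ne _ _ h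
    · exact (ne _ _ h).symm
  Lsymm := by
    rintro x y (h | h)
    · exact Lsymm _ _ h
    · exact (Lsymm _ _ h).symm
  Lpos := by
    rintro x y (h | h)
    · exact Lpos _ _ h
    · rw [Lsymm _ _ h]; exact Lpos _ _ h
  symm := by
    rintro x y k (h | h) hk
    · exact symm _ _ _ h hk
    · rw [Lsymm _ _ h] at hk ⊢
      rw [symm _ _ _ h (by omega)]
      congr 1; omega
  start := by
    rintro x y (h | h)
    · exact start _ _ h
    · rw [symm _ _ _ h (by omega), ← finish _ _ h]; congr 1
  adj := by
    rintro x y k (h | h) hk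
    · exact adj _ _ _ h hk
    · rw [Lsymm _ _ h] at hk
      rw [symm _ _ _ h (by omega), symm _ _ _ h (by omega)]
      have := adj _ _ (L y x - (k + 1)) h (by omega)
      rw [show L y x - (k + 1) + 1 = L y x - k by omega] at this
      exact this.symm
  inter := by
    have aux : ∀ x y c k, (y, x) ∈ es → k ≤ L x y → IsEnd L c y x (L y x - k) →
        IsEnd L c x y k := by
      intro x y c k h hk hc
      have := Lsymm _ _ h
      unfold IsEnd at *
      omega
    rintro x y k x' y' k' (h | h) (h' | h') hk hk' he
    · rcases inter _ _ _ _ _ _ h h' hk hk' he with h1 | ⟨c, h1, h2⟩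
      · exact .inl h1
      · exact .inr (.inr ⟨c, h1, h2⟩)
    · have e' := Lsymm _ _ h'
      rw [symm _ _ _ h' (by omega)] at he
      rcases inter _ _ _ _ _ _ h h' hk (by omega) he with ⟨rfl, rfl, h1⟩ | ⟨c, h1, h2⟩
      · right; left; exact ⟨rfl, rfl, by omega⟩
      · exact .inr (.inr ⟨c, h1, aux _ _ _ _ h' hk' h2⟩)
    · have e := Lsymm _ _ h
      rw [symm _ _ _ h (by omega)] at he
      rcases inter _ _ _ _ _ _ h h' (by omega) hk' he with ⟨rfl, rfl, h1⟩ | ⟨c, h1, h2⟩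
      · right; left; exact ⟨rfl, rfl, by omega⟩
      · exact .inr (.inr ⟨c, aux _ _ _ _ h hk h1, h2⟩)
    · have e := Lsymm _ _ h
      have e' := Lsymm _ _ h'
      rw [symm _ _ _ h (by omega), symm _ _ _ h' (by omega)] at he
      rcases inter _ _ _ _ _ _ h h' (by omega) (by omega) he with ⟨rfl, rfl, h1⟩ | ⟨c, h1, h2⟩
      · left; exact ⟨rfl, rfl, by omega⟩
      · exact .inr (.inr ⟨c, aux _ _ _ _ h hk h1, aux _ _ _ _ h' hk' h2⟩)
  verts := by
    intro v
    rw [verts]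
    constructor
    · rintro ⟨x, y, k, h, hk, rfl⟩; exact ⟨x, y, k, .inl h, hk, rfl⟩
    · rintro ⟨x, y, k, h | h, hk, rfl⟩
      · exact ⟨x, y, k, h, hk, rfl⟩
      · rw [Lsymm _ _ h] at hk
        exact ⟨y, x, L y x - k, h, by omega, symm _ _ _ h (by omega)⟩

theorem mem (hF : Frame G es S φ f L) {x y k : ℕ} (h : EdgeIn es x y) (hk : k ≤ L x y) :
    f x y k ∈ S := (hF.verts _).2 ⟨x, y, k, h, hk, rfl⟩

theorem finish (hF : Frame G es S φ f L) {x y : ℕ} (h : EdgeIn es x y) :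
    f x y (L x y) = φ y := by
  have := hF.symm x y 0 h (by omega)
  rw [Nat.sub_zero] at this
  rw [← this, hF.start _ _ h.symm]

theorem inj (hF : Frame G es S φ f L) {x y k k' : ℕ} (h : EdgeIn es x y) (hk : k ≤ L x y)
    (hk' : k' ≤ L x y) (he : f x y k = f x y k') : k = k' := by
  have hne := hF.ne _ _ h
  rcases hF.inter _ _ _ _ _ _ h h hk hk' he with h1 | h1 | ⟨c, h1, h2⟩
  · exact h1.2.2
  · exact absurd h1.1 hne
  · unfold IsEnd at h1 h2
    omega

theorem phi_inj (hF : Frame G es S φ f L) {x y x' y' : ℕ} (h : EdgeIn es x x')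
    (h' : EdgeIn es y y') (he : φ x = φ y) : x = y := by
  have p := hF.Lpos _ _ h
  have p' := hF.Lpos _ _ h'
  rw [← hF.start _ _ h, ← hF.start _ _ h'] at he
  rcases hF.inter _ _ _ _ _ _ h h' (by omega) (by omega) he with h1 | h1 | ⟨c, h1, h2⟩
  · exact h1.1
  · omega
  · unfold IsEnd at h1 h2
    omega

end Frame

def subEdges (es : List (ℕ × ℕ)) (a b n : ℕ) : List (ℕ × ℕ) :=
  (a, n) :: (n, b) :: es.filter (fun e => e ≠ (a, b) ∧ e ≠ (b, a))

def subLen (L : ℕ → ℕ → ℕ) (a b n i : ℕ) (x y : ℕ) : ℕ :=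
  if (x = a ∧ y = n) ∨ (x = n ∧ y = a) then i
  else if (x = n ∧ y = b) ∨ (x = b ∧ y = n) then L a b - i else L x y

def subMap (f : ℕ → ℕ → ℕ → V) (L : ℕ → ℕ → ℕ) (a b n i : ℕ) (x y k : ℕ) : V :=
  if x = a ∧ y = n then f a b k else if x = n ∧ y = a then f a b (i - k)
  else if x = n ∧ y = b then f a b (i + k) else if x = b ∧ y = n then f a b (L a b - k)
  else f x y k

namespace Frame
variable {G : SimpleGraph V} {es : List (ℕ × ℕ)} {S : Set V} {φ : ℕ → V}
    {f : ℕ → ℕ → ℕ → V} {L : ℕ → ℕ → ℕ}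

theorem subdiv (hF : Frame G es S φ f L) {a b n i : ℕ} (hab : EdgeIn es a b) (hi : 0 < i)
    (hi' : i < L a b) (hn : ∀ e ∈ es, e.1 ≠ n ∧ e.2 ≠ n) :
    Frame G (subEdges es a b n) S (Function.update φ n (f a b i)) (subMap f L a b n i)
      (subLen L a b n i) := by
  have hne := hF.ne _ _ hab
  have hfr : a ≠ n ∧ b ≠ n := by
    rcases hab with h | h
    · exact hn _ h
    · exact (hn _ h).symm
  obtain ⟨han, hbn⟩ := hfr
  have hkind : ∀ x y, (x, y) ∈ subEdges es a b n → (x = a ∧ y = n) ∨ (x = n ∧ y = b) ∨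
      ((x, y) ∈ es ∧ x ≠ n ∧ y ≠ n ∧ ¬ (x = a ∧ y = b) ∧ ¬ (x = b ∧ y = a)) := by
    intro x y h
    simp only [subEdges, List.mem_cons, List.mem_filter, Prod.mk.injEq, decide_eq_true_eq,
      ne_eq] at h
    rcases h with h | h | ⟨h, h1, h2⟩
    · exact .inl h
    · exact .inr (.inl h)
    · exact .inr (.inr ⟨h, (hn _ h).1, (hn _ h).2, h1, h2⟩)
  have L1 : subLen L a b n i a n = i := by simp [subLen]
  have L1' : subLen L a b n i n a = i := by simp [subLen]
  have L2 : subLen L a b n i n b = L a b - i := by simp [subLen, hne.symm, hbn, han.symm]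
  have L2' : subLen L a b n i b n = L a b - i := by simp [subLen, hne.symm, hbn, han.symm]
  have L3 : ∀ x y, x ≠ n → y ≠ n → subLen L a b n i x y = L x y := by
    intro x y h1 h2; simp [subLen, h1, h2]
  have M1 : ∀ k, subMap f L a b n i a n k = f a b k := by intro k; simp [subMap]
  have M1' : ∀ k, subMap f L a b n i n a k = f a b (i - k) := by
    intro k; simp [subMap, han.symm]
  have M2 : ∀ k, subMap f L a b n i n b k = f a b (i + k) := by
    intro k; simp [subMap, han.symm, hne.symm]
  have M2' : ∀ k, subMap f L a b n i b n k = f a b (L a b - k) := by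
    intro k; simp [subMap, hne.symm, hbn]
  have M3 : ∀ x y k, x ≠ n → y ≠ n → subMap f L a b n i x y k = f x y k := by
    intro x y k h1 h2; simp [subMap, h1, h2]
  have fin := hF.finish hab
  have st := hF.start _ _ hab
  apply of_oriented
  · intro x y h h'
    rcases hkind _ _ h with ⟨e1, e2⟩ | ⟨e1, e2⟩ | ⟨h, h1, h2, -⟩ <;>
    rcases hkind _ _ h' with ⟨e3, e4⟩ | ⟨e3, e4⟩ | ⟨h', h1', h2', -⟩
    on_goal 9 => exact hF.asymm _ _ h h'
    all_goals omega
  · intro x y h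
    rcases hkind _ _ h with ⟨rfl, rfl⟩ | ⟨rfl, rfl⟩ | ⟨h, -⟩
    · exact han
    · exact hbn.symm
    · exact hF.ne _ _ (.inl h)
  · intro x y h
    rcases hkind _ _ h with ⟨rfl, rfl⟩ | ⟨rfl, rfl⟩ | ⟨h, h1, h2, -⟩
    · rw [L1, L1']
    · rw [L2, L2']
    · rw [L3 _ _ h1 h2, L3 _ _ h2 h1, hF.Lsymm _ _ (.inl h)]
  · intro x y h
    rcases hkind _ _ h with ⟨rfl, rfl⟩ | ⟨rfl, rfl⟩ | ⟨h, h1, h2, -⟩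
    · omega
    · omega
    · rw [L3 _ _ h1 h2]; exact hF.Lpos _ _ (.inl h)
  · intro x y k h hk
    rcases hkind _ _ h with ⟨rfl, rfl⟩ | ⟨rfl, rfl⟩ | ⟨h, h1, h2, -⟩
    · rw [L1, M1, M1']
    · rw [L2] at hk; rw [L2, M2, M2']; congr 1; omega
    · rw [L3 _ _ h1 h2] at hk ⊢
      rw [M3 _ _ _ h1 h2, M3 _ _ _ h2 h1, hF.symm _ _ _ (.inl h) hk]
  · intro x y h
    rcases hkind _ _ h with ⟨rfl, rfl⟩ | ⟨rfl, rfl⟩ | ⟨h, h1, h2, -⟩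
    · rw [M1, Function.update_of_ne han, st]
    · rw [M2, Function.update_self, Nat.add_zero]
    · rw [M3 _ _ _ h1 h2, Function.update_of_ne h1, hF.start _ _ (.inl h)]
  · intro x y h
    rcases hkind _ _ h with ⟨rfl, rfl⟩ | ⟨rfl, rfl⟩ | ⟨h, h1, h2, -⟩
    · rw [M1, L1, Function.update_self]
    · rw [M2, L2, Function.update_of_ne hbn, ← fin]; congr 1; omega
    · rw [M3 _ _ _ h1 h2, Function.update_of_ne h2, L3 _ _ h1 h2, hF.finish (.inl h)]
  · intro x y k h hk
    rcases hkind _ _ h with ⟨rfl, rfl⟩ | ⟨rfl, rfl⟩ | ⟨h, h1, h2, -⟩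
    · rw [L1] at hk; rw [M1, M1]; exact hF.adj _ _ _ hab (by omega)
    · rw [L2] at hk; rw [M2, M2]; exact hF.adj _ _ _ hab (by omega)
    · rw [L3 _ _ h1 h2] at hk
      rw [M3 _ _ _ h1 h2, M3 _ _ _ h1 h2]; exact hF.adj _ _ _ (.inl h) hk
  · intro x y k x' y' k' h h' hk hk' he
    rcases hkind _ _ h with ⟨e1, e2⟩ | ⟨e1, e2⟩ | ⟨h, h1, h2, h3, h4⟩ <;>
    rcases hkind _ _ h' with ⟨e1', e2'⟩ | ⟨e1', e2'⟩ | ⟨h', h1', h2', h3', h4'⟩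
    · rw [e1, e2] at hk he ⊢
      rw [e1', e2'] at hk' he ⊢
      rw [L1] at hk hk'; rw [M1, M1] at he
      exact .inl ⟨rfl, rfl, hF.inj hab (by omega) (by omega) he⟩
    · rw [e1, e2] at hk he ⊢
      rw [e1', e2'] at hk' he ⊢
      rw [L1] at hk; rw [L2] at hk'; rw [M1, M2] at he
      have := hF.inj hab (by omega) (by omega) he
      exact .inr ⟨_, .inr ⟨by omega, rfl⟩, .inl ⟨by omega, rfl⟩⟩
    · rw [e1, e2] at hk he ⊢
      rw [L1] at hk; rw [L3 _ _ h1' h2'] at hk'; rw [M1, M3 _ _ _ h1' h2'] at he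
      rcases hF.inter _ _ _ _ _ _ hab (.inl h') (by omega) hk' he with h1 | h1 | ⟨c, hc, hc'⟩
      · omega
      · omega
      · refine .inr ⟨c, ?_, ?_⟩
        · unfold IsEnd at *; omega
        · unfold IsEnd at *; rw [L3 _ _ h1' h2']; exact hc'
    · rw [e1, e2] at hk he ⊢
      rw [e1', e2'] at hk' he ⊢
      rw [L2] at hk; rw [L1] at hk'; rw [M2, M1] at he
      have := hF.inj hab (by omega) (by omega) he
      exact .inr ⟨_, .inl ⟨by omega, rfl⟩, .inr ⟨by omega, rfl⟩⟩
    · rw [e1, e2] at hk he ⊢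
      rw [e1', e2'] at hk' he ⊢
      rw [L2] at hk hk'; rw [M2, M2] at he
      have := hF.inj hab (by omega) (by omega) he
      exact .inl ⟨rfl, rfl, by omega⟩
    · rw [e1, e2] at hk he ⊢
      rw [L2] at hk; rw [L3 _ _ h1' h2'] at hk'; rw [M2, M3 _ _ _ h1' h2'] at he
      rcases hF.inter _ _ _ _ _ _ hab (.inl h') (by omega) hk' he with h1 | h1 | ⟨c, hc, hc'⟩
      · omega
      · omega
      · refine .inr ⟨c, ?_, ?_⟩
        · unfold IsEnd at *; omega
        · unfold IsEnd at *; rw [L3 _ _ h1' h2']; exact hc'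
    · rw [e1', e2'] at hk' he ⊢
      rw [L1] at hk'; rw [L3 _ _ h1 h2] at hk; rw [M1, M3 _ _ _ h1 h2] at he
      rcases hF.inter _ _ _ _ _ _ (.inl h) hab hk (by omega) he with h1 | h1 | ⟨c, hc, hc'⟩
      · omega
      · omega
      · refine .inr ⟨c, ?_, ?_⟩
        · unfold IsEnd at *; rw [L3 _ _ h1 h2]; exact hc
        · unfold IsEnd at *; omega
    · rw [e1', e2'] at hk' he ⊢
      rw [L2] at hk'; rw [L3 _ _ h1 h2] at hk; rw [M2, M3 _ _ _ h1 h2] at he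
      rcases hF.inter _ _ _ _ _ _ (.inl h) hab hk (by omega) he with h1 | h1 | ⟨c, hc, hc'⟩
      · omega
      · omega
      · refine .inr ⟨c, ?_, ?_⟩
        · unfold IsEnd at *; rw [L3 _ _ h1 h2]; exact hc
        · unfold IsEnd at *; omega
    · rw [L3 _ _ h1 h2] at hk; rw [L3 _ _ h1' h2'] at hk'
      rw [M3 _ _ _ h1 h2, M3 _ _ _ h1' h2'] at he
      rcases hF.inter _ _ _ _ _ _ (.inl h) (.inl h') hk hk' he with h5 | h5 | ⟨c, hc, hc'⟩
      · exact .inl h5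
      · obtain ⟨rfl, rfl, h6⟩ := h5
        exact absurd h' (hF.asymm _ _ h)
      · exact .inr ⟨c, by unfold IsEnd at *; rwa [L3 _ _ h1 h2],
          by unfold IsEnd at *; rwa [L3 _ _ h1' h2']⟩
  · intro v
    rw [hF.verts]
    constructor
    · have hA : ∀ k, k ≤ L a b → ∃ x y k', (x, y) ∈ subEdges es a b n ∧
          k' ≤ subLen L a b n i x y ∧ f a b k = subMap f L a b n i x y k' := by
        intro k hk
        by_cases hki : k ≤ i
        · exact ⟨a, n, k, by simp [subEdges], by rwa [L1], (M1 k).symm⟩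
        · refine ⟨n, b, k - i, by simp [subEdges], by rw [L2]; omega, ?_⟩
          rw [M2]; congr 1; omega
      have hB : ∀ x y k, (x, y) ∈ es → k ≤ L x y → ∃ x' y' k', (x', y') ∈ subEdges es a b n ∧
          k' ≤ subLen L a b n i x' y' ∧ f x y k = subMap f L a b n i x' y' k' := by
        intro x y k h hk
        by_cases c1 : x = a ∧ y = b
        · rw [c1.1, c1.2] at hk ⊢; exact hA k hk
        by_cases c2 : x = b ∧ y = a
        · rw [c2.1, c2.2] at hk ⊢
          rw [hF.Lsymm _ _ hab] at hk
          rw [hF.symm _ _ _ hab hk]; exact hA _ (by omega)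
        refine ⟨x, y, k, ?_, ?_, ?_⟩
        · simp [subEdges, h, c1, c2]
        · rwa [L3 _ _ (hn _ h).1 (hn _ h).2]
        · rw [M3 _ _ _ (hn _ h).1 (hn _ h).2]
      rintro ⟨x, y, k, h | h, hk, rfl⟩
      · exact hB _ _ _ h hk
      · rw [hF.symm _ _ _ (.inl h) (by rwa [← hF.Lsymm _ _ (.inl h)])]
        exact hB _ _ _ h (by omega)
    · rintro ⟨x, y, k, h, hk, rfl⟩
      rcases hkind _ _ h with ⟨rfl, rfl⟩ | ⟨rfl, rfl⟩ | ⟨h, h1, h2, -⟩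
      · rw [L1] at hk; exact ⟨_, _, k, hab, by omega, M1 k⟩
      · rw [L2] at hk; exact ⟨_, _, i + k, hab, by omega, M2 k⟩
      · rw [L3 _ _ h1 h2] at hk
        exact ⟨x, y, k, .inl h, hk, M3 _ _ _ h1 h2⟩
end Frame

def basePairs : ℕ → List ℕ → List (ℕ × ℕ)
  | _, [] => []
  | x, y :: t => (x, y) :: basePairs y t

def baseLast : ℕ → List ℕ → ℕ
  | x, [] => x
  | _, y :: t => baseLast y t

def baseLength (L : ℕ → ℕ → ℕ) : ℕ → List ℕ → ℕ
  | _, [] => 0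
  | x, y :: t => L x y + baseLength L y t

theorem mem_of_mem_basePairs : ∀ (t : List ℕ) (x : ℕ) (e : ℕ × ℕ), e ∈ basePairs x t →
    e.1 ∈ x :: t ∧ e.2 ∈ x :: t
  | [], _, _, h => by simp [basePairs] at h
  | y :: t, x, e, h => by
    simp only [basePairs, List.mem_cons] at h
    rcases h with rfl | h
    · simp
    · have := mem_of_mem_basePairs t y e h
      exact ⟨List.mem_cons_of_mem _ this.1, List.mem_cons_of_mem _ this.2⟩

def OnBase (φ : ℕ → V) (f : ℕ → ℕ → ℕ → V) (L : ℕ → ℕ → ℕ) (x : ℕ) (t : List ℕ) (v : V) : Prop :=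
  v = φ x ∨ ∃ e ∈ basePairs x t, ∃ k ≤ L e.1 e.2, v = f e.1 e.2 k

theorem isPath_append_of_disjoint {G : SimpleGraph V} {a b c : V} {p : G.Walk a b}
    {q : G.Walk b c} (hp : p.IsPath) (hq : q.IsPath)
    (h : ∀ v ∈ p.support, v ∈ q.support.tail → False) : (p.append q).IsPath := by
  rw [Walk.isPath_def, Walk.support_append]
  exact List.Nodup.append hp.support_nodup hq.support_nodup.tail (fun v h1 h2 => h v h1 h2)

theorem start_notMem_tail {G : SimpleGraph V} {a b : V} {p : G.Walk a b} (hp : p.IsPath) :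
    a ∉ p.support.tail := by
  have := hp.support_nodup
  rw [← Walk.cons_tail_support p] at this
  exact (List.nodup_cons.1 this).1

theorem exists_walk_of_adj {G : SimpleGraph V} (g : ℕ → V) : ∀ n : ℕ,
    (∀ k < n, G.Adj (g k) (g (k + 1))) → ∃ W : G.Walk (g 0) (g n), W.length = n ∧
      W.support = (List.range (n + 1)).map g ∧ ∀ k < n, s(g k, g (k + 1)) ∈ W.edges
  | 0, _ => ⟨.nil, rfl, by simp, by simp⟩
  | n + 1, h => by
    obtain ⟨W, h1, h2, h3⟩ := exists_walk_of_adj g n (fun k hk => h k (by omega))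
    refine ⟨W.concat (h n (by omega)), by simp [h1], ?_, ?_⟩
    · rw [Walk.support_concat, h2, List.range_succ (n := n + 1)]
      simp
    · intro k hk
      rw [Walk.edges_concat]
      rcases Nat.lt_succ_iff_lt_or_eq.1 hk with h' | rfl
      · simp [h3 k h']
      · simp

def WeakJump (G : SimpleGraph V) (S : Set V) (z w : V) (m : ℕ) : Prop :=
  ∃ P : G.Walk z w, P.IsPath ∧ P.length = m ∧ 1 ≤ m ∧ ∀ v ∈ P.support, v ∈ S → v = z ∨ v = w

def Jump (G : SimpleGraph V) (S : Set V) (z w : V) (m : ℕ) (X : Set V) : Prop :=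
  ∃ P : G.Walk z w, P.IsPath ∧ P.length = m ∧ 2 ≤ m ∧ (∀ v ∈ P.support, v ∈ S → v = z ∨ v = w) ∧
    (∀ a ∈ P.support, ∀ b ∈ P.support, G.Adj a b → s(a, b) ∈ P.edges) ∧
    ∀ v ∈ P.support, v ∉ S → ∀ h ∈ S, G.Adj v h → s(v, h) ∈ P.edges ∨ h ∈ X

theorem WeakJump.symm {G : SimpleGraph V} {S : Set V} {z w : V} {m : ℕ}
    (h : WeakJump G S z w m) : WeakJump G S w z m := by
  obtain ⟨P, h1, h2, h3, h4⟩ := h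
  refine ⟨P.reverse, h1.reverse, by simpa, h3, fun v hv hS => (h4 v (by simpa using hv) hS).symm⟩

theorem Jump.symm {G : SimpleGraph V} {S : Set V} {z w : V} {m : ℕ} {X : Set V}
    (h : Jump G S z w m X) : Jump G S w z m X := by
  obtain ⟨P, h1, h2, h3, h4, h5, h6⟩ := h
  refine ⟨P.reverse, h1.reverse, by simpa, h3, fun v hv hS => (h4 v (by simpa using hv) hS).symm,
    ?_, ?_⟩
  · simpa using h5
  · simpa using h6

theorem Jump.weak {G : SimpleGraph V} {S : Set V} {z w : V} {m : ℕ} {X : Set V}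
    (h : Jump G S z w m X) : WeakJump G S z w m := by
  obtain ⟨P, h1, h2, h3, h4, h5, h6⟩ := h
  exact ⟨P, h1, h2, by omega, h4⟩

theorem Jump.mono {G : SimpleGraph V} {S : Set V} {z w : V} {m : ℕ} {X Y : Set V}
    (h : Jump G S z w m X) (hXY : X ⊆ Y) : Jump G S z w m Y := by
  obtain ⟨P, h1, h2, h3, h4, h5, h6⟩ := h
  exact ⟨P, h1, h2, h3, h4, h5, fun v hv hS h hh ha => (h6 v hv hS h hh ha).imp_right (@hXY _)⟩

theorem Jump.two_le {G : SimpleGraph V} {S : Set V} {z w : V} {m : ℕ} {X : Set V}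
    (h : Jump G S z w m X) : 2 ≤ m := by
  obtain ⟨P, h1, h2, h3, -⟩ := h
  exact h3

def HoleInduced (G : SimpleGraph V) (S : Set V) (es : List (ℕ × ℕ)) (f : ℕ → ℕ → ℕ → V)
    (L : ℕ → ℕ → ℕ) : Prop :=
  ∀ a ∈ S, ∀ b ∈ S, G.Adj a b → ∃ x y k, EdgeIn es x y ∧ k < L x y ∧ a = f x y k ∧ b = f x y (k + 1)

namespace Frame
variable {G : SimpleGraph V} {es : List (ℕ × ℕ)} {S : Set V} {φ : ℕ → V}
    {f : ℕ → ℕ → ℕ → V} {L : ℕ → ℕ → ℕ}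

theorem eq_end_of_onBase (hF : Frame G es S φ f L) {x : ℕ} {t : List ℕ} (hx : ∃ x', EdgeIn es x x')
    (ht : ∀ e ∈ basePairs x t, EdgeIn es e.1 e.2) {c d k : ℕ} (hcd : EdgeIn es c d)
    (hk : k ≤ L c d) (h1 : (c, d) ∉ basePairs x t) (h2 : (d, c) ∉ basePairs x t)
    (h : OnBase φ f L x t (f c d k)) : (k = 0 ∧ c ∈ x :: t) ∨ (k = L c d ∧ d ∈ x :: t) := by
  rcases h with h | ⟨e, he, k', hk', h⟩
  · obtain ⟨x', hx⟩ := hx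
    rw [← hF.start _ _ hx] at h
    have p := hF.Lpos _ _ hx
    rcases hF.inter _ _ _ _ _ _ hcd hx hk (by omega) h with h | h | ⟨c', h3, h4⟩
    · left; simp [h.1, h.2.2]
    · right; exact ⟨by omega, by simp [h.2.1]⟩
    · unfold IsEnd at h3 h4
      have : c' = x := by omega
      subst this
      rcases h3 with h3 | h3
      · left; simp [h3.1, h3.2]
      · right; simp [h3.1, h3.2]
  · rcases hF.inter _ _ _ _ _ _ hcd (ht _ he) hk hk' h with h | h | ⟨c', h3, h4⟩
    · exact absurd he (by rwa [show e = (c, d) from Prod.ext h.1.symm h.2.1.symm])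
    · exact absurd he (by rwa [show e = (d, c) from Prod.ext h.2.1.symm h.1.symm])
    · have hc' : c' ∈ x :: t := by
        have := mem_of_mem_basePairs t x e he
        rcases h4 with h4 | h4
        · rw [h4.2]; exact this.1
        · rw [h4.2]; exact this.2
      rcases h3 with h3 | h3
      · left; exact ⟨h3.1, h3.2 ▸ hc'⟩
      · right; exact ⟨h3.1, h3.2 ▸ hc'⟩

theorem onBase_mem (hF : Frame G es S φ f L) {x : ℕ} {t : List ℕ} (hx : ∃ x', EdgeIn es x x')
    (ht : ∀ e ∈ basePairs x t, EdgeIn es e.1 e.2) {v : V} (h : OnBase φ f L x t v) : v ∈ S := by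
  rcases h with rfl | ⟨e, he, k, hk, rfl⟩
  · obtain ⟨x', hx⟩ := hx
    rw [← hF.start _ _ hx]; exact hF.mem hx (by omega)
  · exact hF.mem (ht _ he) hk

theorem exists_basePath (hF : Frame G es S φ f L) : ∀ (t : List ℕ) (x : ℕ) {z : V}, φ (baseLast x t) = z →
    (x :: t).Nodup → (∀ e ∈ basePairs x t, EdgeIn es e.1 e.2) → ∃ R : G.Walk (φ x) z, R.IsPath ∧
      R.length = baseLength L x t ∧ (∀ v, v ∈ R.support ↔ OnBase φ f L x t v) ∧
      ∀ e ∈ basePairs x t, ∀ k < L e.1 e.2, s(f e.1 e.2 k, f e.1 e.2 (k + 1)) ∈ R.edges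
  | [], x, _, hz, _, _ => by
    obtain rfl : φ x = _ := hz
    exact ⟨.nil, by simp, rfl, by simp [OnBase, basePairs], by simp [basePairs]⟩
  | y :: t, x, z, hz, hnd, hp => by
    have hz : φ (baseLast y t) = z := hz
    have hxy : EdgeIn es x y := hp (x, y) (by simp [basePairs])
    have ht : ∀ e ∈ basePairs y t, EdgeIn es e.1 e.2 :=
      fun e he => hp e (by simp [basePairs, he])
    obtain ⟨R, h1, h2, h3, h4⟩ := exists_basePath hF t y hz (List.nodup_cons.1 hnd).2 ht
    obtain ⟨W, w1, w2, w3⟩ := exists_walk_of_adj (G := G) (f x y) (L x y)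
      (fun k hk => hF.adj _ _ _ hxy hk)
    have hW : W.IsPath := by
      rw [Walk.isPath_def, w2]
      refine List.Nodup.map_on ?_ List.nodup_range
      intro a ha b hb hab
      simp only [List.mem_range] at ha hb
      exact hF.inj hxy (by omega) (by omega) hab
    have hWs : ∀ v, v ∈ W.support ↔ ∃ k ≤ L x y, v = f x y k := by
      intro v; rw [w2]; simp [eq_comm]
    obtain ⟨hst, hfin⟩ := And.intro (hF.start _ _ hxy) (hF.finish hxy)
    have hxn : x ∉ y :: t := (List.nodup_cons.1 hnd).1
    have hdis : ∀ v ∈ W.support, v ∈ R.support → v = φ y := by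
      intro v hv hv'
      obtain ⟨k, hk, rfl⟩ := (hWs v).1 hv
      rcases hF.eq_end_of_onBase ⟨x, hxy.symm⟩ ht hxy hk
        (fun h => hxn (mem_of_mem_basePairs t y _ h).1)
        (fun h => hxn (mem_of_mem_basePairs t y _ h).2) ((h3 _).1 hv') with h | h
      · exact absurd h.2 hxn
      · rw [h.1, hfin]
    refine ⟨(W.copy hst hfin).append R, isPath_append_of_disjoint (by simpa) h1 ?_, ?_, ?_, ?_⟩
    · intro v hv hv'
      have := hdis v (by simpa using hv) (List.mem_of_mem_tail hv')
      subst this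
      exact start_notMem_tail h1 hv'
    · simp [baseLength, h2, w1]
    · intro v
      rw [Walk.mem_support_append_iff, Walk.support_copy, hWs, h3]
      constructor
      · rintro (⟨k, hk, rfl⟩ | rfl | ⟨e, he, k, hk, rfl⟩)
        · exact .inr ⟨(x, y), by simp [basePairs], k, hk, rfl⟩
        · exact .inr ⟨(x, y), by simp [basePairs], _, le_rfl, hfin.symm⟩
        · exact .inr ⟨e, by simp [basePairs, he], k, hk, rfl⟩
      · rintro (rfl | ⟨e, he, k, hk, rfl⟩)
        · exact .inl ⟨0, by omega, hst.symm⟩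
        · simp only [basePairs, List.mem_cons] at he
          rcases he with rfl | he
          · exact .inl ⟨k, hk, rfl⟩
          · exact .inr (.inr ⟨e, he, k, hk, rfl⟩)
    · intro e he k hk
      rw [Walk.edges_append, Walk.edges_copy, List.mem_append]
      simp only [basePairs, List.mem_cons] at he
      rcases he with rfl | he
      · exact .inl (w3 k hk)
      · exact .inr (h4 e he k hk)

theorem exists_edgeIn_of_ne_nil {x : ℕ} {t : List ℕ} (h0 : t ≠ [])
    (ht : ∀ e ∈ basePairs x t, EdgeIn es e.1 e.2) : ∃ x', EdgeIn es x x' := by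
  cases t with
  | nil => exact absurd rfl h0
  | cons y t => exact ⟨y, ht (x, y) (by simp [basePairs])⟩

theorem le_of_weakJump (hF : Frame G es S φ f L) {g : ℕ}
    (hg : ∀ v (c : G.Walk v v), c.IsCycle → g ≤ c.length) (x : ℕ) (t : List ℕ) {z w : V} {m : ℕ}
    (hJ : WeakJump G S z w m) (hz : φ (baseLast x t) = z) (hw : φ x = w)
    (h0 : t ≠ [] := by decide) (hnd : (x :: t).Nodup := by decide)
    (ht : ∀ e ∈ basePairs x t, EdgeIn es e.1 e.2 := by decide)
    (hm : 1 < baseLength L x t ∨ 1 < m) : g ≤ baseLength L x t + m := by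
  subst hz hw
  obtain ⟨R, h1, h2, h3, h4⟩ := hF.exists_basePath t x rfl hnd ht
  obtain ⟨P, p1, p2, p3, p4⟩ := hJ
  have hx := exists_edgeIn_of_ne_nil h0 ht
  have := hg _ _ (h1.isCycle_append p1 (by
    intro v hv hv'
    rcases p4 v (List.mem_of_mem_tail hv')
      (hF.onBase_mem hx ht ((h3 v).1 (List.mem_of_mem_tail hv))) with rfl | rfl
    · exact start_notMem_tail p1 hv'
    · exact start_notMem_tail h1 hv) (by omega))
  rw [Walk.length_append, h2, p2] at this
  exact this

theorem le_of_edge (hF : Frame G es S φ f L) {g : ℕ}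
    (hg : ∀ v (c : G.Walk v v), c.IsCycle → g ≤ c.length) (x : ℕ) (t : List ℕ)
    (hnd : (x :: t).Nodup := by decide)
    (ht : ∀ e ∈ basePairs x t, EdgeIn es e.1 e.2 := by decide)
    (hb : EdgeIn es (baseLast x t) x := by decide)
    (hb1 : (baseLast x t, x) ∉ basePairs x t := by decide)
    (hb2 : (x, baseLast x t) ∉ basePairs x t := by decide)
    (hm : 1 < baseLength L x t) : g ≤ baseLength L x t + L (baseLast x t) x := by
  obtain ⟨R, h1, h2, h3, h4⟩ := hF.exists_basePath t x rfl hnd ht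
  have hbne := hF.ne _ _ hb
  obtain ⟨P, p1, p2, p3, p4⟩ := hF.exists_basePath [x] (baseLast x t) (z := φ x) rfl (by simp [hbne])
    (by simpa [basePairs] using hb)
  have := hg _ _ (h1.isCycle_append p1 (by
    intro v hv hv'
    have e1 := (h3 v).1 (List.mem_of_mem_tail hv)
    have e2 := (p3 v).1 (List.mem_of_mem_tail hv')
    rcases e2 with rfl | ⟨e, he, k, hk, rfl⟩
    · exact start_notMem_tail p1 hv'
    · simp only [basePairs, List.mem_cons, List.not_mem_nil, or_false] at he
      subst he
      rcases hF.eq_end_of_onBase ⟨_, hb.symm⟩ ht hb hk hb1 hb2 e1 with h | h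
      · rw [h.1] at hv'
        rw [hF.start _ _ hb] at hv'
        exact start_notMem_tail p1 hv'
      · rw [h.1, hF.finish hb] at hv
        exact start_notMem_tail h1 hv) (by omega))
  rw [Walk.length_append, h2, p2] at this
  simpa [baseLength] using this

end Frame

structure NearGirth (G : SimpleGraph V) (g : ℕ) : Prop where
  le : ∀ v (c : G.Walk v v), c.IsCycle → g ≤ c.length
  eq : ∀ v (c : G.Walk v v), c.IsCycle →
    (∀ a ∈ c.support, ∀ b ∈ c.support, G.Adj a b → s(a, b) ∈ c.edges) → Odd c.length → c.length = g

namespace Frame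
variable {G : SimpleGraph V} {es : List (ℕ × ℕ)} {S : Set V} {φ : ℕ → V}
    {f : ℕ → ℕ → ℕ → V} {L : ℕ → ℕ → ℕ}

theorem eq_or_even (hF : Frame G es S φ f L) {g : ℕ} (hg : NearGirth G g)
    (hI : HoleInduced G S es f L) {X : Set V} (x : ℕ) (t : List ℕ) {z w : V} {m : ℕ}
    (hJ : Jump G S z w m X) (hz : φ (baseLast x t) = z) (hw : φ x = w) (cs : List (ℕ × ℕ))
    (hcs : ∀ e ∈ cs, 2 ≤ L e.1 e.2)
    (hX : ∀ h ∈ X, ¬ OnBase φ f L x t h)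
    (hc : ∀ e ∈ es, e.1 ∈ x :: t → e.2 ∈ x :: t → e ∈ basePairs x t ∨ (e.2, e.1) ∈ basePairs x t ∨
      e ∈ cs := by decide)
    (h0 : t ≠ [] := by decide) (hnd : (x :: t).Nodup := by decide)
    (ht : ∀ e ∈ basePairs x t, EdgeIn es e.1 e.2 := by decide) :
    g ≤ baseLength L x t + m ∧
      (baseLength L x t + m = g ∨ (baseLength L x t + m) % 2 = 0) := by
  have hle := hF.le_of_weakJump hg.le x t hJ.weak hz hw h0 hnd ht (.inr hJ.two_le)
  refine ⟨hle, ?_⟩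
  clear hle
  subst hz hw
  obtain ⟨R, h1, h2, h3, h4⟩ := hF.exists_basePath t x rfl hnd ht
  obtain ⟨P, p1, p2, p3, p4, p5, p6⟩ := hJ
  have hx := exists_edgeIn_of_ne_nil h0 ht
  have hRS : ∀ v ∈ R.support, v ∈ S := fun v hv => hF.onBase_mem hx ht ((h3 v).1 hv)
  have hcyc := h1.isCycle_append p1 (by
    intro v hv hv'
    rcases p4 v (List.mem_of_mem_tail hv') (hRS v (List.mem_of_mem_tail hv)) with rfl | rfl
    · exact start_notMem_tail p1 hv'
    · exact start_notMem_tail h1 hv) (.inr (by omega))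
  have hlen : (R.append P).length = baseLength L x t + m := by rw [Walk.length_append, h2, p2]
  rw [← hlen]
  rcases Nat.even_or_odd (R.append P).length with h | h
  · right; exact Nat.even_iff.1 h
  left
  refine hg.eq _ _ hcyc ?_ h
  have hsup : ∀ v ∈ (R.append P).support, v ∈ S → v ∈ R.support := by
    intro v hv hS
    rcases (Walk.mem_support_append_iff ..).1 hv with h | h
    · exact h
    · rcases p4 v h hS with rfl | rfl
      · exact Walk.end_mem_support _
      · exact Walk.start_mem_support _
  have hout : ∀ a ∈ (R.append P).support, ∀ b ∈ (R.append P).support, G.Adj a b → a ∉ S →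
      s(a, b) ∈ (R.append P).edges := by
    intro a ha b hb hab haS
    rw [Walk.edges_append, List.mem_append]
    right
    have haP : a ∈ P.support := by
      rcases (Walk.mem_support_append_iff ..).1 ha with h | h
      · exact absurd (hRS _ h) haS
      · exact h
    by_cases hbS : b ∈ S
    · rcases p6 a haP haS b hbS hab with h | h
      · exact h
      · exact absurd ((h3 _).1 (hsup _ hb hbS)) (hX _ h)
    · have hbP : b ∈ P.support := by
        rcases (Walk.mem_support_append_iff ..).1 hb with h | h
        · exact absurd (hRS _ h) hbS
        · exact h
      exact p5 a haP b hbP hab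
  intro a ha b hb hab
  by_cases haS : a ∈ S
  · by_cases hbS : b ∈ S
    · obtain ⟨c, d, k, hcd, hk, ea, eb⟩ := hI a haS b hbS hab
      rw [Walk.edges_append, List.mem_append]
      left
      by_cases q1 : (c, d) ∈ basePairs x t
      · rw [ea, eb]; exact h4 _ q1 k hk
      by_cases q2 : (d, c) ∈ basePairs x t
      · have e0 := hF.Lsymm _ _ hcd
        have := h4 _ q2 (L c d - (k + 1)) (by simp only; omega)
        simp only at this
        rw [hF.symm _ _ _ hcd (by omega), hF.symm _ _ _ hcd (by omega),
          show L c d - (L c d - (k + 1)) = k + 1 by omega,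
          show L c d - (L c d - (k + 1) + 1) = k by omega, Sym2.eq_swap] at this
        rw [ea, eb]; exact this
      exfalso
      have k1 := hF.eq_end_of_onBase hx ht hcd hk.le q1 q2 (by
        rw [← ea]; exact (h3 _).1 (hsup _ ha haS))
      have k2 := hF.eq_end_of_onBase hx ht hcd (k := k + 1) hk q1 q2 (by
        rw [← eb]; exact (h3 _).1 (hsup _ hb hbS))
      have k3 : c ∈ x :: t ∧ d ∈ x :: t ∧ L c d = 1 := by
        rcases k1 with k1 | k1 <;> rcases k2 with k2 | k2
        · omega
        · exact ⟨k1.2, k2.2, by omega⟩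
        · omega
        · omega
      obtain ⟨k3, k4, k5⟩ := k3
      rcases hcd with h | h
      · rcases hc _ h k3 k4 with h | h | h
        · exact q1 h
        · exact q2 h
        · have := hcs _ h; simp only at this; omega
      · rcases hc _ h k4 k3 with h' | h' | h'
        · exact q2 h'
        · exact q1 h'
        · have := hcs _ h'; have e0 := hF.Lsymm _ _ (.inl h : EdgeIn es d c); simp only at this; omega
    · rw [Sym2.eq_swap]; exact hout b hb a ha hab.symm hbS
  · exact hout a ha b hb hab haS

theorem HoleInduced.subdiv (hF : Frame G es S φ f L) (hI : HoleInduced G S es f L) {a b n i : ℕ}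
    (hab : EdgeIn es a b) (hi' : i < L a b) (hn : ∀ e ∈ es, e.1 ≠ n ∧ e.2 ≠ n) :
    HoleInduced G S (subEdges es a b n) (subMap f L a b n i) (subLen L a b n i) := by
  have hne := hF.ne _ _ hab
  have hfr : ∀ x y, EdgeIn es x y → x ≠ n ∧ y ≠ n := by
    rintro x y (h | h)
    · exact hn _ h
    · exact (hn _ h).symm
  obtain ⟨han, hbn⟩ := hfr _ _ hab
  have L1 : subLen L a b n i a n = i := by simp [subLen]
  have L1' : subLen L a b n i n a = i := by simp [subLen]
  have L2 : subLen L a b n i n b = L a b - i := by simp [subLen, hne.symm, hbn, han.symm]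
  have L2' : subLen L a b n i b n = L a b - i := by simp [subLen, hne.symm, hbn, han.symm]
  have M1 : ∀ k, subMap f L a b n i a n k = f a b k := by intro k; simp [subMap]
  have M1' : ∀ k, subMap f L a b n i n a k = f a b (i - k) := by
    intro k; simp [subMap, han.symm]
  have M2 : ∀ k, subMap f L a b n i n b k = f a b (i + k) := by
    intro k; simp [subMap, han.symm, hne.symm]
  have M2' : ∀ k, subMap f L a b n i b n k = f a b (L a b - k) := by
    intro k; simp [subMap, hne.symm, hbn]
  have E1 : EdgeIn (subEdges es a b n) a n := by simp [EdgeIn, subEdges]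
  have E2 : EdgeIn (subEdges es a b n) n b := by simp [EdgeIn, subEdges]
  intro u hu v hv huv
  obtain ⟨x, y, k, hxy, hk, rfl, rfl⟩ := hI u hu v hv huv
  obtain ⟨hx, hy⟩ := hfr _ _ hxy
  by_cases c1 : x = a ∧ y = b
  · obtain ⟨rfl, rfl⟩ := c1
    by_cases hki : k < i
    · exact ⟨x, n, k, E1, by omega, (M1 _).symm, (M1 _).symm⟩
    · refine ⟨n, y, k - i, E2, by omega, ?_, ?_⟩
      · rw [M2]; congr 1; omega
      · rw [M2]; congr 1; omega
  by_cases c2 : x = b ∧ y = a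
  · obtain ⟨rfl, rfl⟩ := c2
    have e0 := hF.Lsymm _ _ hab
    by_cases hki : k < L y x - i
    · refine ⟨x, n, k, E2.symm, by omega, ?_, ?_⟩
      · rw [M2', hF.symm _ _ _ hab (by omega)]
      · rw [M2', hF.symm _ _ _ hab (by omega)]
    · refine ⟨n, y, k - (L y x - i), E1.symm, by omega, ?_, ?_⟩
      · rw [M1', hF.symm _ _ _ hab (by omega)]; congr 1; omega
      · rw [M1', hF.symm _ _ _ hab (by omega)]; congr 1; omega
  refine ⟨x, y, k, ?_, ?_, ?_, ?_⟩
  · rcases hxy with h | h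
    · left; simp [subEdges, h, c1, c2]
    · have c3 : ¬ (y = a ∧ x = b) := fun h => c2 ⟨h.2, h.1⟩
      have c4 : ¬ (y = b ∧ x = a) := fun h => c1 ⟨h.2, h.1⟩
      right; simp [subEdges, h, c3, c4]
  · simpa [subLen, hx, hy] using hk
  · simp [subMap, hx, hy]
  · simp [subMap, hx, hy]

end Frame

abbrev k4Edges : List (ℕ × ℕ) := [(0, 1), (2, 3), (1, 2), (0, 3), (0, 2), (1, 3)]

theorem edgeIn_k4Edges {x y : ℕ} : EdgeIn k4Edges x y ↔ x < 4 ∧ y < 4 ∧ x ≠ y := by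
  simp only [EdgeIn, List.mem_cons, Prod.mk.injEq, List.not_mem_nil, or_false]
  omega

structure K4Frame (G : SimpleGraph V) (l : ℕ) (S : Set V) (φ : ℕ → V)
    (f : ℕ → ℕ → ℕ → V) (L : ℕ → ℕ → ℕ) : Prop extends Frame G k4Edges S φ f L where
  opp : ∀ a b c d, [a, b, c, d].Nodup → a < 4 → b < 4 → c < 4 → d < 4 → L a b = L c d
  tri : ∀ a b c, [a, b, c].Nodup → a < 4 → b < 4 → c < 4 → L a b + L b c + L a c = 2 * l + 1

def sel (x y z w : ℕ) : ℕ → ℕ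
  | 0 => x
  | 1 => y
  | 2 => z
  | _ => w

def IsPerm4 (σ : ℕ → ℕ) : Prop :=
  (∀ i < 4, σ i < 4) ∧ (∀ i < 4, ∀ j < 4, σ i = σ j → i = j) ∧ ∀ c < 4, ∃ i < 4, σ i = c

instance (σ : ℕ → ℕ) : Decidable (IsPerm4 σ) := by unfold IsPerm4; infer_instance

namespace Frame
variable {G : SimpleGraph V} {es : List (ℕ × ℕ)} {S : Set V} {φ : ℕ → V}
    {f : ℕ → ℕ → ℕ → V} {L : ℕ → ℕ → ℕ}

theorem le_of_weakJump_same (hF : Frame G es S φ f L) {g : ℕ} (hg : NearGirth G g) {x y : ℕ}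
    (h : EdgeIn es x y) {i j m : ℕ} (hij : i < j) (hj : j ≤ L x y)
    (hJ : WeakJump G S (f x y j) (f x y i) m) (hm : 1 < j - i ∨ 1 < m) : g ≤ j - i + m := by
  obtain ⟨W, w1, w2, w3⟩ := exists_walk_of_adj (G := G) (fun k => f x y (i + k)) (j - i)
      (fun k hk => hF.adj _ _ _ h (by omega))
  obtain ⟨P, p1, p2, p3, p4⟩ := hJ
  have hW : W.IsPath := by
    rw [Walk.isPath_def, w2]
    refine List.Nodup.map_on ?_ List.nodup_range
    intro a ha b hb hab
    simp only [List.mem_range] at ha hb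
    have := hF.inj h (by omega) (by omega) hab
    omega
  have e1 : f x y (i + 0) = f x y i := by simp
  have e2 : f x y (i + (j - i)) = f x y j := by congr 1; omega
  have := hg.le _ _ (Walk.IsPath.isCycle_append (p := W.copy e1 e2) (by simpa) p1 (by
    intro v hv hv'
    have hvS : v ∈ S := by
      have := List.mem_of_mem_tail hv
      rw [Walk.support_copy, w2, List.mem_map] at this
      obtain ⟨k, hk, rfl⟩ := this
      rw [List.mem_range] at hk
      exact hF.mem h (by omega)
    rcases p4 v (List.mem_of_mem_tail hv') hvS with rfl | rfl
    · exact start_notMem_tail p1 hv'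
    · exact start_notMem_tail (p := W.copy e1 e2) (by simpa) hv) (by simp; omega))
  simpa [w1, p2] using this

end Frame

namespace K4Frame
variable {G : SimpleGraph V} {l : ℕ} {S : Set V} {φ : ℕ → V}
    {f : ℕ → ℕ → ℕ → V} {L : ℕ → ℕ → ℕ}

theorem relabel (K : K4Frame G l S φ f L) (σ : ℕ → ℕ) (hσ : IsPerm4 σ) :
    K4Frame G l S (fun x => φ (σ x)) (fun x y => f (σ x) (σ y)) (fun x y => L (σ x) (σ y)) := by
  obtain ⟨h1, h2, h3⟩ := hσ
  have hE : ∀ x y, EdgeIn k4Edges x y → EdgeIn k4Edges (σ x) (σ y) := by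
    intro x y h
    rw [edgeIn_k4Edges] at h ⊢
    exact ⟨h1 _ h.1, h1 _ h.2.1, fun e => h.2.2 (h2 _ h.1 _ h.2.1 e)⟩
  refine ⟨⟨K.asymm, K.ne, ?_, ?_, ?_, ?_, ?_, ?_, ?_⟩, ?_, ?_⟩
  · intro x y h; exact K.Lsymm _ _ (hE _ _ h)
  · intro x y h; exact K.Lpos _ _ (hE _ _ h)
  · intro x y k h; exact K.symm _ _ _ (hE _ _ h)
  · intro x y h; exact K.start _ _ (hE _ _ h)
  · intro x y k h; exact K.adj _ _ _ (hE _ _ h)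
  · intro x y k x' y' k' h h' hk hk' he
    have q := edgeIn_k4Edges.1 h
    have q' := edgeIn_k4Edges.1 h'
    rcases K.inter _ _ _ _ _ _ (hE _ _ h) (hE _ _ h') hk hk' he with e | e | ⟨c, e, e'⟩
    · exact .inl ⟨h2 _ q.1 _ q'.1 e.1, h2 _ q.2.1 _ q'.2.1 e.2.1, e.2.2⟩
    · exact .inr (.inl ⟨h2 _ q.1 _ q'.2.1 e.1, h2 _ q.2.1 _ q'.1 e.2.1, e.2.2⟩)
    · right; right
      have hc : c < 4 := by
        rcases e with e | e
        · rw [e.2]; exact h1 _ q.1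
        · rw [e.2]; exact h1 _ q.2.1
      obtain ⟨d, hd, rfl⟩ := h3 c hc
      refine ⟨d, ?_, ?_⟩
      · exact e.imp (fun e => ⟨e.1, h2 _ hd _ q.1 e.2⟩) (fun e => ⟨e.1, h2 _ hd _ q.2.1 e.2⟩)
      · exact e'.imp (fun e => ⟨e.1, h2 _ hd _ q'.1 e.2⟩) (fun e => ⟨e.1, h2 _ hd _ q'.2.1 e.2⟩)
  · intro v
    rw [K.verts]
    constructor
    · rintro ⟨x, y, k, h, hk, rfl⟩
      rw [edgeIn_k4Edges] at h
      obtain ⟨x, hx, rfl⟩ := h3 _ h.1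
      obtain ⟨y, hy, rfl⟩ := h3 _ h.2.1
      exact ⟨x, y, k, edgeIn_k4Edges.2 ⟨hx, hy, fun e => h.2.2 (by rw [e])⟩, hk, rfl⟩
    · rintro ⟨x, y, k, h, hk, rfl⟩
      exact ⟨_, _, k, hE _ _ h, hk, rfl⟩
  · intro a b c d hn ha hb hc hd
    refine K.opp _ _ _ _ ?_ (h1 _ ha) (h1 _ hb) (h1 _ hc) (h1 _ hd)
    refine (List.nodup_map_iff_inj_on (f := σ) hn).2 ?_
    intro x hx y hy
    simp only [List.mem_cons, List.not_mem_nil, or_false] at hx hy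
    exact h2 _ (by omega) _ (by omega)
  · intro a b c hn ha hb hc
    refine K.tri _ _ _ ?_ (h1 _ ha) (h1 _ hb) (h1 _ hc)
    refine (List.nodup_map_iff_inj_on (f := σ) hn).2 ?_
    intro x hx y hy
    simp only [List.mem_cons, List.not_mem_nil, or_false] at hx hy
    exact h2 _ (by omega) _ (by omega)

structure Lens (L : ℕ → ℕ → ℕ) (l : ℕ) : Prop where
  h10 : L 1 0 = L 0 1
  h23 : L 2 3 = L 0 1
  h32 : L 3 2 = L 0 1
  h21 : L 2 1 = L 1 2
  h03 : L 0 3 = L 1 2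
  h30 : L 3 0 = L 1 2
  h20 : L 2 0 = L 0 2
  h13 : L 1 3 = L 0 2
  h31 : L 3 1 = L 0 2
  sum : L 0 1 + L 1 2 + L 0 2 = 2 * l + 1
  p1 : 1 ≤ L 0 1
  q1 : 1 ≤ L 1 2
  r1 : 1 ≤ L 0 2
  pl : L 0 1 ≤ l
  ql : L 1 2 ≤ l
  rl : L 0 2 ≤ l

theorem lens (K : K4Frame G l S φ f L) (hg : NearGirth G (2 * l + 1)) : Lens L l := by
  have h10 := K.Lsymm 0 1 (by decide)
  have h32 := K.Lsymm 2 3 (by decide)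
  have h21 := K.Lsymm 1 2 (by decide)
  have h30 := K.Lsymm 0 3 (by decide)
  have h20 := K.Lsymm 0 2 (by decide)
  have h31 := K.Lsymm 1 3 (by decide)
  have p1 := K.Lpos 0 1 (by decide)
  have q1 := K.Lpos 1 2 (by decide)
  have r1 := K.Lpos 0 2 (by decide)
  have o1 := K.opp 0 1 2 3 (by decide) (by decide) (by decide) (by decide) (by decide)
  have o2 := K.opp 0 3 1 2 (by decide) (by decide) (by decide) (by decide) (by decide)
  have o3 := K.opp 0 2 1 3 (by decide) (by decide) (by decide) (by decide) (by decide)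
  have t := K.tri 0 1 2 (by decide) (by decide) (by decide) (by decide)
  have c1 := K.le_of_edge hg.le 0 [1, 2, 3] (hm := by simp [baseLength]; omega)
  have c2 := K.le_of_edge hg.le 0 [1, 3, 2] (hm := by simp [baseLength]; omega)
  have c3 := K.le_of_edge hg.le 0 [2, 1, 3] (hm := by simp [baseLength]; omega)
  simp only [baseLength, baseLast] at c1 c2 c3
  constructor <;> omega

end K4Frame

theorem isPerm4_sel : ∀ x < 4, ∀ y < 4, ∀ z < 4, ∀ w < 4, [x, y, z, w].Nodup →
    IsPerm4 (sel x y z w) := by decide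

theorem exists_fourth : ∀ x < 4, ∀ y < 4, ∀ z < 4, [x, y, z].Nodup →
    ∃ w < 4, [x, y, z, w].Nodup := by decide

namespace K4Frame
variable {G : SimpleGraph V} {l : ℕ} {S : Set V} {φ : ℕ → V}
    {f : ℕ → ℕ → ℕ → V} {L : ℕ → ℕ → ℕ}

theorem cases_mem (K : K4Frame G l S φ f L) {v : V} (hv : v ∈ S) :
    (∃ c < 4, v = φ c) ∨ ∃ x y k, EdgeIn k4Edges x y ∧ 0 < k ∧ k < L x y ∧ v = f x y k := by
  obtain ⟨x, y, k, h, hk, rfl⟩ := (K.verts v).1 hv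
  have q := edgeIn_k4Edges.1 h
  rcases Nat.eq_zero_or_pos k with rfl | h0
  · exact .inl ⟨x, q.1, K.start _ _ h⟩
  rcases hk.lt_or_eq with h1 | rfl
  · exact .inr ⟨x, y, k, h, h0, h1, rfl⟩
  · exact .inl ⟨y, q.2.1, K.finish h⟩

theorem pair_cases (K : K4Frame G l S φ f L) {motive : V → V → Prop}
    (hsymm : ∀ a b, motive a b → motive b a)
    (same : ∀ x y i j, EdgeIn k4Edges x y → i < j → j ≤ L x y → motive (f x y i) (f x y j))
    (adjacent : ∀ σ, IsPerm4 σ → ∀ i t, 0 < i → i < L (σ 0) (σ 1) → 0 < t → t < L (σ 1) (σ 2) →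
      motive (f (σ 0) (σ 1) i) (f (σ 1) (σ 2) t))
    (branch : ∀ σ, IsPerm4 σ → ∀ i, 0 < i → i < L (σ 0) (σ 1) →
      motive (f (σ 0) (σ 1) i) (φ (σ 2)))
    (opposite : ∀ σ, IsPerm4 σ → ∀ i j, 0 < i → i < L (σ 0) (σ 1) → 0 < j → j < L (σ 2) (σ 3) →
      motive (f (σ 0) (σ 1) i) (f (σ 2) (σ 3) j)) :
    ∀ a ∈ S, ∀ b ∈ S, a ≠ b → motive a b := by
  have hb : ∀ x y i c, EdgeIn k4Edges x y → 0 < i → i < L x y → c < 4 →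
      motive (f x y i) (φ c) := by
    intro x y i c h h0 h1 hc
    have q := edgeIn_k4Edges.1 h
    by_cases c1 : c = x
    · rw [c1, ← K.start _ _ h]; exact hsymm _ _ (same _ _ _ _ h h0 h1.le)
    by_cases c2 : c = y
    · rw [c2, ← K.finish h]; exact same _ _ _ _ h h1 le_rfl
    obtain ⟨w, hw, hn⟩ := exists_fourth x q.1 y q.2.1 c hc (by simp; omega)
    exact branch (sel x y c w) (isPerm4_sel _ q.1 _ q.2.1 _ hc _ hw hn) i h0 h1
  have hadj : ∀ x y z i t, EdgeIn k4Edges x y → EdgeIn k4Edges y z → x ≠ z → 0 < i → i < L x y →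
      0 < t → t < L y z → motive (f x y i) (f y z t) := by
    intro x y z i t h h' hxz h0 h1 h2 h3
    have q := edgeIn_k4Edges.1 h
    have q' := edgeIn_k4Edges.1 h'
    obtain ⟨w, hw, hn⟩ := exists_fourth x q.1 y q.2.1 z q'.2.1 (by simp; omega)
    exact adjacent (sel x y z w) (isPerm4_sel _ q.1 _ q.2.1 _ q'.2.1 _ hw hn) i t h0 h1 h2 h3
  intro a ha b hb' hab
  rcases K.cases_mem ha with ⟨c, hc, rfl⟩ | ⟨x, y, i, h, h0, h1, rfl⟩ <;>
  rcases K.cases_mem hb' with ⟨d, hd, rfl⟩ | ⟨x', y', j, h', h0', h1', rfl⟩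
  · have h : EdgeIn k4Edges c d := edgeIn_k4Edges.2 ⟨hc, hd, fun e => hab (by rw [e])⟩
    rw [← K.start _ _ h, ← K.finish h]
    exact same _ _ _ _ h (K.Lpos _ _ h) le_rfl
  · exact hsymm _ _ (hb _ _ _ _ h' h0' h1' hc)
  · exact hb _ _ _ _ h h0 h1 hd
  have q := edgeIn_k4Edges.1 h
  have q' := edgeIn_k4Edges.1 h'
  have e := K.Lsymm _ _ h
  have e' := K.Lsymm _ _ h'
  have flip : f x y i = f y x (L x y - i) := by
    rw [K.symm _ _ _ h (by omega)]; congr 1; omega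
  have flip' : f x' y' j = f y' x' (L x' y' - j) := by
    rw [K.symm _ _ _ h' (by omega)]; congr 1; omega
  have hsame : ∀ j, j ≤ L x y → f x y i ≠ f x y j → motive (f x y i) (f x y j) := by
    intro j hj hne
    rcases lt_trichotomy i j with h2 | rfl | h2
    · exact same _ _ _ _ h h2 hj
    · exact absurd rfl hne
    · exact hsymm _ _ (same _ _ _ _ h h2 h1.le)
  by_cases c1 : x' = x ∧ y' = y
  · obtain ⟨rfl, rfl⟩ := c1
    exact hsame _ h1'.le hab
  by_cases c2 : x' = y ∧ y' = x
  · obtain ⟨rfl, rfl⟩ := c2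
    rw [flip'] at hab ⊢
    exact hsame _ (by omega) hab
  by_cases c3 : x' = y
  · subst c3; exact hadj _ _ _ _ _ h h' (by omega) h0 h1 h0' h1'
  by_cases c4 : y' = y
  · subst c4; rw [flip']
    exact hadj _ _ _ _ _ h h'.symm (by omega) h0 h1 (by omega) (by omega)
  by_cases c5 : x' = x
  · subst c5; rw [flip]
    exact hadj _ _ _ _ _ h.symm h' (by omega) (by omega) (by omega) h0' h1'
  by_cases c6 : y' = x
  · subst c6; rw [flip, flip']
    exact hadj _ _ _ _ _ h.symm h'.symm (by omega) (by omega) (by omega) (by omega) (by omega)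
  exact opposite (sel x y x' y') (isPerm4_sel _ q.1 _ q.2.1 _ q'.1 _ q'.2.1 (by simp; omega))
    i j h0 h1 h0' h1'

end K4Frame

abbrev pointMap (φ : ℕ → V) (f : ℕ → ℕ → ℕ → V) (L : ℕ → ℕ → ℕ) (i c d t : ℕ) : ℕ → V :=
  Function.update (Function.update φ 4 (f 0 1 i)) 5 (subMap f L 0 1 4 i c d t)

abbrev pieceMap (f : ℕ → ℕ → ℕ → V) (L : ℕ → ℕ → ℕ) (i c d t : ℕ) : ℕ → ℕ → ℕ → V :=
  subMap (subMap f L 0 1 4 i) (subLen L 0 1 4 i) c d 5 t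

abbrev pieceLen (L : ℕ → ℕ → ℕ) (i c d t : ℕ) : ℕ → ℕ → ℕ :=
  subLen (subLen L 0 1 4 i) c d 5 t

abbrev pieceEdges (c d : ℕ) : List (ℕ × ℕ) := subEdges (subEdges k4Edges 0 1 4) c d 5

namespace K4Frame
variable {G : SimpleGraph V} {l : ℕ} {S : Set V} {φ : ℕ → V}
    {f : ℕ → ℕ → ℕ → V} {L : ℕ → ℕ → ℕ}

theorem subdiv_once (K : K4Frame G l S φ f L) {i : ℕ} (hi : 0 < i) (hi' : i < L 0 1) :
    Frame G (subEdges k4Edges 0 1 4) S (Function.update φ 4 (f 0 1 i)) (subMap f L 0 1 4 i)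
      (subLen L 0 1 4 i) :=
  K.toFrame.subdiv (by decide) hi hi' (by decide)

theorem subdiv_twice (K : K4Frame G l S φ f L) {i t : ℕ} (c d : ℕ) (hi : 0 < i) (hi' : i < L 0 1)
    (ht : 0 < t) (ht' : t < subLen L 0 1 4 i c d)
    (h : EdgeIn (subEdges k4Edges 0 1 4) c d := by decide) :
    Frame G (pieceEdges c d) S (pointMap φ f L i c d t) (pieceMap f L i c d t)
      (pieceLen L i c d t) :=
  (K.subdiv_once hi hi').subdiv h ht ht' (by decide)

theorem induced_once (K : K4Frame G l S φ f L) (hI : HoleInduced G S k4Edges f L) {i : ℕ}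
    (hi' : i < L 0 1) :
    HoleInduced G S (subEdges k4Edges 0 1 4) (subMap f L 0 1 4 i) (subLen L 0 1 4 i) :=
  Frame.HoleInduced.subdiv K.toFrame hI (by decide) hi' (by decide)

theorem induced_twice (K : K4Frame G l S φ f L) (hI : HoleInduced G S k4Edges f L) {i t : ℕ}
    (c d : ℕ) (hi : 0 < i) (hi' : i < L 0 1) (ht' : t < subLen L 0 1 4 i c d)
    (h : EdgeIn (subEdges k4Edges 0 1 4) c d := by decide) :
    HoleInduced G S (pieceEdges c d) (pieceMap f L i c d t) (pieceLen L i c d t) :=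
  Frame.HoleInduced.subdiv (K.subdiv_once hi hi') (K.induced_once hI hi') h ht' (by decide)

theorem false_of_weakJump_adjacent (K : K4Frame G l S φ f L) (hg : NearGirth G (2 * l + 1))
    {i t m : ℕ} (hi : 0 < i) (hi' : i < L 0 1) (ht : 0 < t) (ht' : t < L 1 2) (hm : m ≤ 2)
    (hJ : WeakJump G S (f 0 1 i) (f 1 2 t) m) : False := by
  have F := K.subdiv_twice 1 2 hi hi' ht (by simpa [subLen] using ht')
  have e4 : pointMap φ f L i 1 2 t 4 = f 0 1 i := by simp
  have e5 : pointMap φ f L i 1 2 t 5 = f 1 2 t := by simp [subMap]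
  obtain ⟨⟩ := K.lens hg
  have c1 := F.le_of_weakJump hg.le 4 [1, 5] hJ.symm e5 e4 (hm := by
    simp [baseLength, subLen]; omega)
  have c2 := F.le_of_weakJump hg.le 4 [0, 2, 5] hJ.symm e5 e4 (hm := by
    simp [baseLength, subLen]; omega)
  simp [baseLength, subLen] at c1 c2
  omega

theorem false_of_weakJump_branch (K : K4Frame G l S φ f L) (hg : NearGirth G (2 * l + 1))
    {i m : ℕ} (hi : 0 < i) (hi' : i < L 0 1) (hm : m ≤ 2)
    (hJ : WeakJump G S (f 0 1 i) (φ 2) m) : False := by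
  have F := K.subdiv_once hi hi'
  have e4 : Function.update φ 4 (f 0 1 i) 4 = f 0 1 i := by simp
  have e2 : Function.update φ 4 (f 0 1 i) 2 = φ 2 := by simp
  obtain ⟨⟩ := K.lens hg
  have c1 := F.le_of_weakJump hg.le 4 [1, 2] hJ.symm e2 e4 (hm := by
    simp [baseLength, subLen]; omega)
  have c2 := F.le_of_weakJump hg.le 4 [0, 2] hJ.symm e2 e4 (hm := by
    simp [baseLength, subLen]; omega)
  simp [baseLength, subLen] at c1 c2
  omega

theorem false_of_weakJump_opposite (K : K4Frame G l S φ f L) (hg : NearGirth G (2 * l + 1))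
    {i j m : ℕ} (hi : 0 < i) (hi' : i < L 0 1) (hj : 0 < j) (hj' : j < L 2 3) (hl : 4 ≤ l) (hm : m ≤ 2)
    (hJ : WeakJump G S (f 0 1 i) (f 2 3 j) m) : False := by
  have F := K.subdiv_twice 2 3 hi hi' hj (by simpa [subLen] using hj')
  have e4 : pointMap φ f L i 2 3 j 4 = f 0 1 i := by simp
  have e5 : pointMap φ f L i 2 3 j 5 = f 2 3 j := by simp [subMap]
  obtain ⟨⟩ := K.lens hg
  have c1 := F.le_of_weakJump hg.le 4 [0, 2, 5] hJ.symm e5 e4 (hm := by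
    simp [baseLength, subLen]; omega)
  have c2 := F.le_of_weakJump hg.le 4 [1, 2, 5] hJ.symm e5 e4 (hm := by
    simp [baseLength, subLen]; omega)
  have c3 := F.le_of_weakJump hg.le 4 [0, 3, 5] hJ.symm e5 e4 (hm := by
    simp [baseLength, subLen]; omega)
  have c4 := F.le_of_weakJump hg.le 4 [1, 3, 5] hJ.symm e5 e4 (hm := by
    simp [baseLength, subLen]; omega)
  simp [baseLength, subLen] at c1 c2 c3 c4
  omega

def Consecutive (f : ℕ → ℕ → ℕ → V) (L : ℕ → ℕ → ℕ) (a b : V) : Prop :=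
  ∃ x y k, EdgeIn k4Edges x y ∧ k < L x y ∧ a = f x y k ∧ b = f x y (k + 1)

theorem le_half (K : K4Frame G l S φ f L) (hg : NearGirth G (2 * l + 1)) {x y : ℕ}
    (h : EdgeIn k4Edges x y) : L x y ≤ l := by
  obtain ⟨⟩ := K.lens hg
  simp only [EdgeIn, List.mem_cons, Prod.mk.injEq, List.not_mem_nil, or_false] at h
  rcases h with (⟨rfl, rfl⟩ | ⟨rfl, rfl⟩ | ⟨rfl, rfl⟩ | ⟨rfl, rfl⟩ | ⟨rfl, rfl⟩ | ⟨rfl, rfl⟩) |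
    (⟨rfl, rfl⟩ | ⟨rfl, rfl⟩ | ⟨rfl, rfl⟩ | ⟨rfl, rfl⟩ | ⟨rfl, rfl⟩ | ⟨rfl, rfl⟩) <;> omega

theorem eq_one_of_weakJump (K : K4Frame G l S φ f L) (hg : NearGirth G (2 * l + 1)) (hl : 4 ≤ l) :
    ∀ a ∈ S, ∀ b ∈ S, a ≠ b → ∀ m ≤ 2, WeakJump G S a b m → m = 1 ∧ Consecutive f L a b := by
  refine K.pair_cases ?_ ?_ ?_ ?_ ?_
  · intro a b h m hm hJ
    obtain ⟨h1, x, y, k, h2, h3, h4, h5⟩ := h m hm hJ.symm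
    have e := K.Lsymm _ _ h2
    refine ⟨h1, y, x, L x y - (k + 1), h2.symm, by omega, ?_, ?_⟩
    · rw [K.symm _ _ _ h2 (by omega), h5]; congr 1; omega
    · rw [K.symm _ _ _ h2 (by omega), h4]; congr 1; omega
  · intro x y i j h hij hj m hm hJ
    have h2 := K.le_half hg h
    have h3 : 1 ≤ m := by obtain ⟨P, h⟩ := hJ; exact h.2.2.1
    by_cases h4 : 1 < j - i ∨ 1 < m
    · have := K.le_of_weakJump_same hg h hij hj hJ.symm h4
      omega
    · obtain rfl : j = i + 1 := by omega
      exact ⟨by omega, x, y, i, h, by omega, rfl, rfl⟩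
  · intro σ hσ i t h1 h2 h3 h4 m hm hJ
    exact ((K.relabel σ hσ).false_of_weakJump_adjacent hg h1 h2 h3 h4 hm hJ).elim
  · intro σ hσ i h1 h2 m hm hJ
    exact ((K.relabel σ hσ).false_of_weakJump_branch hg h1 h2 hm hJ).elim
  · intro σ hσ i j h1 h2 h3 h4 m hm hJ
    exact ((K.relabel σ hσ).false_of_weakJump_opposite hg h1 h2 h3 h4 hl hm hJ).elim

theorem induced (K : K4Frame G l S φ f L) (hg : NearGirth G (2 * l + 1)) (hl : 4 ≤ l) :
    HoleInduced G S k4Edges f L := by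
  intro a ha b hb hab
  exact (K.eq_one_of_weakJump hg hl a ha b hb hab.ne 1 (by omega)
    ⟨hab.toWalk, by simp [hab.ne], by simp, le_rfl, by simp⟩).2

theorem unique_attachment (K : K4Frame G l S φ f L) (hg : NearGirth G (2 * l + 1)) (hl : 4 ≤ l)
    {v a b : V} (hv : v ∉ S) (ha : a ∈ S) (hb : b ∈ S) (hva : G.Adj v a) (hvb : G.Adj v b) :
    a = b := by
  by_contra hab
  have := (K.eq_one_of_weakJump hg hl a ha b hb hab 2 le_rfl
    ⟨.cons hva.symm (.cons hvb .nil), by simp [hva.ne', hvb.ne, hab], by simp, by simp, by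
      simp; tauto⟩).1
  omega

end K4Frame

namespace K4Frame
variable {G : SimpleGraph V} {l : ℕ} {S : Set V} {φ : ℕ → V}
    {f : ℕ → ℕ → ℕ → V} {L : ℕ → ℕ → ℕ}

theorem unattached_adjacent (K : K4Frame G l S φ f L) (hg : NearGirth G (2 * l + 1)) (hl : 4 ≤ l)
    {i t m : ℕ} (hi : 0 < i) (hi' : i < L 0 1) (ht : 0 < t) (ht' : t < L 1 2)
    (hJ : Jump G S (f 0 1 i) (f 1 2 t) m ∅) : L 0 2 = 1 ∧ i + 1 = L 0 1 ∧ t = 1 := by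
  have hI := K.induced hg hl
  have F := K.subdiv_twice 1 2 hi hi' ht (by simpa [subLen] using ht')
  have I := K.induced_twice hI 1 2 hi hi' (t := t) (by simpa [subLen] using ht')
  have e4 : pointMap φ f L i 1 2 t 4 = f 0 1 i := by simp
  have e5 : pointMap φ f L i 1 2 t 5 = f 1 2 t := by simp [subMap]
  obtain ⟨⟩ := K.lens hg
  have hm := hJ.two_le
  obtain ⟨s, hs⟩ : ∃ s, L 0 1 = i + s := ⟨L 0 1 - i, by omega⟩
  obtain ⟨r, hr⟩ : ∃ r, L 1 2 = t + r := ⟨L 1 2 - t, by omega⟩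
  have e1 : L 0 1 - i = s := by omega
  have e2 : L 1 2 - t = r := by omega
  have c1 := F.eq_or_even hg I 4 [1, 5] hJ.symm e5 e4 [] (by simp) (by simp)
  have c2 := F.eq_or_even hg I 4 [0, 2, 5] hJ.symm e5 e4 [] (by simp) (by simp)
  have c3 := fun h => F.eq_or_even hg I 4 [0, 3, 2, 5] hJ.symm e5 e4 [(0, 2)] h (by simp)
  have c4 := fun h => F.eq_or_even hg I 4 [1, 3, 2, 5] hJ.symm e5 e4 [(1, 5)] h (by simp)
  have c5 := fun h => F.eq_or_even hg I 4 [0, 3, 1, 5] hJ.symm e5 e4 [(4, 1)] h (by simp)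
  have c6 := fun h => F.eq_or_even hg I 4 [0, 2, 3, 1, 5] hJ.symm e5 e4 [(4, 1), (5, 2), (0, 3)]
    h (by simp)
  have c7 := fun h => F.eq_or_even hg I 4 [1, 3, 0, 2, 5] hJ.symm e5 e4 [(1, 5), (0, 4), (2, 3)]
    h (by simp)
  simp [baseLength, subLen] at c1 c2 c3 c4 c5 c6 c7
  rw [e1] at c1 c4 c5 c6
  rw [e2] at c2 c3 c4 c6 c7
  clear F I hJ hI hg
  obtain ⟨b1, c1⟩ := c1
  obtain ⟨b2, c2⟩ := c2
  rcases c2 with c2 | c2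
  · clear c3 c6 c7 c1
    have h1 : t < 2 := by
      rcases lt_or_ge t 2 with h | h
      · exact h
      · rcases (c4 h).2 with h | h <;> clear c4 c5 <;> omega
    have h2 : s < 2 := by
      rcases lt_or_ge s 2 with h | h
      · exact h
      · rcases (c5 h).2 with h | h <;> clear c4 c5 <;> omega
    clear c4 c5
    omega
  · clear c4 c5
    have c1 : s + t + m = 2 * l + 1 := by
      clear c3 c6 c7
      omega
    have h1 : L 0 2 < 2 := by
      rcases lt_or_ge (L 0 2) 2 with h | h
      · exact h
      · rcases (c3 h).2 with h | h <;> clear c3 c6 c7 <;> omega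
    clear c3
    have h2 : 2 ≤ L 0 3 := by clear c6 c7; omega
    have h3 : 2 ≤ L 2 3 := by clear c6 c7; omega
    have h6 : ¬ (2 ≤ s ∧ 2 ≤ r) := by
      rintro ⟨h4, h5⟩
      rcases (c6 h4 h5 h2).2 with h | h <;> clear c6 c7 <;> omega
    have h7 : ¬ (2 ≤ t ∧ 2 ≤ i) := by
      rintro ⟨h4, h5⟩
      rcases (c7 h4 h5 h3).2 with h | h <;> clear c6 c7 h6 <;> omega
    clear c6 c7
    omega

end K4Frame

namespace K4Frame
variable {G : SimpleGraph V} {l : ℕ} {S : Set V} {φ : ℕ → V}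
    {f : ℕ → ℕ → ℕ → V} {L : ℕ → ℕ → ℕ}

theorem unattached_branch (K : K4Frame G l S φ f L) (hg : NearGirth G (2 * l + 1)) (hl : 4 ≤ l)
    {i m : ℕ} (hi : 0 < i) (hi' : i < L 0 1) (hJ : Jump G S (f 0 1 i) (φ 2) m ∅) : False := by
  have F := K.subdiv_once hi hi'
  have I := K.induced_once (K.induced hg hl) hi'
  have e4 : Function.update φ 4 (f 0 1 i) 4 = f 0 1 i := by simp
  have e2 : Function.update φ 4 (f 0 1 i) 2 = φ 2 := by simp
  obtain ⟨⟩ := K.lens hg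
  obtain ⟨s, hs⟩ : ∃ s, L 0 1 = i + s := ⟨L 0 1 - i, by omega⟩
  have e1 : L 0 1 - i = s := by omega
  have c1 := F.eq_or_even hg I 4 [1, 2] hJ.symm e2 e4 [] (by simp) (by simp)
  have c2 := F.eq_or_even hg I 4 [0, 2] hJ.symm e2 e4 [] (by simp) (by simp)
  have c3 := fun h => F.eq_or_even hg I 4 [0, 3, 2] hJ.symm e2 e4 [(0, 2)] h (by simp)
  have c4 := fun h => F.eq_or_even hg I 4 [1, 3, 2] hJ.symm e2 e4 [(1, 2)] h (by simp)
  simp [baseLength, subLen] at c1 c2 c3 c4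
  rw [e1] at c1 c4
  clear F I hJ hg
  obtain ⟨b1, c1⟩ := c1
  obtain ⟨b2, c2⟩ := c2
  rcases c2 with c2 | c2
  · have h1 : L 1 2 < 2 := by
      rcases lt_or_ge (L 1 2) 2 with h | h
      · exact h
      · rcases (c4 h).2 with h | h <;> clear c3 c4 <;> omega
    clear c3 c4
    omega
  · have c1 : s + L 1 2 + m = 2 * l + 1 := by
      clear c3 c4
      omega
    have h1 : L 0 2 < 2 := by
      rcases lt_or_ge (L 0 2) 2 with h | h
      · exact h
      · rcases (c3 h).2 with h | h <;> clear c3 c4 <;> omega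
    clear c3 c4
    omega

theorem unattached_opposite (K : K4Frame G l S φ f L) (hg : NearGirth G (2 * l + 1)) (hl : 4 ≤ l)
    {i j m : ℕ} (hi : 0 < i) (hi' : i < L 0 1) (hj : 0 < j) (hj' : j < L 2 3)
    (hJ : Jump G S (f 0 1 i) (f 2 3 j) m ∅) :
    (m = L 1 2 ∧ i + j = L 0 1 ∨ m = L 0 2 ∧ i = j) ∧ l + 1 ≤ i + m ∧ l + 1 ≤ L 0 1 - i + m := by
  have F := K.subdiv_twice 2 3 hi hi' hj (by simpa [subLen] using hj')
  have I := K.induced_twice (K.induced hg hl) 2 3 hi hi' (t := j) (by simpa [subLen] using hj')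
  have e4 : pointMap φ f L i 2 3 j 4 = f 0 1 i := by simp
  have e5 : pointMap φ f L i 2 3 j 5 = f 2 3 j := by simp [subMap]
  obtain ⟨⟩ := K.lens hg
  obtain ⟨s, hs⟩ : ∃ s, L 0 1 = i + s := ⟨L 0 1 - i, by omega⟩
  obtain ⟨r, hr⟩ : ∃ r, L 2 3 = j + r := ⟨L 2 3 - j, by omega⟩
  have e1 : L 0 1 - i = s := by omega
  have e2 : L 2 3 - j = r := by omega
  have c1 := F.eq_or_even hg I 4 [0, 2, 5] hJ.symm e5 e4 [] (by simp) (by simp)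
  have c2 := F.eq_or_even hg I 4 [1, 2, 5] hJ.symm e5 e4 [] (by simp) (by simp)
  have c3 := F.eq_or_even hg I 4 [0, 3, 5] hJ.symm e5 e4 [] (by simp) (by simp)
  have c4 := F.eq_or_even hg I 4 [1, 3, 5] hJ.symm e5 e4 [] (by simp) (by simp)
  simp [baseLength, subLen] at c1 c2 c3 c4
  rw [e1] at c2 c4
  rw [e2] at c3 c4
  rw [e1]
  clear F I hJ hg
  obtain ⟨b1, c1⟩ := c1
  obtain ⟨b2, c2⟩ := c2
  obtain ⟨b3, c3⟩ := c3
  obtain ⟨b4, c4⟩ := c4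
  rcases c1 with c1 | c1
  · have d4 : s + (L 1 3 + r) + m = 2 * l + 1 := by omega
    omega
  · have d2 : s + (L 1 2 + j) + m = 2 * l + 1 := by omega
    have d3 : i + (L 0 3 + r) + m = 2 * l + 1 := by omega
    omega

end K4Frame

theorem Frame.not_onBase {G : SimpleGraph V} {es : List (ℕ × ℕ)} {S : Set V} {φ : ℕ → V}
    {f : ℕ → ℕ → ℕ → V} {L : ℕ → ℕ → ℕ} (hF : Frame G es S φ f L) {a b k x : ℕ} {t : List ℕ}
    (hab : EdgeIn es a b) (h0 : 0 < k) (hk : k ≤ L a b) (hb : k = L a b → b ∉ x :: t)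
    (hx : ∃ x', EdgeIn es x x')
    (ht : ∀ e ∈ basePairs x t, EdgeIn es e.1 e.2 := by decide)
    (h1 : (a, b) ∉ basePairs x t := by decide) (h2 : (b, a) ∉ basePairs x t := by decide) :
    ¬ OnBase φ f L x t (f a b k) := by
  intro h
  rcases hF.eq_end_of_onBase hx ht hab hk h1 h2 h with h | h
  · omega
  · exact hb h.1 h.2

namespace K4Frame
variable {G : SimpleGraph V} {l : ℕ} {S : Set V} {φ : ℕ → V}
    {f : ℕ → ℕ → ℕ → V} {L : ℕ → ℕ → ℕ}

theorem false_of_two_routes (h : Lens L l) (hl : 4 ≤ l) {d m A B C : ℕ} (hd : d ≤ L 0 1)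
    (c0 : 2 * l + 1 ≤ d + m) (hA : A + d = 2 * l + 1) (hB : B + d = 2 * L 0 1 + 2 * L 0 2)
    (hC : C + d = 2 * L 0 1 + 2 * L 1 2) (cA : A + m = 2 * l + 1 ∨ (A + m) % 2 = 0)
    (cB : 2 ≤ L 1 2 → B + m = 2 * l + 1 ∨ (B + m) % 2 = 0)
    (cC : 2 ≤ L 0 2 → C + m = 2 * l + 1 ∨ (C + m) % 2 = 0) : False := by
  obtain ⟨⟩ := h
  rcases lt_or_ge (L 1 2) 2 with h | h
  · have h' : 2 ≤ L 0 2 := by omega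
    have cC := cC h'
    clear cB
    omega
  · have cB := cB h
    clear cC
    omega

theorem false_of_jump_same_interior (K : K4Frame G l S φ f L) (hg : NearGirth G (2 * l + 1))
    (hl : 4 ≤ l) {i j m : ℕ} (hi : 0 < i) (hij : i + 2 ≤ j) (hj : j < L 0 1)
    (hJ : Jump G S (f 0 1 i) (f 0 1 j) m {v | ∃ k, i < k ∧ k < j ∧ v = f 0 1 k}) : False := by
  have hK := K.lens hg
  have hI := K.induced hg hl
  have c0 := K.le_of_weakJump_same hg (x := 0) (y := 1) (by decide) (i := i) (j := j)
    (by omega) hj.le hJ.symm.weak (by omega)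
  obtain ⟨h10, h23, h32, h21, h03, h30, h20, h13, h31, hsum, -, -, -, -, -, -⟩ := hK
  have hij' : i < subLen L 0 1 4 j 0 4 := by simp [subLen]; omega
  have F := K.subdiv_twice 0 4 (by omega) hj hi hij'
  have I := K.induced_twice hI 0 4 (by omega) hj hij'
  have eb : pointMap φ f L j 0 4 i 4 = f 0 1 j := by simp
  have ea : pointMap φ f L j 0 4 i 5 = f 0 1 i := by simp [subMap]
  have hX : ∀ x t, (∃ x', EdgeIn (pieceEdges 0 4) x x') →
      (∀ e ∈ basePairs x t, EdgeIn (pieceEdges 0 4) e.1 e.2) →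
      (5, 4) ∉ basePairs x t → (4, 5) ∉ basePairs x t →
      ∀ h ∈ {v | ∃ k, i < k ∧ k < j ∧ v = f 0 1 k},
        ¬ OnBase (pointMap φ f L j 0 4 i) (pieceMap f L j 0 4 i) (pieceLen L j 0 4 i) x t h := by
    rintro x t hx ht h1 h2 _ ⟨k, hk, hk', rfl⟩
    have e2 : pieceLen L j 0 4 i 5 4 = j - i := by simp [subLen]
    have e : f 0 1 k = pieceMap f L j 0 4 i 5 4 (k - i) := by
      simp [subMap, Nat.add_sub_cancel' hk.le]
    rw [e]
    exact F.not_onBase (by decide) (by omega) (by omega) (by omega) hx ht h1 h2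
  have hx : ∃ x', EdgeIn (pieceEdges 0 4) 4 x' := ⟨1, by decide⟩
  have cA := F.eq_or_even hg I 4 [1, 2, 0, 5] hJ ea eb [(5, 4)] (by simp [subLen]; omega)
    (hX _ _ hx (by decide) (by decide) (by decide))
  have cB := fun h => F.eq_or_even hg I 4 [1, 3, 2, 0, 5] hJ ea eb [(5, 4), (1, 2), (0, 3)] h
    (hX _ _ hx (by decide) (by decide) (by decide))
  have cC := fun h => F.eq_or_even hg I 4 [1, 2, 3, 0, 5] hJ ea eb [(5, 4), (1, 3), (0, 2)] h
    (hX _ _ hx (by decide) (by decide) (by decide))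
  simp [baseLength, subLen] at cA cB cC
  refine false_of_two_routes (K.lens hg) hl (d := j - i) (by omega) c0 ?_ ?_ ?_ cA.2
    (fun h => (cB (by omega) (by omega) (by omega)).2)
    (fun h => (cC (by omega) (by omega) (by omega)).2) <;> clear cA cB cC <;> omega

theorem false_of_jump_same_start (K : K4Frame G l S φ f L) (hg : NearGirth G (2 * l + 1))
    (hl : 4 ≤ l) {j m : ℕ} (hij : 2 ≤ j) (hj : j < L 0 1)
    (hJ : Jump G S (f 0 1 0) (f 0 1 j) m {v | ∃ k, 0 < k ∧ k < j ∧ v = f 0 1 k}) : False := by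
  have hK := K.lens hg
  have hI := K.induced hg hl
  have c0 := K.le_of_weakJump_same hg (x := 0) (y := 1) (by decide) (i := 0) (j := j)
    (by omega) hj.le hJ.symm.weak (by omega)
  obtain ⟨h10, h23, h32, h21, h03, h30, h20, h13, h31, hsum, -, -, -, -, -, -⟩ := hK
  have F := K.subdiv_once (i := j) (by omega) hj
  have I := K.induced_once hI (i := j) hj
  have eb : Function.update φ 4 (f 0 1 j) 4 = f 0 1 j := by simp
  have ea : Function.update φ 4 (f 0 1 j) 0 = f 0 1 0 := by simp [K.start 0 1 (by decide)]
  have hX : ∀ x t, (∃ x', EdgeIn (subEdges k4Edges 0 1 4) x x') →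
      (∀ e ∈ basePairs x t, EdgeIn (subEdges k4Edges 0 1 4) e.1 e.2) →
      (0, 4) ∉ basePairs x t → (4, 0) ∉ basePairs x t →
      ∀ h ∈ {v | ∃ k, 0 < k ∧ k < j ∧ v = f 0 1 k},
        ¬ OnBase (Function.update φ 4 (f 0 1 j)) (subMap f L 0 1 4 j) (subLen L 0 1 4 j) x t h := by
    rintro x t hx ht h1 h2 _ ⟨k, hk, hk', rfl⟩
    have e2 : subLen L 0 1 4 j 0 4 = j := by simp [subLen]
    have e : f 0 1 k = subMap f L 0 1 4 j 0 4 k := by simp [subMap]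
    rw [e]
    exact F.not_onBase (by decide) (by omega) (by omega) (by omega) hx ht h1 h2
  have hx : ∃ x', EdgeIn (subEdges k4Edges 0 1 4) 4 x' := ⟨0, by decide⟩
  have cA := F.eq_or_even hg I 4 [1, 2, 0] hJ ea eb [(0, 4)] (by simp [subLen]; omega)
    (hX _ _ hx (by decide) (by decide) (by decide))
  have cB := fun h => F.eq_or_even hg I 4 [1, 3, 2, 0] hJ ea eb [(0, 4), (1, 2), (0, 3)] h
    (hX _ _ hx (by decide) (by decide) (by decide))
  have cC := fun h => F.eq_or_even hg I 4 [1, 2, 3, 0] hJ ea eb [(0, 4), (1, 3), (0, 2)] h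
    (hX _ _ hx (by decide) (by decide) (by decide))
  simp [baseLength, subLen] at cA cB cC
  refine false_of_two_routes (K.lens hg) hl hj.le c0 ?_ ?_ ?_ cA.2
    (fun h => (cB (by omega) (by omega) (by omega)).2)
    (fun h => (cC (by omega) (by omega) (by omega)).2) <;> clear cA cB cC <;> omega

theorem false_of_jump_same_ends (K : K4Frame G l S φ f L) (hg : NearGirth G (2 * l + 1))
    (hl : 4 ≤ l) {m : ℕ} (hp : 2 ≤ L 0 1)
    (hJ : Jump G S (f 0 1 0) (f 0 1 (L 0 1)) m {v | ∃ k, 0 < k ∧ k < L 0 1 ∧ v = f 0 1 k}) :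
    False := by
  have hK := K.lens hg
  have I := K.induced hg hl
  have c0 := K.le_of_weakJump_same hg (x := 0) (y := 1) (by decide) (i := 0) (j := L 0 1)
    (by omega) le_rfl hJ.symm.weak (by omega)
  obtain ⟨h10, h23, h32, h21, h03, h30, h20, h13, h31, hsum, -, -, -, -, -, -⟩ := hK
  have eb : φ 1 = f 0 1 (L 0 1) := (K.finish (by decide)).symm
  have ea : φ 0 = f 0 1 0 := (K.start 0 1 (by decide)).symm
  have hX : ∀ x t, (∃ x', EdgeIn k4Edges x x') → (∀ e ∈ basePairs x t, EdgeIn k4Edges e.1 e.2) →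
      (0, 1) ∉ basePairs x t → (1, 0) ∉ basePairs x t →
      ∀ h ∈ {v | ∃ k, 0 < k ∧ k < L 0 1 ∧ v = f 0 1 k}, ¬ OnBase φ f L x t h := by
    rintro x t hx ht h1 h2 _ ⟨k, hk, hk', rfl⟩
    exact K.not_onBase (by decide) (by omega) (by omega) (by omega) hx ht h1 h2
  have hx : ∃ x', EdgeIn k4Edges 1 x' := ⟨0, by decide⟩
  have cA := K.eq_or_even hg I 1 [2, 0] hJ ea eb [(0, 1)] (by simp; omega)
    (hX _ _ hx (by decide) (by decide) (by decide))
  have cB := fun h => K.eq_or_even hg I 1 [3, 2, 0] hJ ea eb [(0, 1), (1, 2), (0, 3)] h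
    (hX _ _ hx (by decide) (by decide) (by decide))
  have cC := fun h => K.eq_or_even hg I 1 [2, 3, 0] hJ ea eb [(0, 1), (1, 3), (0, 2)] h
    (hX _ _ hx (by decide) (by decide) (by decide))
  simp [baseLength] at cA cB cC
  refine false_of_two_routes (K.lens hg) hl le_rfl c0 ?_ ?_ ?_ cA.2
    (fun h => (cB (by omega) (by omega) (by omega)).2)
    (fun h => (cC (by omega) (by omega) (by omega)).2) <;> clear cA cB cC <;> omega

theorem false_of_jump_same (K : K4Frame G l S φ f L) (hg : NearGirth G (2 * l + 1)) (hl : 4 ≤ l)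
    {i j m : ℕ} (hij : i + 2 ≤ j) (hj : j ≤ L 0 1)
    (hJ : Jump G S (f 0 1 i) (f 0 1 j) m {v | ∃ k, i < k ∧ k < j ∧ v = f 0 1 k}) : False := by
  rcases Nat.eq_zero_or_pos i with rfl | hi <;> rcases hj.lt_or_eq with hj' | rfl
  · exact K.false_of_jump_same_start hg hl (by omega) hj' hJ
  · exact K.false_of_jump_same_ends hg hl (by omega) hJ
  · exact K.false_of_jump_same_interior hg hl hi hij hj' hJ
  · have h01 : EdgeIn k4Edges 0 1 := by decide
    have e := K.Lsymm 0 1 h01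
    have e1 : f 0 1 i = f 1 0 (L 0 1 - i) := by
      rw [K.symm 0 1 _ h01 (by omega)]; congr 1; omega
    have e2 : f 0 1 (L 0 1) = f 1 0 0 := (K.finish h01).trans (K.start 1 0 h01.symm).symm
    rw [e1, e2] at hJ
    refine (K.relabel (sel 1 0 3 2) (by decide)).false_of_jump_same_start hg hl (j := L 0 1 - i)
      (m := m) (by omega) (by simp [sel]; omega) (hJ.symm.mono ?_)
    rintro _ ⟨k, h1, h2, rfl⟩
    refine ⟨L 0 1 - k, by omega, by omega, ?_⟩
    simp only [sel]
    rw [K.symm 0 1 _ h01 (by omega)]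
    congr 1
    omega

end K4Frame

namespace K4Frame
variable {G : SimpleGraph V} {l : ℕ} {S : Set V} {φ : ℕ → V}
    {f : ℕ → ℕ → ℕ → V} {L : ℕ → ℕ → ℕ}

theorem attached_opposite (K : K4Frame G l S φ f L) (hg : NearGirth G (2 * l + 1)) (hl : 4 ≤ l)
    {i j m : ℕ} (hi : 0 < i) (hi' : i < L 0 1) (hj : 0 < j) (hj' : j < L 2 3) (hm : 2 * l ≤ m)
    (hJ : Jump G S (f 0 1 i) (f 2 3 j) m {f 0 1 (i + 1)}) : False := by
  have F := K.subdiv_twice 2 3 hi hi' hj (by simpa [subLen] using hj')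
  have I := K.induced_twice (K.induced hg hl) 2 3 hi hi' (t := j) (by simpa [subLen] using hj')
  have e4 : pointMap φ f L i 2 3 j 4 = f 0 1 i := by simp
  have e5 : pointMap φ f L i 2 3 j 5 = f 2 3 j := by simp [subMap]
  have ez : f 0 1 (i + 1) = pieceMap f L i 2 3 j 4 1 1 := by simp [subMap]
  have le : pieceLen L i 2 3 j 4 1 = L 0 1 - i := by simp [subLen]
  obtain ⟨⟩ := K.lens hg
  have hx : ∃ x', EdgeIn (pieceEdges 2 3) 4 x' := ⟨1, by decide⟩
  have c1 := F.eq_or_even hg I 4 [0, 2, 5] hJ.symm e5 e4 [] (by simp) (by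
    rintro _ rfl; rw [ez]
    exact F.not_onBase (by decide) (by omega) (by omega) (fun _ => by decide) hx)
  have c2 := F.eq_or_even hg I 4 [0, 3, 5] hJ.symm e5 e4 [] (by simp) (by
    rintro _ rfl; rw [ez]
    exact F.not_onBase (by decide) (by omega) (by omega) (fun _ => by decide) hx)
  simp [baseLength, subLen] at c1 c2
  clear F I hJ hg
  omega

theorem attached_branch (K : K4Frame G l S φ f L) (hg : NearGirth G (2 * l + 1)) (hl : 4 ≤ l)
    {i m : ℕ} (hi : 0 < i) (hi' : i < L 0 1) (hr : 2 ≤ L 0 2) (hm : 2 * l ≤ m)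
    (hJ : Jump G S (f 0 1 i) (φ 2) m {f 0 1 (i + 1)}) : False := by
  have F := K.subdiv_once hi hi'
  have I := K.induced_once (K.induced hg hl) hi'
  have e4 : Function.update φ 4 (f 0 1 i) 4 = f 0 1 i := by simp
  have e2 : Function.update φ 4 (f 0 1 i) 2 = φ 2 := by simp
  have ez : f 0 1 (i + 1) = subMap f L 0 1 4 i 4 1 1 := by simp [subMap]
  have le : subLen L 0 1 4 i 4 1 = L 0 1 - i := by simp [subLen]
  obtain ⟨⟩ := K.lens hg
  have hx : ∃ x', EdgeIn (subEdges k4Edges 0 1 4) 4 x' := ⟨1, by decide⟩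
  have c1 := F.eq_or_even hg I 4 [0, 2] hJ.symm e2 e4 [] (by simp) (by
    rintro _ rfl; rw [ez]
    exact F.not_onBase (by decide) (by omega) (by omega) (fun _ => by decide) hx)
  have c2 := F.eq_or_even hg I 4 [0, 3, 2] hJ.symm e2 e4 [(0, 2)] (by simpa [subLen]) (by
    rintro _ rfl; rw [ez]
    exact F.not_onBase (by decide) (by omega) (by omega) (fun _ => by decide) hx)
  simp [baseLength, subLen] at c1 c2
  clear F I hJ hg
  omega

theorem attached_adjacent (K : K4Frame G l S φ f L) (hg : NearGirth G (2 * l + 1)) (hl : 4 ≤ l)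
    {i t m : ℕ} (hi : 0 < i) (hi' : i < L 0 1) (ht : 0 < t) (ht' : t < L 1 2) (hr : 2 ≤ L 0 2)
    (hm : 2 * l ≤ m) (hJ : Jump G S (f 0 1 i) (f 1 2 t) m {f 0 1 (i + 1)}) : False := by
  have F := K.subdiv_twice 1 2 hi hi' ht (by simpa [subLen] using ht')
  have I := K.induced_twice (K.induced hg hl) 1 2 hi hi' (t := t) (by simpa [subLen] using ht')
  have e4 : pointMap φ f L i 1 2 t 4 = f 0 1 i := by simp
  have e5 : pointMap φ f L i 1 2 t 5 = f 1 2 t := by simp [subMap]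
  have ez : f 0 1 (i + 1) = pieceMap f L i 1 2 t 4 1 1 := by simp [subMap]
  have le : pieceLen L i 1 2 t 4 1 = L 0 1 - i := by simp [subLen]
  obtain ⟨⟩ := K.lens hg
  have hx : ∃ x', EdgeIn (pieceEdges 1 2) 4 x' := ⟨1, by decide⟩
  have c1 := F.eq_or_even hg I 4 [0, 2, 5] hJ.symm e5 e4 [] (by simp) (by
    rintro _ rfl; rw [ez]
    exact F.not_onBase (by decide) (by omega) (by omega) (fun _ => by decide) hx)
  have c2 := F.eq_or_even hg I 4 [0, 3, 2, 5] hJ.symm e5 e4 [(0, 2)] (by simpa [subLen]) (by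
    rintro _ rfl; rw [ez]
    exact F.not_onBase (by decide) (by omega) (by omega) (fun _ => by decide) hx)
  simp [baseLength, subLen] at c1 c2
  clear F I hJ hg
  omega

theorem attached_near (K : K4Frame G l S φ f L) (hg : NearGirth G (2 * l + 1)) (hl : 4 ≤ l)
    {i m : ℕ} (hi' : i + 2 = L 0 1) (hr : L 0 2 = 1)
    (hm : 2 * l ≤ m) (hJ : Jump G S (f 0 1 i) (f 1 2 1) m {f 0 1 (i + 1)}) : False := by
  have hK := K.lens hg
  obtain ⟨⟩ := hK
  have F := K.subdiv_twice 1 2 (i := i) (t := 1) (by omega) (by omega) (by omega)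
    (by simp [subLen]; omega)
  have I := K.induced_twice (K.induced hg hl) 1 2 (i := i) (t := 1) (by omega) (by omega)
    (by simp [subLen]; omega)
  have e4 : pointMap φ f L i 1 2 1 4 = f 0 1 i := by simp
  have e5 : pointMap φ f L i 1 2 1 5 = f 1 2 1 := by simp [subMap]
  have ez : f 0 1 (i + 1) = pieceMap f L i 1 2 1 4 1 1 := by simp [subMap]
  have le : pieceLen L i 1 2 1 4 1 = L 0 1 - i := by simp [subLen]
  have hx : ∃ x', EdgeIn (pieceEdges 1 2) 4 x' := ⟨1, by decide⟩
  have c1 := F.eq_or_even hg I 4 [0, 2, 5] hJ.symm e5 e4 [] (by simp) (by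
    rintro _ rfl; rw [ez]
    exact F.not_onBase (by decide) (by omega) (by omega) (fun _ => by decide) hx)
  have c2 := F.eq_or_even hg I 4 [0, 2, 3, 1, 5] hJ.symm e5 e4 [(4, 1), (0, 3), (5, 2)]
    (by simp [subLen]; omega) (by
    rintro _ rfl; rw [ez]
    exact F.not_onBase (by decide) (by omega) (by omega) (fun _ => by omega) hx)
  simp [baseLength, subLen] at c1 c2
  clear F I hJ hg
  omega

end K4Frame

namespace K4Frame
variable {G : SimpleGraph V} {l : ℕ} {S : Set V} {φ : ℕ → V}
    {f : ℕ → ℕ → ℕ → V} {L : ℕ → ℕ → ℕ}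

theorem flip (K : K4Frame G l S φ f L) {x y i : ℕ} (hi : i ≤ L x y)
    (h : EdgeIn k4Edges x y := by decide) : f x y i = f y x (L x y - i) := by
  have e := K.Lsymm x y h
  rw [K.symm _ _ _ h.symm (by omega), e]

theorem cases_off_arris (K : K4Frame G l S φ f L) {w : V} (hw : w ∈ S)
    (hw' : ∀ k ≤ L 0 1, w ≠ f 0 1 k) {motive : Prop} (h2 : w = φ 2 → motive)
    (h3 : w = φ 3 → motive) (h12 : ∀ t, 0 < t → t < L 1 2 → w = f 1 2 t → motive)
    (h13 : ∀ t, 0 < t → t < L 1 3 → w = f 1 3 t → motive)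
    (h02 : ∀ t, 0 < t → t < L 0 2 → w = f 0 2 t → motive)
    (h03 : ∀ t, 0 < t → t < L 0 3 → w = f 0 3 t → motive)
    (h23 : ∀ t, 0 < t → t < L 2 3 → w = f 2 3 t → motive) : motive := by
  have hsym : ∀ {x y k}, EdgeIn k4Edges x y → 0 < k → k < L x y → w = f x y k →
      ∃ t, 0 < t ∧ t < L y x ∧ w = f y x t := by
    intro x y k h h0 h1 e
    have := K.Lsymm _ _ h
    exact ⟨L x y - k, by omega, by omega, by rw [e, K.flip h1.le h]⟩
  have e := K.Lsymm 0 1 (by decide)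
  rcases K.cases_mem hw with ⟨c, hc, rfl⟩ | ⟨x, y, k, h, h0, h1, hk⟩
  · interval_cases c
    · exact absurd (K.start 0 1 (by decide)).symm (hw' 0 (by omega))
    · exact absurd (K.finish (by decide)).symm (hw' _ le_rfl)
    · exact h2 rfl
    · exact h3 rfl
  have h' := h
  simp only [EdgeIn, List.mem_cons, Prod.mk.injEq, List.not_mem_nil, or_false] at h'
  rcases h' with (⟨rfl, rfl⟩ | ⟨rfl, rfl⟩ | ⟨rfl, rfl⟩ | ⟨rfl, rfl⟩ | ⟨rfl, rfl⟩ | ⟨rfl, rfl⟩) |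
    (⟨rfl, rfl⟩ | ⟨rfl, rfl⟩ | ⟨rfl, rfl⟩ | ⟨rfl, rfl⟩ | ⟨rfl, rfl⟩ | ⟨rfl, rfl⟩)
  · exact absurd hk (hw' _ h1.le)
  · exact h23 _ h0 h1 hk
  · exact h12 _ h0 h1 hk
  · exact h03 _ h0 h1 hk
  · exact h02 _ h0 h1 hk
  · exact h13 _ h0 h1 hk
  all_goals obtain ⟨t, h0, h1, hk⟩ := hsym h h0 h1 hk
  · exact absurd hk (hw' _ h1.le)
  · exact h23 _ h0 h1 hk
  · exact h12 _ h0 h1 hk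
  · exact h03 _ h0 h1 hk
  · exact h02 _ h0 h1 hk
  · exact h13 _ h0 h1 hk

theorem opposite_of_unattached (K : K4Frame G l S φ f L) (hg : NearGirth G (2 * l + 1))
    (hl : 4 ≤ l) {i m : ℕ} (hi : 0 < i) (hi' : i < L 0 1)
    (hi2 : (2 ≤ L 1 2 ∧ 2 ≤ L 0 2) ∨ (2 ≤ i ∧ i + 2 ≤ L 0 1)) {w : V} (hw : w ∈ S)
    (hw' : ∀ k ≤ L 0 1, w ≠ f 0 1 k) (hJ : Jump G S (f 0 1 i) w m ∅) :
    ∃ j, 0 < j ∧ j < L 2 3 ∧ w = f 2 3 j ∧ (m = L 1 2 ∧ i + j = L 0 1 ∨ m = L 0 2 ∧ i = j) ∧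
      l + 1 ≤ i + m ∧ l + 1 ≤ L 0 1 - i + m := by
  have hL := K.lens hg
  have e := K.flip (x := 0) (y := 1) hi'.le
  obtain ⟨⟩ := hL
  refine K.cases_off_arris hw hw' ?_ ?_ ?_ ?_ ?_ ?_ ?_
  · rintro rfl
    exact (K.unattached_branch hg hl hi hi' hJ).elim
  · rintro rfl
    exact ((K.relabel (sel 0 1 3 2) (by decide)).unattached_branch hg hl hi hi' hJ).elim
  · rintro t ht ht' rfl
    have := K.unattached_adjacent hg hl hi hi' ht ht' hJ
    omega
  · rintro t ht ht' rfl
    have : L 0 3 = 1 ∧ i + 1 = L 0 1 ∧ t = 1 :=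
      (K.relabel (sel 0 1 3 2) (by decide)).unattached_adjacent hg hl hi hi' ht ht' hJ
    omega
  · rintro t ht ht' rfl
    rw [e] at hJ
    have : L 1 2 = 1 ∧ L 0 1 - i + 1 = L 1 0 ∧ t = 1 :=
      (K.relabel (sel 1 0 2 3) (by decide)).unattached_adjacent hg hl (i := L 0 1 - i) (by omega)
        (by simp only [sel]; omega) ht ht' hJ
    omega
  · rintro t ht ht' rfl
    rw [e] at hJ
    have : L 1 3 = 1 ∧ L 0 1 - i + 1 = L 1 0 ∧ t = 1 :=
      (K.relabel (sel 1 0 3 2) (by decide)).unattached_adjacent hg hl (i := L 0 1 - i) (by omega)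
        (by simp only [sel]; omega) ht ht' hJ
    omega
  · rintro t ht ht' rfl
    exact ⟨t, ht, ht', rfl, K.unattached_opposite hg hl hi hi' ht ht' hJ⟩

theorem not_adj_fork (K : K4Frame G l S φ f L) (hg : NearGirth G (2 * l + 1)) (hl : 4 ≤ l)
    {k t : ℕ} (hk0 : 0 < k) (hk : k ≤ L 0 1) (ht : 0 < t) (ht' : t < L 0 2) :
    ¬ G.Adj (f 0 1 k) (f 0 2 t) := by
  intro hadj
  have h01 : EdgeIn k4Edges 0 1 := by decide
  have h02 : EdgeIn k4Edges 0 2 := by decide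
  obtain ⟨x, y, j, hxy, hj, e1, e2⟩ :=
    K.induced hg hl _ (K.mem h01 hk) _ (K.mem h02 ht'.le) hadj
  have hne : ∀ s ≤ L 0 2, f 0 1 k ≠ f 0 2 s := by
    intro s hs e
    rcases K.inter _ _ _ _ _ _ h01 h02 hk hs e with h | h | ⟨c, h3, h4⟩
    · omega
    · omega
    · unfold IsEnd at h3 h4
      omega
  have hE := K.Lsymm _ _ h02
  rcases K.inter _ _ _ _ _ _ h02 hxy ht'.le hj e2 with ⟨rfl, rfl, h3⟩ | ⟨rfl, rfl, h3⟩ | ⟨c, h3, -⟩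
  · exact hne _ (by omega) e1
  · rw [K.symm 0 2 _ h02 (by omega)] at e1
    exact hne _ (by omega) e1
  · unfold IsEnd at h3
    omega

theorem false_of_attached_fork (K : K4Frame G l S φ f L) (hg : NearGirth G (2 * l + 1))
    (hl : 4 ≤ l) {k t : ℕ} (hk0 : 1 < k) (hk : k ≤ L 0 1) (ht : 0 < t) (ht' : t < L 0 2)
    (hJ : ¬ G.Adj (f 0 1 k) (f 0 2 t) → ∃ m', Jump G S (f 0 1 k) (f 0 2 t) m' ∅) : False := by
  obtain ⟨m', hJ⟩ := hJ (K.not_adj_fork hg hl (by omega) hk ht ht')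
  have e := K.Lsymm 0 1 (by decide)
  rcases hk.lt_or_eq with h | rfl
  · rw [K.flip (x := 0) (y := 1) hk] at hJ
    have : L 1 2 = 1 ∧ L 0 1 - k + 1 = L 1 0 ∧ t = 1 :=
      (K.relabel (sel 1 0 2 3) (by decide)).unattached_adjacent hg hl (i := L 0 1 - k) (by omega)
        (by simp only [sel]; omega) ht ht' hJ
    omega
  · rw [K.finish (by decide)] at hJ
    exact (K.relabel (sel 0 2 1 3) (by decide)).unattached_branch hg hl ht ht' hJ.symm

theorem false_of_attached_succ (K : K4Frame G l S φ f L) (hg : NearGirth G (2 * l + 1))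
    (hl : 4 ≤ l) {i m : ℕ} (hi : 0 < i) (hi' : i < L 0 1)
    (hi2 : (2 ≤ L 1 2 ∧ 2 ≤ L 0 2) ∨ (2 ≤ i ∧ i + 2 ≤ L 0 1)) {w : V} (hw : w ∈ S)
    (hw' : ∀ k ≤ L 0 1, w ≠ f 0 1 k) (hm : 2 * l ≤ m)
    (hJ : Jump G S (f 0 1 i) w m {f 0 1 (i + 1)})
    (hJ' : ¬ G.Adj (f 0 1 (i + 1)) w → ∃ m', Jump G S (f 0 1 (i + 1)) w m' ∅) : False := by
  have hL := K.lens hg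
  have KS := K.relabel (sel 0 1 3 2) (by decide)
  obtain ⟨⟩ := hL
  have hnadj : i + 1 < L 0 1 → ¬ G.Adj (f 0 1 (i + 1)) w := by
    intro h hadj
    obtain ⟨x, y, k, hxy, hk, e1, e2⟩ :=
      K.induced hg hl _ (K.mem (x := 0) (y := 1) (by decide) h.le) w hw hadj
    have hE := K.Lsymm _ _ hxy
    rcases K.inter _ _ _ _ _ _ (show EdgeIn k4Edges 0 1 by decide) hxy h.le hk.le e1 with
      ⟨rfl, rfl, h3⟩ | ⟨rfl, rfl, h3⟩ | ⟨c, h3, -⟩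
    · exact hw' _ (by omega) e2
    · rw [K.symm 0 1 _ hxy.symm (by omega)] at e2
      exact hw' _ (by omega) e2
    · unfold IsEnd at h3
      omega
  refine K.cases_off_arris hw hw' ?_ ?_ ?_ ?_ ?_ ?_ ?_
  · rintro rfl
    by_cases h : i + 1 < L 0 1
    · obtain ⟨m', hJ'⟩ := hJ' (hnadj h)
      exact K.unattached_branch hg hl (by omega) h hJ'
    · exact K.attached_branch hg hl hi hi' (by omega) hm hJ
  · rintro rfl
    by_cases h : i + 1 < L 0 1
    · obtain ⟨m', hJ'⟩ := hJ' (hnadj h)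
      exact KS.unattached_branch hg hl (i := i + 1) (by omega) h hJ'
    · exact KS.attached_branch hg hl hi hi' (by simp only [sel]; omega) hm hJ
  · rintro t ht ht' rfl
    by_cases h2 : 2 ≤ L 0 2
    · exact K.attached_adjacent hg hl hi hi' ht ht' h2 hm hJ
    have h : i + 1 < L 0 1 := by omega
    obtain ⟨m', hJ'⟩ := hJ' (hnadj h)
    obtain ⟨h3, h4, rfl⟩ := K.unattached_adjacent hg hl (i := i + 1) (by omega) h ht ht' hJ'
    exact K.attached_near hg hl h4 h3 hm hJ
  · rintro t ht ht' rfl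
    by_cases h2 : 2 ≤ L 0 3
    · exact KS.attached_adjacent hg hl hi hi' ht ht' h2 hm hJ
    have h : i + 1 < L 0 1 := by omega
    obtain ⟨m', hJ'⟩ := hJ' (hnadj h)
    obtain ⟨h3, h4, rfl⟩ := KS.unattached_adjacent hg hl (i := i + 1) (by omega) h ht ht' hJ'
    exact KS.attached_near hg hl h4 h3 hm hJ
  · rintro t ht ht' rfl
    exact K.false_of_attached_fork hg hl (by omega) hi' ht ht' hJ'
  · rintro t ht ht' rfl
    exact KS.false_of_attached_fork hg hl (k := i + 1) (by omega) hi' ht ht' hJ'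
  · rintro t ht ht' rfl
    exact K.attached_opposite hg hl hi hi' ht ht' hm hJ

end K4Frame

section Coloring
variable {G : SimpleGraph V}

theorem exists_coloring_of_colorable_induce {v : V} {n : ℕ} [NeZero n]
    (h : (G.induce {u | u ≠ v}).Colorable n) :
    ∃ c : V → Fin n, ∀ x y, x ≠ v → y ≠ v → G.Adj x y → c x ≠ c y := by
  classical
  obtain ⟨c⟩ := h
  refine ⟨fun x => if hx : x ≠ v then c ⟨x, hx⟩ else 0, ?_⟩
  intro x y hx hy hxy
  simp only [hx, hy, ne_eq, not_false_eq_true, dif_pos]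
  exact c.valid (by simpa using hxy)

theorem colorable_of_two_neighbors {z a b : V} (h : (G.induce {u | u ≠ z}).Colorable 3)
    (hz : ∀ y, G.Adj z y → y = a ∨ y = b) : G.Colorable 3 := by
  classical
  obtain ⟨c, hc⟩ := exists_coloring_of_colorable_induce h
  obtain ⟨k, h1, h2⟩ : ∃ k : Fin 3, k ≠ c a ∧ k ≠ c b := by
    generalize c a = x
    generalize c b = y
    revert x y
    decide
  have hk : ∀ y, G.Adj z y → k ≠ c y := by
    intro y hy
    rcases hz y hy with rfl | rfl
    · exact h1
    · exact h2
  refine ⟨Coloring.mk (fun x => if x = z then k else c x) ?_⟩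
  intro x y hxy
  by_cases hx : x = z
  · subst hx
    simpa [hxy.ne'] using hk y hxy
  · by_cases hy : y = z
    · subst hy
      simpa [hx] using (hk x hxy.symm).symm
    · simpa [hx, hy] using hc x y hx hy hxy

theorem exists_perm_two {α : Type*} [DecidableEq α] {a b a' b' : α} (h : a ≠ b) (h' : a' ≠ b') :
    ∃ π : Equiv.Perm α, π a = a' ∧ π b = b' := by
  have h1 : Equiv.swap a a' b ≠ a' := by
    intro e
    have := (Equiv.swap a a').injective (e.trans (Equiv.swap_apply_left a a').symm)
    exact h this.symm
  exact ⟨(Equiv.swap a a').trans (Equiv.swap (Equiv.swap a a' b) b'),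
    by simp [Equiv.swap_apply_of_ne_of_ne h1.symm h'], by simp⟩

theorem colorable_of_clique_cut {n : ℕ} [NeZero n] (h : ∀ v, (G.induce {u | u ≠ v}).Colorable n)
    {D : Set V} {a b u v : V} (hab : G.Adj a b) (ha : a ∉ D) (hb : b ∉ D) (hv : v ∈ D)
    (hu : u ∉ D) (hua : u ≠ a) (hub : u ≠ b)
    (hD : ∀ x ∈ D, ∀ y ∉ D, G.Adj x y → y = a ∨ y = b) : G.Colorable n := by
  classical
  obtain ⟨c, hc⟩ := exists_coloring_of_colorable_induce (h u)
  obtain ⟨c', hc'⟩ := exists_coloring_of_colorable_induce (h v)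
  have hD' : ∀ x ∉ D, x ≠ v := by rintro x hx rfl; exact hx hv
  have hDu : ∀ x ∈ D, x ≠ u := by rintro x hx rfl; exact hu hx
  obtain ⟨π, h1, h2⟩ := exists_perm_two (hc' a b (hD' a ha) (hD' b hb) hab)
    (hc a b hua.symm hub.symm hab)
  have key : ∀ x ∈ D, ∀ y ∉ D, G.Adj x y → c x ≠ π (c' y) := by
    intro x hx y hy hxy
    rcases hD x hx y hy hxy with rfl | rfl
    · rw [h1]; exact hc _ _ (hDu _ hx) hua.symm hxy
    · rw [h2]; exact hc _ _ (hDu _ hx) hub.symm hxy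
  refine ⟨Coloring.mk (fun x => if x ∈ D then c x else π (c' x)) ?_⟩
  intro x y hxy
  by_cases hx : x ∈ D <;> by_cases hy : y ∈ D <;> simp only [hx, hy, if_true, if_false]
  · exact hc _ _ (hDu _ hx) (hDu _ hy) hxy
  · exact key x hx y hy hxy
  · exact (key y hy x hx hxy.symm).symm
  · exact fun e => hc' _ _ (hD' _ hx) (hD' _ hy) hxy (π.injective e)

end Coloring

def within (G : SimpleGraph V) (R : Set V) : SimpleGraph V where
  Adj a b := G.Adj a b ∧ a ∈ R ∧ b ∈ R
  symm := ⟨fun _ _ h => ⟨h.1.symm, h.2.2, h.2.1⟩⟩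
  loopless := ⟨fun _ h => h.1.ne rfl⟩

theorem within_mono {G : SimpleGraph V} {R R' : Set V} (h : R ⊆ R') : within G R ≤ within G R' :=
  fun _ _ e => ⟨e.1, h e.2.1, h e.2.2⟩

theorem reachable_within_component {G : SimpleGraph V} {R : Set V} {u v : V}
    (h : (within G R).Reachable u v) :
    (within G {x | (within G R).Reachable u x}).Reachable u v := by
  have h' := (SimpleGraph.reachable_iff_reflTransGen _ _).1 h
  induction h' with
  | refl => rfl
  | @tail b c h1 h2 ih =>
    have hb : (within G R).Reachable u b := (SimpleGraph.reachable_iff_reflTransGen _ _).2 h1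
    exact (ih hb).trans (Adj.reachable ⟨h2.1, hb, h⟩)

theorem mem_of_reachable_within {G : SimpleGraph V} {R : Set V} {u v : V} (hu : u ∈ R)
    (h : (within G R).Reachable u v) : v ∈ R := by
  have h' := (SimpleGraph.reachable_iff_reflTransGen _ _).1 h
  induction h' with
  | refl => exact hu
  | tail _ h2 _ => exact h2.2.2

structure Geodesic (G : SimpleGraph V) (R : Set V) (Q : V → Prop) (u : V) (n : ℕ)
    (g : ℕ → V) : Prop where
  start : g 0 = u
  finish : Q (g n)
  mem : ∀ k ≤ n, g k ∈ R
  before : ∀ k < n, ¬ Q (g k)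
  adj : ∀ k < n, G.Adj (g k) (g (k + 1))
  inj : ∀ a ≤ n, ∀ b ≤ n, g a = g b → a = b
  chordless : ∀ a b, a < b → b ≤ n → G.Adj (g a) (g b) → b = a + 1

theorem dist_le_add_of_reachable {G : SimpleGraph V} {u v w : V} (h : G.Reachable u v)
    (h' : G.Reachable v w) : G.dist u w ≤ G.dist u v + G.dist v w := by
  obtain ⟨p, hp⟩ := h.exists_walk_length_eq_dist
  obtain ⟨q, hq⟩ := h'.exists_walk_length_eq_dist
  rw [← hp, ← hq, ← Walk.length_append]
  exact dist_le _

theorem exists_geodesic {G : SimpleGraph V} {R : Set V} {Q : V → Prop} {u : V} (hu : u ∈ R)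
    (h : ∃ v, (within G R).Reachable u v ∧ Q v) : ∃ n g, Geodesic G R Q u n g := by
  classical
  have hex : ∃ n, ∃ v, (within G R).Reachable u v ∧ Q v ∧ (within G R).dist u v = n := by
    obtain ⟨v, h1, h2⟩ := h
    exact ⟨_, v, h1, h2, rfl⟩
  obtain ⟨v, h1, h2, h3⟩ := Nat.find_spec hex
  have hmin : ∀ x, (within G R).Reachable u x → Q x → Nat.find hex ≤ (within G R).dist u x :=
    fun x hx hq => Nat.find_min' hex ⟨x, hx, hq, rfl⟩
  set n := Nat.find hex
  obtain ⟨W, hW⟩ := h1.exists_walk_length_eq_dist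
  rw [h3] at hW
  have hreach : ∀ k, (within G R).Reachable u (W.getVert k) := fun k => ⟨W.take k⟩
  have hdle : ∀ k, (within G R).dist u (W.getVert k) ≤ k := fun k =>
    (dist_le (W.take k)).trans (by simp)
  have hd : ∀ k ≤ n, (within G R).dist u (W.getVert k) = k := by
    intro k hk
    refine le_antisymm (hdle k) ?_
    have h4 : (within G R).dist (W.getVert k) v ≤ n - k := (dist_le (W.drop k)).trans (by simp [hW])
    have h5 := dist_le_add_of_reachable (hreach k) ⟨W.drop k⟩
    omega
  have hmem : ∀ k, W.getVert k ∈ R := fun k => mem_of_reachable_within hu (hreach k)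
  refine ⟨n, W.getVert, by simp, ?_, fun k _ => hmem k, ?_, ?_, ?_, ?_⟩
  · rw [← hW, Walk.getVert_length]; exact h2
  · intro k hk hq
    have := hmin _ (hreach k) hq
    have := hdle k
    omega
  · intro k hk
    exact (W.adj_getVert_succ (hW ▸ hk)).1
  · intro a ha b hb hab
    rw [← hd a ha, ← hd b hb, hab]
  · intro a b hab hb hadj
    have h6 : (within G R).Adj (W.getVert a) (W.getVert b) := ⟨hadj, hmem a, hmem b⟩
    have h7 : (within G R).dist (W.getVert a) (W.getVert b) = 1 := dist_eq_one_iff_adj.2 h6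
    have h5 := dist_le_add_of_reachable (hreach a) h6.reachable
    rw [hd a (by omega), hd b hb, h7] at h5
    omega

structure Chain (G : SimpleGraph V) (S : Set V) (m : ℕ) (g : ℕ → V) (X : Set V) : Prop where
  two_le : 2 ≤ m
  start_mem : g 0 ∈ S
  finish_mem : g m ∈ S
  adj : ∀ k < m, G.Adj (g k) (g (k + 1))
  inj : ∀ a ≤ m, ∀ b ≤ m, g a = g b → a = b
  notMem : ∀ k, 0 < k → k < m → g k ∉ S
  chordless : ∀ a b, a < b → b ≤ m → G.Adj (g a) (g b) → b = a + 1
  attach : ∀ k, 0 < k → k < m → ∀ h ∈ S, G.Adj (g k) h →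
    (k = 1 ∧ h = g 0) ∨ (k + 1 = m ∧ h = g m) ∨ h ∈ X

namespace Chain
variable {G : SimpleGraph V} {S X : Set V} {m : ℕ} {g : ℕ → V}

theorem jump (hc : Chain G S m g X) : Jump G S (g 0) (g m) m X := by
  obtain ⟨W, w1, w2, w3⟩ := exists_walk_of_adj g m hc.adj
  have hsup : ∀ v, v ∈ W.support ↔ ∃ k ≤ m, g k = v := by
    intro v; rw [w2]; simp
  refine ⟨W, ?_, w1, hc.two_le, ?_, ?_, ?_⟩
  · rw [Walk.isPath_def, w2]
    refine List.Nodup.map_on ?_ List.nodup_range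
    intro a ha b hb hab
    simp only [List.mem_range] at ha hb
    exact hc.inj a (by omega) b (by omega) hab
  · intro v hv hS
    obtain ⟨k, hk, rfl⟩ := (hsup v).1 hv
    rcases Nat.eq_zero_or_pos k with rfl | h0
    · exact .inl rfl
    rcases hk.lt_or_eq with h | rfl
    · exact absurd hS (hc.notMem k h0 h)
    · exact .inr rfl
  · intro a ha b hb hab
    obtain ⟨i, hi, rfl⟩ := (hsup a).1 ha
    obtain ⟨j, hj, rfl⟩ := (hsup b).1 hb
    rcases lt_trichotomy i j with h | rfl | h
    · obtain rfl := hc.chordless i j h hj hab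
      exact w3 i (by omega)
    · exact absurd rfl hab.ne
    · obtain rfl := hc.chordless j i h hi hab.symm
      rw [Sym2.eq_swap]
      exact w3 j (by omega)
  · intro v hv hS h hh hadj
    obtain ⟨k, hk, rfl⟩ := (hsup v).1 hv
    have h0 : 0 < k := by
      rcases Nat.eq_zero_or_pos k with rfl | h0
      · exact absurd hc.start_mem hS
      · exact h0
    have h1 : k < m := by
      rcases hk.lt_or_eq with h | rfl
      · exact h
      · exact absurd hc.finish_mem hS
    rcases hc.attach k h0 h1 h hh hadj with ⟨rfl, rfl⟩ | ⟨rfl, rfl⟩ | h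
    · left; rw [Sym2.eq_swap]; exact w3 0 (by omega)
    · exact .inl (w3 k h1)
    · exact .inr h

theorem mono {Y : Set V} (hc : Chain G S m g X) (h : X ⊆ Y) : Chain G S m g Y :=
  { hc with attach := fun k h0 h1 x hx hadj =>
      (hc.attach k h0 h1 x hx hadj).imp_right (Or.imp_right (@h x)) }

theorem le_of_adj (hc : Chain G S m g X) {c r : ℕ} (hg : NearGirth G c) {z' : V} (hz' : z' ∈ S)
    (h0 : g 0 ≠ z') (had : G.Adj (g 0) z') (hr : 0 < r) (hrm : r < m) (hr' : G.Adj (g r) z') :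
    c ≤ r + 2 := by
  set p : ℕ → V := fun k => if k ≤ r then g k else z' with hp
  have p1 : ∀ k ≤ r, p k = g k := fun k hk => by simp [hp, hk]
  have p2 : p (r + 1) = z' := by simp [hp]
  have hne : ∀ k ≤ r, g k ≠ z' := by
    intro k hk e
    rcases Nat.eq_zero_or_pos k with rfl | hk0
    · exact h0 e
    · exact hc.notMem k hk0 (by omega) (e ▸ hz')
  obtain ⟨W, w1, w2, -⟩ := exists_walk_of_adj (G := G) p (r + 1) (by
    intro k hk
    rcases (Nat.lt_succ_iff.1 hk).lt_or_eq with h | rfl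
    · rw [p1 k h.le, p1 (k + 1) h]; exact hc.adj k (by omega)
    · rw [p1 k le_rfl, p2]; exact hr')
  have hW : W.IsPath := by
    rw [Walk.isPath_def, w2]
    refine List.Nodup.map_on ?_ List.nodup_range
    intro a ha b hb hab
    simp only [List.mem_range] at ha hb
    rcases (show a ≤ r + 1 by omega).lt_or_eq with h | rfl <;>
    rcases (show b ≤ r + 1 by omega).lt_or_eq with h' | rfl
    · rw [p1 a (by omega), p1 b (by omega)] at hab
      exact hc.inj a (by omega) b (by omega) hab
    · rw [p1 a (by omega), p2] at hab
      exact absurd hab (hne a (by omega))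
    · rw [p1 b (by omega), p2] at hab
      exact absurd hab.symm (hne b (by omega))
    · rfl
  have e0 : p 0 = g 0 := p1 0 (by omega)
  have had' : G.Adj (p (r + 1)) (p 0) := by rw [p2, e0]; exact had.symm
  have := hg.le _ _ (Walk.IsPath.isCycle_append hW (q := had'.toWalk)
    (by simpa using had'.ne) (by
      intro v hv hv'
      simp only [Adj.toWalk, Walk.support_cons, Walk.support_nil, List.tail_cons,
        List.mem_singleton] at hv'
      subst hv'
      exact start_notMem_tail hW hv) (.inl (by omega)))
  simpa [w1] using this

theorem detach {z' : V} (hc : Chain G S m g {z'}) {c : ℕ} (hg : NearGirth G c)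
    (hu : ∀ v ∉ S, ∀ a ∈ S, ∀ b ∈ S, G.Adj v a → G.Adj v b → a = b) (hz' : z' ∈ S)
    (hz : G.Adj (g 0) z') (hw : g m ≠ z') :
    Chain G S m g ∅ ∨
      (c ≤ m ∧ (¬ G.Adj z' (g m) → ∃ m', Jump G S z' (g m) m' ∅)) := by
  classical
  by_cases hex : ∃ k, 0 < k ∧ k < m ∧ G.Adj (g k) z'
  swap
  · left
    refine { hc with attach := fun k h0 h1 x hx hadj => ?_ }
    rcases hc.attach k h0 h1 x hx hadj with h | h | rfl
    · exact .inl h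
    · exact .inr (.inl h)
    · exact absurd ⟨k, h0, h1, hadj⟩ hex
  right
  obtain ⟨r, ⟨hr0, hrm, hr⟩, hmax⟩ : ∃ r, (0 < r ∧ r < m ∧ G.Adj (g r) z') ∧
      ∀ k, (0 < k ∧ k < m ∧ G.Adj (g k) z') → k ≤ r := by
    obtain ⟨k, hk⟩ := hex
    exact ⟨Nat.findGreatest (fun k => 0 < k ∧ k < m ∧ G.Adj (g k) z') m,
      Nat.findGreatest_spec (P := fun k => 0 < k ∧ k < m ∧ G.Adj (g k) z') hk.2.1.le hk,
      fun k hk => Nat.le_findGreatest hk.2.1.le hk⟩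
  have hr1 : r ≠ 1 := by
    rintro rfl
    exact hz.ne (hu _ (hc.notMem 1 hr0 hrm) _ hc.start_mem _ hz' (hc.adj 0 (by omega)).symm hr)
  have hr2 : r + 1 ≠ m := by
    rintro rfl
    exact hw (hu _ (hc.notMem r hr0 hrm) _ hc.finish_mem _ hz' (hc.adj r (by omega)) hr)
  refine ⟨?_, fun hnadj => ?_⟩
  · have := hc.le_of_adj hg hz' hz.ne hz hr0 hrm hr
    omega
  set p : ℕ → V := fun k => if k = 0 then z' else g (r + k - 1) with hp
  have p0 : p 0 = z' := by simp [hp]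
  have p1 : ∀ k, 0 < k → p k = g (r + k - 1) := fun k hk => by simp [hp, hk.ne']
  have pm : p (m - r + 1) = g m := by rw [p1 _ (by omega)]; congr 1; omega
  have hne : ∀ k, 0 < k → k ≤ m → g k ≠ z' := by
    intro k hk hkm e
    rcases hkm.lt_or_eq with h | rfl
    · exact hc.notMem k hk h (e ▸ hz')
    · exact hw e
  have hch : Chain G S (m - r + 1) p ∅ := by
    refine ⟨by omega, by rwa [p0], by rw [pm]; exact hc.finish_mem, ?_, ?_, ?_, ?_, ?_⟩
    · intro k hk
      rcases Nat.eq_zero_or_pos k with rfl | h0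
      · rw [p0, p1 1 (by omega)]; exact hr.symm
      · rw [p1 k h0, p1 (k + 1) (by omega), show r + (k + 1) - 1 = (r + k - 1) + 1 by omega]
        exact hc.adj _ (by omega)
    · intro a ha b hb hab
      rcases Nat.eq_zero_or_pos a with rfl | h0 <;> rcases Nat.eq_zero_or_pos b with rfl | h0'
      · rfl
      · rw [p0, p1 b h0'] at hab
        exact absurd hab.symm (hne _ (by omega) (by omega))
      · rw [p0, p1 a h0] at hab
        exact absurd hab (hne _ (by omega) (by omega))
      · rw [p1 a h0, p1 b h0'] at hab
        have := hc.inj _ (by omega) _ (by omega) hab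
        omega
    · intro k h0 hk
      rw [p1 k h0]
      exact hc.notMem _ (by omega) (by omega)
    · intro a b hab hb hadj
      rw [p1 b (by omega)] at hadj
      rcases Nat.eq_zero_or_pos a with rfl | h0
      · rw [p0] at hadj
        by_cases h : r + b - 1 = m
        · rw [h] at hadj
          exact absurd hadj hnadj
        · have := hmax _ ⟨by omega, by omega, hadj.symm⟩
          omega
      · rw [p1 a h0] at hadj
        have := hc.chordless _ _ (by omega) (by omega) hadj
        omega
    · intro k h0 hk h hh hadj
      rw [p1 k h0] at hadj
      rcases hc.attach _ (by omega) (by omega) h hh hadj with h | h | rfl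
      · omega
      · exact .inr (.inl ⟨by omega, by rw [pm]; exact h.2⟩)
      · have := hmax _ ⟨by omega, by omega, hadj⟩
        exact .inl ⟨by omega, p0.symm⟩
  have := hch.jump
  rw [p0, pm] at this
  exact ⟨_, this⟩

end Chain

theorem Geodesic.chain {G : SimpleGraph V} {S D : Set V} {Q : V → Prop} {z w : V} {n : ℕ}
    {g : ℕ → V} (hG : Geodesic G (insert z D) Q z n g) (hz : z ∈ S) (hw : w ∈ S) (hzw : z ≠ w)
    (hnz : ¬ G.Adj z w) (hD : ∀ d ∈ D, d ∉ S) (hQ : ∀ v, Q v → v ∈ D) (hadj : G.Adj (g n) w)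
    (hQw : ∀ v ∈ D, G.Adj v w → Q v)
    (hu : ∀ v ∉ S, ∀ a ∈ S, ∀ b ∈ S, G.Adj v a → G.Adj v b → a = b) :
    (∀ k, 0 < k → k ≤ n → g k ∈ D) ∧ Chain G S (n + 1) (fun k => if k ≤ n then g k else w)
      {h | h ∈ S ∧ h ≠ z ∧ h ≠ w ∧ ∃ k, 0 < k ∧ k < n ∧ G.Adj (g k) h} := by
  have h0 := hG.start
  have hn : 1 ≤ n := by
    rcases Nat.eq_zero_or_pos n with rfl | h
    · exact absurd hz (hD _ (hQ _ (h0 ▸ hG.finish)))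
    · exact h
  have hmem : ∀ k, 0 < k → k ≤ n → g k ∈ D := by
    intro k hk hkn
    rcases hG.mem k hkn with h | h
    · have := hG.inj k hkn 0 (by omega) (h.trans h0.symm)
      omega
    · exact h
  have hne : ∀ k ≤ n, g k ≠ w := by
    intro k hk e
    rcases Nat.eq_zero_or_pos k with rfl | h
    · exact hzw (h0.symm.trans e)
    · exact hD _ (hmem k h hk) (e ▸ hw)
  have hlast : ∀ k ≤ n, G.Adj (g k) w → k = n := by
    intro k hk had
    rcases Nat.eq_zero_or_pos k with rfl | h
    · exact absurd (h0 ▸ had) hnz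
    · by_contra hkn
      exact hG.before k (by omega) (hQw _ (hmem k h hk) had)
  set p : ℕ → V := fun k => if k ≤ n then g k else w with hp
  have p1 : ∀ k ≤ n, p k = g k := fun k hk => by simp [hp, hk]
  have p2 : p (n + 1) = w := by simp [hp]
  refine ⟨hmem, by omega, by rwa [p1 0 (by omega), h0], by rwa [p2], ?_, ?_, ?_, ?_, ?_⟩
  · intro k hk
    rcases (Nat.lt_succ_iff.1 hk).lt_or_eq with h | rfl
    · rw [p1 k h.le, p1 (k + 1) h]; exact hG.adj k h
    · rw [p1 k le_rfl, p2]; exact hadj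
  · intro a ha b hb hab
    rcases ha.lt_or_eq with h | rfl <;> rcases hb.lt_or_eq with h' | rfl
    · rw [p1 a (by omega), p1 b (by omega)] at hab
      exact hG.inj a (by omega) b (by omega) hab
    · rw [p1 a (by omega), p2] at hab
      exact absurd hab (hne a (by omega))
    · rw [p1 b (by omega), p2] at hab
      exact absurd hab.symm (hne b (by omega))
    · rfl
  · intro k hk hkn
    rw [p1 k (by omega)]
    exact hD _ (hmem k hk (by omega))
  · intro a b hab hb had
    rcases hb.lt_or_eq with h' | rfl
    · rw [p1 a (by omega), p1 b (by omega)] at had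
      exact hG.chordless a b hab (by omega) had
    · rw [p1 a (by omega), p2] at had
      rw [hlast a (by omega) had]
  · intro k hk hkn h hh had
    rw [p1 k (by omega)] at had
    rw [p1 0 (by omega), p2, h0]
    by_cases e1 : h = z
    · subst e1
      exact .inl ⟨hG.chordless 0 k hk (by omega) (by rw [h0]; exact had.symm), rfl⟩
    by_cases e2 : h = w
    · subst e2
      exact .inr (.inl ⟨by rw [hlast k (by omega) had], rfl⟩)
    have hkn' : k ≠ n := by
      rintro rfl
      exact e2 (hu _ (hD _ (hmem k hk le_rfl)) _ hh _ hw had hadj)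
    exact .inr (.inr ⟨hh, e1, e2, k, hk, by omega, had⟩)

namespace K4Frame
variable {G : SimpleGraph V} {l : ℕ} {S : Set V} {φ : ℕ → V}
    {f : ℕ → ℕ → ℕ → V} {L : ℕ → ℕ → ℕ}

theorem attachments_close (K : K4Frame G l S φ f L) (hg : NearGirth G (2 * l + 1)) (hl : 4 ≤ l)
    {D : Set V} (hD : ∀ d ∈ D, d ∉ S) (hconn : ∀ d ∈ D, ∀ d' ∈ D, (within G D).Reachable d d')
    (hatt : ∀ d ∈ D, ∀ h ∈ S, G.Adj d h → ∃ k ≤ L 0 1, h = f 0 1 k) {i j : ℕ} (hi : i ≤ L 0 1)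
    (hj : j ≤ L 0 1) {d d' : V} (hd : d ∈ D) (hd' : d' ∈ D) (hdi : G.Adj d (f 0 1 i))
    (hdj : G.Adj d' (f 0 1 j)) : j ≤ i + 1 := by
  classical
  by_contra hij
  have h01 : EdgeIn k4Edges 0 1 := by decide
  have hlo : ∃ k, k ≤ L 0 1 ∧ ∃ x ∈ D, G.Adj x (f 0 1 k) := ⟨i, hi, d, hd, hdi⟩
  obtain ⟨a, ⟨ha, x, hx, hxa⟩, hamin⟩ : ∃ a, (a ≤ L 0 1 ∧ ∃ x ∈ D, G.Adj x (f 0 1 a)) ∧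
      ∀ k, (k ≤ L 0 1 ∧ ∃ x ∈ D, G.Adj x (f 0 1 k)) → a ≤ k :=
    ⟨Nat.find hlo, Nat.find_spec hlo, fun k hk => Nat.find_min' hlo hk⟩
  obtain ⟨b, ⟨hb, y, hy, hyb⟩, hbmax⟩ : ∃ b, (b ≤ L 0 1 ∧ ∃ x ∈ D, G.Adj x (f 0 1 b)) ∧
      ∀ k, (k ≤ L 0 1 ∧ ∃ x ∈ D, G.Adj x (f 0 1 k)) → k ≤ b :=
    ⟨Nat.findGreatest (fun k => k ≤ L 0 1 ∧ ∃ x ∈ D, G.Adj x (f 0 1 k)) (L 0 1),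
      Nat.findGreatest_spec (P := fun k => k ≤ L 0 1 ∧ ∃ x ∈ D, G.Adj x (f 0 1 k)) hi
        ⟨hi, d, hd, hdi⟩, fun k hk => Nat.le_findGreatest hk.1 hk⟩
  have hab : a + 2 ≤ b := by
    have := hamin i ⟨hi, d, hd, hdi⟩
    have := hbmax j ⟨hj, d', hd', hdj⟩
    omega
  have hza := K.mem h01 ha
  have hwb := K.mem h01 hb
  have hzw : f 0 1 a ≠ f 0 1 b := fun e => by have := K.inj h01 ha hb e; omega
  have hnz : ¬ G.Adj (f 0 1 a) (f 0 1 b) := by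
    intro had
    have := K.le_of_weakJump_same hg h01 (i := a) (j := b) (m := 1) (by omega) hb
      ⟨had.symm.toWalk, by simp [had.ne'], by simp, le_rfl, by simp⟩ (by omega)
    have := K.le_half hg h01
    omega
  obtain ⟨n, g, hG⟩ := exists_geodesic (G := G) (R := insert (f 0 1 a) D)
    (Q := fun v => v ∈ D ∧ G.Adj v (f 0 1 b)) (u := f 0 1 a) (Set.mem_insert _ _)
    ⟨y, (Adj.reachable (G := within G (insert (f 0 1 a) D))
      (show (within G _).Adj (f 0 1 a) x from
        ⟨hxa.symm, Set.mem_insert _ _, Set.mem_insert_of_mem _ hx⟩)).trans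
      ((hconn x hx y hy).mono (within_mono (Set.subset_insert _ _))), hy, hyb⟩
  obtain ⟨hmem, hc⟩ := hG.chain hza hwb hzw hnz hD (fun v hv => hv.1) hG.finish.2
    (fun v hv h => ⟨hv, h⟩)
    (fun v hv a ha b hb h h' => K.unique_attachment hg hl hv ha hb h h')
  have hJ := (hc.mono (Y := {v | ∃ k, a < k ∧ k < b ∧ v = f 0 1 k}) (by
    rintro h ⟨hS, hz, hw, k, hk0, hkn, had⟩
    have hkD := hmem k hk0 hkn.le
    obtain ⟨k', hk', rfl⟩ := hatt _ hkD _ hS had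
    have h1 := hamin k' ⟨hk', _, hkD, had⟩
    have h2 := hbmax k' ⟨hk', _, hkD, had⟩
    have h3 : k' ≠ a := by rintro rfl; exact hz rfl
    have h4 : k' ≠ b := by rintro rfl; exact hw rfl
    exact ⟨k', by omega, by omega, rfl⟩)).jump
  simp only [Nat.zero_le, if_true, hG.start, Nat.not_succ_le_self, if_false] at hJ
  exact K.false_of_jump_same hg hl hab hb hJ

theorem exists_unattached (K : K4Frame G l S φ f L) (hg : NearGirth G (2 * l + 1)) (hl : 4 ≤ l)
    {i : ℕ} (hi : 0 < i) (hi' : i < L 0 1)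
    (hi2 : (2 ≤ L 1 2 ∧ 2 ≤ L 0 2) ∨ (2 ≤ i ∧ i + 2 ≤ L 0 1)) {D : Set V} (hD : ∀ d ∈ D, d ∉ S)
    (hconn : ∀ d ∈ D, ∀ d' ∈ D, (within G D).Reachable d d') {x y w : V} (hx : x ∈ D)
    (hxz : G.Adj (f 0 1 i) x) (hy : y ∈ D) (hw : w ∈ S) (hyw : G.Adj y w)
    (hw' : ∀ k ≤ L 0 1, w ≠ f 0 1 k) :
    ∃ j m, 0 < j ∧ j < L 2 3 ∧ Jump G S (f 0 1 i) (f 2 3 j) m ∅ ∧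
      (m = L 1 2 ∧ i + j = L 0 1 ∨ m = L 0 2 ∧ i = j) ∧ l + 1 ≤ i + m ∧ l + 1 ≤ L 0 1 - i + m := by
  classical
  have h01 : EdgeIn k4Edges 0 1 := by decide
  have hz := K.mem h01 hi'.le
  have hu : ∀ v ∉ S, ∀ a ∈ S, ∀ b ∈ S, G.Adj v a → G.Adj v b → a = b :=
    fun v hv a ha b hb h h' => K.unique_attachment hg hl hv ha hb h h'
  obtain ⟨n, g, hG⟩ := exists_geodesic (G := G) (R := insert (f 0 1 i) D)
    (Q := fun v => v ∈ D ∧ ∃ w ∈ S, (∀ k ≤ L 0 1, w ≠ f 0 1 k) ∧ G.Adj v w)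
    (u := f 0 1 i) (Set.mem_insert _ _)
    ⟨y, (Adj.reachable (G := within G (insert (f 0 1 i) D))
      (show (within G _).Adj (f 0 1 i) x from
        ⟨hxz, Set.mem_insert _ _, Set.mem_insert_of_mem _ hx⟩)).trans
      ((hconn x hx y hy).mono (within_mono (Set.subset_insert _ _))), hy, w, hw, hw', hyw⟩
  clear hy hw hyw hw' y w
  obtain ⟨-, w, hw, hw', hyw⟩ := hG.finish
  have hnz : ¬ G.Adj (f 0 1 i) w := by
    intro had
    obtain ⟨a, b, k, hab, hk, e1, e2⟩ := K.induced hg hl _ hz w hw had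
    rcases K.inter _ _ _ _ _ _ h01 hab hi'.le hk.le e1 with
      ⟨rfl, rfl, h3⟩ | ⟨rfl, rfl, h3⟩ | ⟨c, h3, -⟩
    · exact hw' _ (by omega) e2
    · have hE := K.Lsymm _ _ hab
      rw [K.symm 0 1 _ hab.symm (by omega)] at e2
      exact hw' _ (by omega) e2
    · unfold IsEnd at h3
      omega
  obtain ⟨hmem, hc⟩ := hG.chain hz hw (hw' i hi'.le).symm hnz hD (fun v hv => hv.1) hyw
    (fun v hv h => ⟨hv, w, hw, hw', h⟩) hu
  have hatt : ∀ k, 0 < k → k < n → ∀ h ∈ S, G.Adj (g k) h → ∃ k' ≤ L 0 1, h = f 0 1 k' := by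
    intro k hk hkn h hS had
    by_contra hcon
    push Not at hcon
    exact hG.before k hkn ⟨hmem k hk hkn.le, h, hS, hcon, had⟩
  have hsub : ∀ k, 0 < k → k < n → (within G {v | ∃ k, 0 < k ∧ k < n ∧ v = g k}).Reachable
      (g 1) (g k) := by
    intro k hk
    induction k, hk using Nat.le_induction with
    | base => intro _; rfl
    | succ k hk ih =>
      intro hkn
      exact (ih (by omega)).trans (Adj.reachable
        (show (within G _).Adj (g k) (g (k + 1)) from
          ⟨hG.adj k (by omega), ⟨k, hk, by omega, rfl⟩, ⟨k + 1, by omega, hkn, rfl⟩⟩))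
  have hclose : ∀ a b k k', a ≤ L 0 1 → b ≤ L 0 1 → 0 < k → k < n → 0 < k' → k' < n →
      G.Adj (g k) (f 0 1 a) → G.Adj (g k') (f 0 1 b) → b ≤ a + 1 := by
    intro a b k k' ha hb h1 h2 h3 h4 h5 h6
    refine K.attachments_close hg hl (D := {v | ∃ k, 0 < k ∧ k < n ∧ v = g k}) ?_ ?_ ?_ ha hb
      ⟨k, h1, h2, rfl⟩ ⟨k', h3, h4, rfl⟩ h5 h6
    · rintro _ ⟨k, hk, hkn, rfl⟩
      exact hD _ (hmem k hk hkn.le)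
    · rintro _ ⟨k, hk, hkn, rfl⟩ _ ⟨k', hk', hkn', rfl⟩
      exact (hsub k hk hkn).symm.trans (hsub k' hk' hkn')
    · rintro _ ⟨k, hk, hkn, rfl⟩
      exact hatt k hk hkn
  set p : ℕ → V := fun k => if k ≤ n then g k else w with hp
  have p0 : p 0 = f 0 1 i := by simp [hp, hG.start]
  have pn : p (n + 1) = w := by simp [hp]
  have hnear : ∀ h ∈ S, h ≠ f 0 1 i → (∃ k, 0 < k ∧ k < n ∧ G.Adj (g k) h) →
      h = f 0 1 (i + 1) ∨ h = f 0 1 (i - 1) := by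
    rintro h hS hne ⟨k, hk, hkn, had⟩
    obtain ⟨k', hk', rfl⟩ := hatt k hk hkn h hS had
    have h1 : G.Adj (g 1) (f 0 1 i) := by
      have := hG.adj 0 (by omega)
      rw [hG.start] at this
      exact this.symm
    have h2 := hclose _ _ _ _ hk' hi'.le hk hkn one_pos (by omega) had h1
    have h3 := hclose _ _ _ _ hi'.le hk' one_pos (by omega) hk hkn h1 had
    have h4 : k' ≠ i := by rintro rfl; exact hne rfl
    rcases (show k' = i + 1 ∨ k' = i - 1 by omega) with rfl | rfl
    · exact .inl rfl
    · exact .inr rfl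
  have done : Chain G S (n + 1) p ∅ → ∃ j m, 0 < j ∧ j < L 2 3 ∧
      Jump G S (f 0 1 i) (f 2 3 j) m ∅ ∧ (m = L 1 2 ∧ i + j = L 0 1 ∨ m = L 0 2 ∧ i = j) ∧
      l + 1 ≤ i + m ∧ l + 1 ≤ L 0 1 - i + m := by
    intro hc
    have hJ := hc.jump
    rw [p0, pn] at hJ
    obtain ⟨j, h1, h2, rfl, h3⟩ := K.opposite_of_unattached hg hl hi hi' hi2 hw hw' hJ
    exact ⟨j, _, h1, h2, hJ, h3⟩
  by_cases hup : ∃ k, 0 < k ∧ k < n ∧ G.Adj (g k) (f 0 1 (i + 1))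
  · have hc' := hc.mono (Y := {f 0 1 (i + 1)}) (by
      rintro h ⟨hS, h1, h2, h3⟩
      rcases hnear h hS h1 h3 with h | rfl
      · exact h
      · obtain ⟨k, hk, hkn, had⟩ := hup
        obtain ⟨k', hk', hkn', had'⟩ := h3
        have := hclose _ _ _ _ (by omega) (by omega) hk' hkn' hk hkn had' had
        omega)
    rcases hc'.detach hg hu (K.mem h01 hi') (by rw [p0]; exact K.adj _ _ _ h01 hi')
      (by rw [pn]; exact hw' _ hi') with h | ⟨h1, h2⟩
    · exact done h
    · have hJ := hc'.jump
      rw [pn] at h2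
      rw [p0, pn] at hJ
      exact (K.false_of_attached_succ hg hl hi hi' hi2 hw hw' (by omega) hJ h2).elim
  · have hc' := hc.mono (Y := {f 0 1 (i - 1)}) (by
      rintro h ⟨hS, h1, h2, h3⟩
      rcases hnear h hS h1 h3 with rfl | h
      · exact absurd h3 hup
      · exact h)
    rcases hc'.detach hg hu (K.mem h01 (by omega)) (by
        have := K.adj 0 1 (i - 1) h01 (by omega)
        rw [Nat.sub_add_cancel hi] at this
        rw [p0]; exact this.symm)
      (by rw [pn]; exact hw' _ (by omega)) with h | ⟨h1, h2⟩
    · exact done h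
    · have hJ := hc'.jump
      rw [pn] at h2
      rw [p0, pn] at hJ
      have hL := K.lens hg
      obtain ⟨⟩ := hL
      have e2 : f 0 1 (i - 1) = f 1 0 (L 0 1 - i + 1) := by
        rw [K.flip (by omega) h01]; congr 1; omega
      rw [e2] at h2
      rw [e2, K.flip hi'.le h01] at hJ
      refine ((K.relabel (sel 1 0 3 2) (by decide)).false_of_attached_succ hg hl (i := L 0 1 - i)
        (by omega) (by simp only [sel]; omega) (by simp only [sel]; omega) hw ?_
        (by omega) hJ h2).elim
      intro k hk
      simp only [sel] at hk ⊢
      rw [K.flip hk h01.symm]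
      exact hw' _ (by omega)

end K4Frame

namespace K4Frame
variable {G : SimpleGraph V} {l : ℕ} {S : Set V} {φ : ℕ → V}
    {f : ℕ → ℕ → ℕ → V} {L : ℕ → ℕ → ℕ}

theorem eq_of_adj (K : K4Frame G l S φ f L) (hg : NearGirth G (2 * l + 1)) (hl : 4 ≤ l)
    {i : ℕ} (hi : 0 < i) (hi' : i < L 0 1) {w : V} (hw : w ∈ S) (had : G.Adj (f 0 1 i) w) :
    w = f 0 1 (i - 1) ∨ w = f 0 1 (i + 1) := by
  have h01 : EdgeIn k4Edges 0 1 := by decide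
  obtain ⟨a, b, k, hab, hk, e1, e2⟩ := K.induced hg hl _ (K.mem h01 hi'.le) w hw had
  rcases K.inter _ _ _ _ _ _ h01 hab hi'.le hk.le e1 with
    ⟨rfl, rfl, rfl⟩ | ⟨rfl, rfl, h3⟩ | ⟨c, h3, -⟩
  · exact .inr e2
  · left
    have hE := K.Lsymm _ _ hab
    rw [K.symm 0 1 _ hab.symm (by omega)] at e2
    rw [e2]; congr 1; omega
  · unfold IsEnd at h3
    omega

theorem exists_jump (K : K4Frame G l S φ f L) (hg : NearGirth G (2 * l + 1)) (hl : 4 ≤ l)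
    (h3 : ¬ G.Colorable 3) (hv : ∀ v, (G.induce {u | u ≠ v}).Colorable 3)
    {i : ℕ} (hi : 0 < i) (hi' : i < L 0 1)
    (hi2 : (2 ≤ L 1 2 ∧ 2 ≤ L 0 2) ∨ (2 ≤ i ∧ i + 2 ≤ L 0 1)) :
    ∃ j m, 0 < j ∧ j < L 2 3 ∧ Jump G S (f 0 1 i) (f 2 3 j) m ∅ ∧
      (m = L 1 2 ∧ i + j = L 0 1 ∨ m = L 0 2 ∧ i = j) ∧ l + 1 ≤ i + m ∧ l + 1 ≤ L 0 1 - i + m := by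
  have h01 : EdgeIn k4Edges 0 1 := by decide
  obtain ⟨x, hxS, hzx⟩ : ∃ x, x ∉ S ∧ G.Adj (f 0 1 i) x := by
    by_contra! hcon
    refine h3 (colorable_of_two_neighbors (hv (f 0 1 i)) (a := f 0 1 (i - 1))
      (b := f 0 1 (i + 1)) fun y hy => ?_)
    by_cases hyS : y ∈ S
    · exact K.eq_of_adj hg hl hi hi' hyS hy
    · exact absurd hy (hcon y hyS)
  set D : Set V := {v | (within G Sᶜ).Reachable x v} with hDdef
  have hD : ∀ d ∈ D, d ∉ S := fun d hd => mem_of_reachable_within (R := Sᶜ) hxS hd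
  have hconn : ∀ d ∈ D, ∀ d' ∈ D, (within G D).Reachable d d' := fun d hd d' hd' =>
    (reachable_within_component hd).symm.trans (reachable_within_component hd')
  have hx : x ∈ D := Reachable.refl _
  have hout : ∀ d ∈ D, ∀ y ∉ D, G.Adj d y → y ∈ S := by
    intro d hd y hy had
    by_contra hyS
    exact hy (Reachable.trans hd (Adj.reachable (G := within G Sᶜ) ⟨had, hD d hd, hyS⟩))
  by_cases hex : ∃ y ∈ D, ∃ w ∈ S, G.Adj y w ∧ ∀ k ≤ L 0 1, w ≠ f 0 1 k
  · obtain ⟨y, hy, w, hw, hyw, hw'⟩ := hex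
    exact K.exists_unattached hg hl hi hi' hi2 hD hconn hx hzx hy hw hyw hw'
  exfalso
  push Not at hex
  have hatt : ∀ d ∈ D, ∀ h ∈ S, G.Adj d h → ∃ k ≤ L 0 1, h = f 0 1 k := hex
  have hclose : ∀ a ≤ L 0 1, ∀ b ≤ L 0 1, ∀ d ∈ D, ∀ d' ∈ D, G.Adj d (f 0 1 a) →
      G.Adj d' (f 0 1 b) → b ≤ a + 1 := fun a ha b hb d hd d' hd' h h' =>
    K.attachments_close hg hl hD hconn hatt ha hb hd hd' h h'
  obtain ⟨k, hk, hpos⟩ : ∃ k < L 0 1, ∀ a ≤ L 0 1, ∀ d ∈ D, G.Adj d (f 0 1 a) →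
      a = k ∨ a = k + 1 := by
    by_cases hlow : ∃ d ∈ D, G.Adj d (f 0 1 (i - 1))
    · obtain ⟨d, hd, had⟩ := hlow
      refine ⟨i - 1, by omega, fun a ha d' hd' had' => ?_⟩
      have h1 := hclose (i - 1) (by omega) a ha d hd d' hd' had had'
      have h2 := hclose a ha i hi'.le d' hd' x hx had' hzx.symm
      omega
    · refine ⟨i, hi', fun a ha d' hd' had' => ?_⟩
      have h1 := hclose i hi'.le a ha x hx d' hd' hzx.symm had'
      have h2 := hclose a ha i hi'.le d' hd' x hx had' hzx.symm
      have h3 : a ≠ i - 1 := by rintro rfl; exact hlow ⟨d', hd', had'⟩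
      omega
  have hφ2 : φ 2 ∈ S := K.start 2 3 (by decide) ▸ K.mem (by decide) (Nat.zero_le _)
  have hoff : ∀ a ≤ L 0 1, φ 2 ≠ f 0 1 a := by
    intro a ha e
    rw [← K.start 2 3 (by decide)] at e
    have := K.Lpos 2 3 (by decide)
    rcases K.inter _ _ _ _ _ _ (by decide) h01 (Nat.zero_le _) ha e with h | h | ⟨c, h, h'⟩
    · omega
    · omega
    · unfold IsEnd at h h'
      omega
  refine h3 (colorable_of_clique_cut hv (D := D) (a := f 0 1 k) (b := f 0 1 (k + 1)) (u := φ 2)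
    (K.adj _ _ _ h01 hk) (fun h => hD _ h (K.mem h01 hk.le)) (fun h => hD _ h (K.mem h01 hk)) hx
    (fun h => hD _ h hφ2) (hoff _ hk.le) (hoff _ hk) fun d hd y hy had => ?_)
  obtain ⟨a, ha, rfl⟩ := hatt d hd y (hout d hd y hy had) had
  rcases hpos a ha d hd had with rfl | rfl <;> simp

theorem not_all_two_le (K : K4Frame G l S φ f L) (hg : NearGirth G (2 * l + 1)) (hl : 4 ≤ l)
    (h3 : ¬ G.Colorable 3) (hv : ∀ v, (G.induce {u | u ≠ v}).Colorable 3)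
    (h01 : 2 ≤ L 0 1) (h12 : 2 ≤ L 1 2) (h02 : 2 ≤ L 0 2) : False := by
  have main : ∀ {φ f L}, K4Frame G l S φ f L → 2 ≤ L 0 1 → 2 ≤ L 1 2 → 2 ≤ L 0 2 →
      L 1 2 ≤ L 0 1 → L 0 2 ≤ L 0 1 → False := by
    intro φ f L K h01 h12 h02 hp hq
    obtain ⟨⟩ := K.lens hg
    obtain ⟨j, m, -, -, -, hm, h, -⟩ := K.exists_jump hg hl h3 hv (i := 1) (by omega) (by omega)
      (.inl ⟨h12, h02⟩)
    omega
  obtain ⟨⟩ := K.lens hg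
  by_cases hp : L 1 2 ≤ L 0 1 ∧ L 0 2 ≤ L 0 1
  · exact main K h01 h12 h02 hp.1 hp.2
  by_cases hq : L 0 1 ≤ L 1 2 ∧ L 0 2 ≤ L 1 2
  · refine main (K.relabel (sel 1 2 0 3) (by decide)) ?_ ?_ ?_ ?_ ?_ <;> simp only [sel] <;> omega
  · refine main (K.relabel (sel 0 2 1 3) (by decide)) ?_ ?_ ?_ ?_ ?_ <;> simp only [sel] <;> omega

end K4Frame

def undirected {α : Type*} (f : ℕ → ℕ → α) (x y : ℕ) : α := if x < y then f x y else f y x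

theorem undirected_of_lt {α : Type*} {f : ℕ → ℕ → α} {x y : ℕ} (h : x < y) :
    undirected f x y = f x y := if_pos h

theorem undirected_of_gt {α : Type*} {f : ℕ → ℕ → α} {x y : ℕ} (h : x < y) :
    undirected f y x = f x y := if_neg (by omega)

def twoSided (g : ℕ → ℕ → ℕ → V) (L : ℕ → ℕ → ℕ) (x y k : ℕ) : V :=
  if x < y then g x y k else g y x (L y x - k)

theorem lt_of_mem_k4Edges {x y : ℕ} : (x, y) ∈ k4Edges ↔ x < y ∧ y < 4 := by
  simp only [List.mem_cons, Prod.mk.injEq, List.not_mem_nil, or_false]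
  omega

theorem K4Frame.exists_of_paths {G : SimpleGraph V} {l : ℕ} {φ : ℕ → V}
    (T : ℕ → ℕ → V → Prop) (L : ℕ → ℕ → ℕ)
    (hpath : ∀ x y, x < y → y < 4 → ∃ P : G.Walk (φ x) (φ y), P.IsPath ∧ P.length = L x y ∧
      ∀ v, v ∈ P.support ↔ T x y v)
    (hpos : ∀ x y, x < y → y < 4 → 1 ≤ L x y)
    (hdis : ∀ x y x' y', x < y → y < 4 → x' < y' → y' < 4 → 4 * x + y < 4 * x' + y' → ∀ v,
      T x y v → T x' y' v → ∃ c, v = φ c ∧ (c = x ∨ c = y) ∧ (c = x' ∨ c = y'))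
    (h23 : L 2 3 = L 0 1) (h03 : L 0 3 = L 1 2) (h13 : L 1 3 = L 0 2)
    (hsum : L 0 1 + L 1 2 + L 0 2 = 2 * l + 1) :
    ∃ S f, K4Frame G l S φ f (undirected L) := by
  choose P hP hlen hsupp using hpath
  set g : ℕ → ℕ → ℕ → V := fun x y k =>
    if h : x < y ∧ y < 4 then (P x y h.1 h.2).getVert k else φ 0 with hg
  have hgP : ∀ x y (h : x < y) (h' : y < 4) k, g x y k = (P x y h h').getVert k := by
    intro x y h h' k; simp [hg, h, h']
  have hf : ∀ x y k, x < y → twoSided g L x y k = g x y k := fun x y k h => if_pos h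
  have hT : ∀ x y, x < y → y < 4 → ∀ k, T x y (g x y k) := by
    intro x y h h' k
    rw [hgP x y h h', ← hsupp x y h h']
    exact Walk.getVert_mem_support _ _
  have hends : ∀ x y, x < y → y < 4 → ∀ k ≤ L x y, ∀ c, (c = x ∨ c = y) → g x y k = φ c →
      IsEnd (undirected L) c x y k := by
    intro x y h h' k hk c hc e
    rw [hgP x y h h'] at e
    rcases hc with rfl | rfl
    · refine .inl ⟨(hP _ _ h h').getVert_injOn (by simpa [hlen] using hk) (by simp) ?_, rfl⟩
      rw [e, Walk.getVert_zero]
    · rw [IsEnd, undirected_of_lt h]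
      refine .inr ⟨(hP _ _ h h').getVert_injOn (by simpa [hlen] using hk) (by simp [hlen]) ?_, rfl⟩
      rw [e, ← hlen _ _ h h', Walk.getVert_length]
  have hmeet : ∀ x y x' y', x < y → y < 4 → x' < y' → y' < 4 → 4 * x + y < 4 * x' + y' →
      ∀ k ≤ L x y, ∀ k' ≤ L x' y', g x y k = g x' y' k' →
        ∃ c, IsEnd (undirected L) c x y k ∧ IsEnd (undirected L) c x' y' k' := by
    intro x y x' y' h1 h2 h3 h4 h5 k hk k' hk' e
    obtain ⟨c, e1, hc, hc'⟩ := hdis x y x' y' h1 h2 h3 h4 h5 _ (hT x y h1 h2 k)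
      (e ▸ hT x' y' h3 h4 k')
    exact ⟨c, hends x y h1 h2 k hk c hc e1, hends x' y' h3 h4 k' hk' c hc' (e ▸ e1)⟩
  refine ⟨{v | ∃ x y, x < y ∧ y < 4 ∧ T x y v}, twoSided g L, ⟨Frame.of_oriented ?_ ?_ ?_ ?_ ?_ ?_
    ?_ ?_ ?_ ?_, ?_, ?_⟩⟩
  · intro x y h h'
    rw [lt_of_mem_k4Edges] at h h'
    omega
  · intro x y h
    rw [lt_of_mem_k4Edges] at h
    omega
  · intro x y h
    rw [lt_of_mem_k4Edges] at h
    rw [undirected_of_lt h.1, undirected_of_gt h.1]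
  · intro x y h
    rw [lt_of_mem_k4Edges] at h
    rw [undirected_of_lt h.1]
    exact hpos x y h.1 h.2
  · intro x y k h hk
    rw [lt_of_mem_k4Edges] at h
    rw [undirected_of_lt h.1, hf _ _ _ h.1, twoSided, if_neg (by omega)]
  · intro x y h
    rw [lt_of_mem_k4Edges] at h
    rw [hf _ _ _ h.1, hgP x y h.1 h.2, Walk.getVert_zero]
  · intro x y h
    rw [lt_of_mem_k4Edges] at h
    rw [undirected_of_lt h.1, hf _ _ _ h.1, hgP x y h.1 h.2, ← hlen x y h.1 h.2,
      Walk.getVert_length]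
  · intro x y k h hk
    rw [lt_of_mem_k4Edges] at h
    rw [undirected_of_lt h.1] at hk
    rw [hf _ _ _ h.1, hf _ _ _ h.1, hgP x y h.1 h.2, hgP x y h.1 h.2]
    exact Walk.adj_getVert_succ _ (by rwa [hlen])
  · intro x y k x' y' k' h h' hk hk' e
    rw [lt_of_mem_k4Edges] at h h'
    rw [undirected_of_lt h.1] at hk
    rw [undirected_of_lt h'.1] at hk'
    rw [hf _ _ _ h.1, hf _ _ _ h'.1] at e
    rcases lt_trichotomy (4 * x + y) (4 * x' + y') with hlt | heq | hgt
    · exact .inr (hmeet x y x' y' h.1 h.2 h'.1 h'.2 hlt k hk k' hk' e)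
    · obtain ⟨rfl, rfl⟩ : x = x' ∧ y = y' := by omega
      rw [hgP x y h.1 h.2, hgP x y h.1 h.2] at e
      exact .inl ⟨rfl, rfl, (hP _ _ h.1 h.2).getVert_injOn (by simpa [hlen] using hk)
        (by simpa [hlen] using hk') e⟩
    · obtain ⟨c, h1, h2⟩ := hmeet x' y' x y h'.1 h'.2 h.1 h.2 hgt k' hk' k hk e.symm
      exact .inr ⟨c, h2, h1⟩
  · intro v
    constructor
    · rintro ⟨x, y, h, h', hv⟩
      rw [← hsupp x y h h', Walk.mem_support_iff_exists_getVert] at hv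
      obtain ⟨k, rfl, hk⟩ := hv
      rw [hlen] at hk
      refine ⟨x, y, k, lt_of_mem_k4Edges.2 ⟨h, h'⟩, ?_, ?_⟩
      · rwa [undirected_of_lt h]
      · rw [hf _ _ _ h, hgP x y h h']
    · rintro ⟨x, y, k, h, hk, rfl⟩
      rw [lt_of_mem_k4Edges] at h
      rw [hf _ _ _ h.1]
      exact ⟨x, y, h.1, h.2, hT x y h.1 h.2 k⟩
  · intro a b c d hn ha hb hc hd
    simp only [List.nodup_cons, List.mem_cons, List.not_mem_nil, or_false, not_or] at hn
    interval_cases a <;> interval_cases b <;> first | omega | skip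
    all_goals interval_cases c <;> interval_cases d <;> first | omega | (simp only [undirected]; simp; omega)
  · intro a b c hn ha hb hc
    simp only [List.nodup_cons, List.mem_cons, List.not_mem_nil, or_false, not_or] at hn
    interval_cases a <;> interval_cases b <;> first | omega | skip
    all_goals interval_cases c <;> first | omega | (simp only [undirected]; simp; omega)

theorem Frame.exists_common_of_onBase {G : SimpleGraph V} {es : List (ℕ × ℕ)} {S : Set V}
    {φ : ℕ → V} {f : ℕ → ℕ → ℕ → V} {L : ℕ → ℕ → ℕ} (hF : Frame G es S φ f L) {x x' : ℕ}
    {t t' : List ℕ} {v : V} (h : OnBase φ f L x t v) (h' : OnBase φ f L x' t' v)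
    (hx : ∃ y, EdgeIn es x y) (hx' : ∃ y, EdgeIn es x' y)
    (ht : ∀ e ∈ basePairs x t, EdgeIn es e.1 e.2 := by decide)
    (ht' : ∀ e ∈ basePairs x' t', EdgeIn es e.1 e.2 := by decide)
    (hne : ∀ e ∈ basePairs x t, e ∉ basePairs x' t' ∧ (e.2, e.1) ∉ basePairs x' t' := by decide) :
    ∃ c, v = φ c ∧ c ∈ x :: t ∧ c ∈ x' :: t' := by
  rcases h with rfl | ⟨e, he, k, hk, rfl⟩
  · refine ⟨x, rfl, by simp, ?_⟩
    obtain ⟨y, hy⟩ := hx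
    have p := hF.Lpos _ _ hy
    rcases h' with h' | ⟨e', he', k', hk', h'⟩
    · obtain ⟨y', hy'⟩ := hx'
      rw [hF.phi_inj hy hy' h']
      simp
    · have hm := mem_of_mem_basePairs t' x' e' he'
      rw [← hF.start _ _ hy] at h'
      rcases hF.inter _ _ _ _ _ _ hy (ht' _ he') (by omega) hk' h' with h | h | ⟨c', h3, h4⟩
      · rw [h.1]; exact hm.1
      · rw [h.1]; exact hm.2
      · unfold IsEnd at h3 h4
        obtain rfl : c' = x := by omega
        rcases h4 with h4 | h4
        · rw [h4.2]; exact hm.1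
        · rw [h4.2]; exact hm.2
  · have hm := mem_of_mem_basePairs t x e he
    rcases hF.eq_end_of_onBase hx' ht' (ht _ he) hk (hne e he).1 (hne e he).2 h' with h | h
    · exact ⟨e.1, by rw [h.1, hF.start _ _ (ht _ he)], hm.1, h.2⟩
    · exact ⟨e.2, by rw [h.1, hF.finish (ht _ he)], hm.2, h.2⟩

namespace K4Frame
variable {G : SimpleGraph V} {l : ℕ} {S : Set V} {φ : ℕ → V}
    {f : ℕ → ℕ → ℕ → V} {L : ℕ → ℕ → ℕ}

theorem not_length_eq_one (K : K4Frame G l S φ f L) (hg : NearGirth G (2 * l + 1)) (hl : 4 ≤ l)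
    (h3 : ¬ G.Colorable 3) (hv : ∀ v, (G.induce {u | u ≠ v}).Colorable 3)
    (h02 : L 0 2 = 1) : False := by
  have hL := K.lens hg
  have hLc := hL
  obtain ⟨⟩ := hLc
  obtain ⟨j, m, hj, hj', hJ, hm, h, -⟩ := K.exists_jump hg hl h3 hv (i := 2) (by omega) (by omega)
    (.inr ⟨le_rfl, by omega⟩)
  obtain ⟨hm1, hm2⟩ : m = L 1 2 ∧ 2 + j = L 0 1 := by omega
  clear hm h
  obtain ⟨P, p1, p2, -, p4, -⟩ := hJ
  have F := K.subdiv_twice 2 3 (i := 2) (by omega) (by omega) hj (by simpa [subLen] using hj')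
  set ψ := pointMap φ f L 2 2 3 j with hψ
  set F' := pieceMap f L 2 2 3 j with hF'
  set M := pieceLen L 2 2 3 j with hM
  have e4 : ψ 4 = f 0 1 2 := by simp [hψ]
  have e5 : ψ 5 = f 2 3 j := by simp [hψ, subMap]
  obtain ⟨P', q1, q2, q3⟩ : ∃ P' : G.Walk (ψ 4) (ψ 5), P'.IsPath ∧ P'.length = l ∧
      ∀ v, v ∈ P'.support ↔ v ∈ P.support :=
    ⟨P.copy e4.symm e5.symm, by simpa, by simp; omega, by simp⟩
  set T : ℕ → ℕ → V → Prop := fun x y v => match x, y with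
    | 0, 1 => OnBase ψ F' M 0 [4] v
    | 2, 3 => OnBase ψ F' M 5 [3] v
    | 0, 3 => OnBase ψ F' M 0 [3] v
    | 0, 2 => OnBase ψ F' M 0 [2, 5] v
    | 1, 3 => OnBase ψ F' M 4 [1, 3] v
    | _, _ => v ∈ P.support with hT
  set N : ℕ → ℕ → ℕ := fun x y => match x, y with
    | 0, 1 => 2
    | 2, 3 => 2
    | 0, 3 => l
    | 0, 2 => l - 1
    | 1, 3 => l - 1
    | _, _ => l with hN
  have common : ∀ x t x' t' i j i' j' v, OnBase ψ F' M x t v → OnBase ψ F' M x' t' v →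
      t ≠ [] → t' ≠ [] → (∀ e ∈ basePairs x t, EdgeIn (pieceEdges 2 3) e.1 e.2) →
      (∀ e ∈ basePairs x' t', EdgeIn (pieceEdges 2 3) e.1 e.2) →
      (∀ e ∈ basePairs x t, e ∉ basePairs x' t' ∧ (e.2, e.1) ∉ basePairs x' t') →
      (∀ c ∈ x :: t, c ∈ x' :: t' → ∃ b < 4, sel 0 4 5 3 b = c ∧ (b = i ∨ b = j) ∧
        (b = i' ∨ b = j')) → ∃ b, v = ψ (sel 0 4 5 3 b) ∧ (b = i ∨ b = j) ∧ (b = i' ∨ b = j') := by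
    intro x t x' t' i j i' j' v h h' h0 h0' ht ht' hne hc
    obtain ⟨c, h1, h2, h3⟩ := F.exists_common_of_onBase h h' (Frame.exists_edgeIn_of_ne_nil h0 ht)
      (Frame.exists_edgeIn_of_ne_nil h0' ht') ht ht' hne
    obtain ⟨b, -, rfl, hb⟩ := hc c h2 h3
    exact ⟨b, h1, hb⟩
  have commonJump : ∀ x t i j, t ≠ [] →
      (∀ e ∈ basePairs x t, EdgeIn (pieceEdges 2 3) e.1 e.2) →
      (∀ c ∈ x :: t, c ∈ [4, 5] → ∃ b < 4, sel 0 4 5 3 b = c ∧ (b = i ∨ b = j) ∧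
        (b = 1 ∨ b = 2)) → ∀ v, OnBase ψ F' M x t v → v ∈ P.support →
      ∃ b, v = ψ (sel 0 4 5 3 b) ∧ (b = i ∨ b = j) ∧ (b = 1 ∨ b = 2) := by
    intro x t i j h0 ht hc v hb hs
    have hx := Frame.exists_edgeIn_of_ne_nil h0 ht
    suffices h : (v = ψ 4 ∧ 4 ∈ x :: t) ∨ (v = ψ 5 ∧ 5 ∈ x :: t) by
      rcases h with h | h
      · obtain ⟨b, -, h1, h2⟩ := hc 4 h.2 (by simp)
        exact ⟨b, by rw [h1]; exact h.1, h2⟩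
      · obtain ⟨b, -, h1, h2⟩ := hc 5 h.2 (by simp)
        exact ⟨b, by rw [h1]; exact h.1, h2⟩
    rcases p4 v hs (F.onBase_mem hx ht hb) with rfl | rfl
    · obtain ⟨c, h1, h2, h3⟩ := F.exists_common_of_onBase hb (x' := 4) (t' := []) (.inl e4.symm)
        hx ⟨0, by decide⟩ ht (by simp [basePairs]) (by simp [basePairs])
      obtain rfl : c = 4 := by simpa using h3
      exact .inl ⟨h1, h2⟩
    · obtain ⟨c, h1, h2, h3⟩ := F.exists_common_of_onBase hb (x' := 5) (t' := []) (.inl e5.symm)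
        hx ⟨3, by decide⟩ ht (by simp [basePairs]) (by simp [basePairs])
      obtain rfl : c = 5 := by simpa using h3
      exact .inr ⟨h1, h2⟩
  obtain ⟨S', f', K'⟩ := K4Frame.exists_of_paths (G := G) (l := l)
    (φ := fun x => ψ (sel 0 4 5 3 x)) T N (by
      intro x y hxy hy
      have base : ∀ x t z n, ψ (baseLast x t) = z → (x :: t).Nodup →
          (∀ e ∈ basePairs x t, EdgeIn (pieceEdges 2 3) e.1 e.2) → baseLength M x t = n →
          ∃ R : G.Walk (ψ x) z, R.IsPath ∧ R.length = n ∧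
            ∀ v, v ∈ R.support ↔ OnBase ψ F' M x t v := by
        intro x t z n h1 h2 h3 h4
        obtain ⟨R, r1, r2, r3, -⟩ := F.exists_basePath t x h1 h2 h3
        exact ⟨R, r1, r2.trans h4, r3⟩
      interval_cases y <;> interval_cases x
      · exact base 0 [4] _ _ rfl (by decide) (by decide) (by simp [hM, hN, baseLength, subLen])
      · exact base 0 [2, 5] _ _ rfl (by decide) (by decide)
          (by simp [hM, hN, baseLength, subLen]; omega)
      · exact ⟨P', q1, q2, q3⟩
      · exact base 0 [3] _ _ rfl (by decide) (by decide)
          (by simp [hM, hN, baseLength, subLen]; omega)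
      · exact base 4 [1, 3] _ _ rfl (by decide) (by decide)
          (by simp [hM, hN, baseLength, subLen]; omega)
      · exact base 5 [3] _ _ rfl (by decide) (by decide)
          (by simp [hM, hN, baseLength, subLen]; omega)) (by
      intro x y hxy hy
      interval_cases y <;> interval_cases x <;> simp [hN] <;> omega) (by
      intro x y x' y' h1 h2 h3 h4 h5 v hv hv'
      interval_cases y' <;> interval_cases x' <;> interval_cases y <;> interval_cases x <;>
        first | omega | skip
      · exact common 0 [4] 0 [2, 5] 0 1 0 2 v hv hv' (by decide) (by decide) (by decide)
          (by decide) (by decide) (by decide)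
      · exact commonJump 0 [4] 0 1 (by decide) (by decide) (by decide) v hv hv'
      · exact commonJump 0 [2, 5] 0 2 (by decide) (by decide) (by decide) v hv hv'
      · exact commonJump 0 [3] 0 3 (by decide) (by decide) (by decide) v hv hv'
      · exact common 0 [4] 0 [3] 0 1 0 3 v hv hv' (by decide) (by decide) (by decide)
          (by decide) (by decide) (by decide)
      · exact common 0 [2, 5] 0 [3] 0 2 0 3 v hv hv' (by decide) (by decide) (by decide)
          (by decide) (by decide) (by decide)
      · exact common 0 [4] 4 [1, 3] 0 1 1 3 v hv hv' (by decide) (by decide) (by decide)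
          (by decide) (by decide) (by decide)
      · exact common 0 [2, 5] 4 [1, 3] 0 2 1 3 v hv hv' (by decide) (by decide) (by decide)
          (by decide) (by decide) (by decide)
      · obtain ⟨b, h1, h2, h3⟩ := commonJump 4 [1, 3] 1 3 (by decide) (by decide) (by decide)
          v hv' hv
        exact ⟨b, h1, h3, h2⟩
      · exact common 0 [3] 4 [1, 3] 0 3 1 3 v hv hv' (by decide) (by decide) (by decide)
          (by decide) (by decide) (by decide)
      · exact common 0 [4] 5 [3] 0 1 2 3 v hv hv' (by decide) (by decide) (by decide)
          (by decide) (by decide) (by decide)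
      · exact common 0 [2, 5] 5 [3] 0 2 2 3 v hv hv' (by decide) (by decide) (by decide)
          (by decide) (by decide) (by decide)
      · obtain ⟨b, h1, h2, h3⟩ := commonJump 5 [3] 2 3 (by decide) (by decide) (by decide)
          v hv' hv
        exact ⟨b, h1, h3, h2⟩
      · exact common 0 [3] 5 [3] 0 3 2 3 v hv hv' (by decide) (by decide) (by decide)
          (by decide) (by decide) (by decide)
      · exact common 4 [1, 3] 5 [3] 1 3 2 3 v hv hv' (by decide) (by decide) (by decide)
          (by decide) (by decide) (by decide)) (by simp [hN]) (by simp [hN]) (by simp [hN]) (by simp [hN]; omega)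
  refine K'.not_all_two_le hg hl h3 hv ?_ ?_ ?_ <;> simp [undirected, hN] <;> omega

theorem false_of_critical (K : K4Frame G l S φ f L) (hg : NearGirth G (2 * l + 1)) (hl : 4 ≤ l)
    (h3 : ¬ G.Colorable 3) (hv : ∀ v, (G.induce {u | u ≠ v}).Colorable 3) : False := by
  obtain ⟨⟩ := K.lens hg
  by_cases h02 : L 0 2 = 1
  · exact K.not_length_eq_one hg hl h3 hv h02
  by_cases h01 : L 0 1 = 1
  · exact (K.relabel (sel 0 2 1 3) (by decide)).not_length_eq_one hg hl h3 hv h01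
  by_cases h12 : L 1 2 = 1
  · exact (K.relabel (sel 1 0 2 3) (by decide)).not_length_eq_one hg hl h3 hv h12
  exact K.not_all_two_le hg hl h3 hv (by omega) (by omega) (by omega)

end K4Frame

theorem arcs_of_isCycle {G : SimpleGraph V} {a b c : V} {p : G.Walk a b} {q : G.Walk b c}
    {r : G.Walk a c} (h : ((p.append q).append r.reverse).IsCycle) (hab : a ≠ b) (hac : a ≠ c)
    (hbc : b ≠ c) :
    (∀ v ∈ p.support, v ∈ q.support → v = b) ∧ (∀ v ∈ p.support, v ∈ r.support → v = a) ∧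
      ∀ v ∈ q.support, v ∈ r.support → v = c := by
  have hnd := h.support_nodup
  rw [Walk.tail_support_append, Walk.tail_support_append] at hnd
  obtain ⟨h1, -, h2⟩ := List.nodup_append'.1 hnd
  obtain ⟨-, -, h3⟩ := List.nodup_append'.1 h1
  have hp : ∀ v, v ∈ p.support → v = a ∨ v ∈ p.support.tail := fun v hv => by
    rwa [← Walk.cons_tail_support p, List.mem_cons] at hv
  have hq : ∀ v, v ∈ q.support → v = b ∨ v ∈ q.support.tail := fun v hv => by
    rwa [← Walk.cons_tail_support q, List.mem_cons] at hv
  have hr : ∀ v, v ∈ r.support → v = c ∨ v ∈ r.reverse.support.tail := fun v hv => by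
    rw [← List.mem_reverse, ← Walk.support_reverse, ← Walk.cons_tail_support r.reverse,
      List.mem_cons] at hv
    exact hv
  have ha : a ∈ r.reverse.support.tail := (hr a r.start_mem_support).resolve_left hac
  have hb : b ∈ p.support.tail := (hp b p.end_mem_support).resolve_left hab.symm
  have hc : c ∈ q.support.tail := (hq c q.end_mem_support).resolve_left hbc.symm
  have d1 : ∀ v, v ∈ p.support.tail → v ∉ q.support.tail := fun v hv hv' => h3 hv hv'
  have d2 : ∀ v, v ∈ p.support.tail → v ∉ r.reverse.support.tail := fun v hv hv' =>
    h2 (List.mem_append_left _ hv) hv'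
  have d3 : ∀ v, v ∈ q.support.tail → v ∉ r.reverse.support.tail := fun v hv hv' =>
    h2 (List.mem_append_right _ hv) hv'
  refine ⟨fun v m1 m2 => ?_, fun v m1 m2 => ?_, fun v m1 m2 => ?_⟩
  · rcases hp v m1 with rfl | m1 <;> rcases hq v m2 with rfl | m2
    · rfl
    · exact absurd ha (d3 _ m2)
    · rfl
    · exact absurd m2 (d1 _ m1)
  · rcases hp v m1 with rfl | m1 <;> rcases hr v m2 with rfl | m2
    · rfl
    · rfl
    · exact absurd hc (d1 _ m1)
    · exact absurd m2 (d2 _ m1)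
  · rcases hq v m1 with rfl | m1 <;> rcases hr v m2 with rfl | m2
    · rfl
    · exact absurd m2 (d2 _ hb)
    · rfl
    · exact absurd m2 (d3 _ m1)

theorem MemGFam.nearGirth {G : SimpleGraph V} {l : ℕ} (hG : MemGFam G l) (hl : 4 ≤ l) :
    NearGirth G (2 * l + 1) := by
  have hle : ∀ v (c : G.Walk v v), c.IsCycle → 2 * l + 1 ≤ c.length := by
    intro v c hc
    have := hc.girth_le_length
    rw [hG.1] at this
    exact this
  refine ⟨hle, fun v c hc hi ho => ?_⟩
  have h1 := hle v c hc
  have h2 := hG.2 v c ⟨⟨hc, by omega, hi⟩, ho⟩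
  obtain ⟨k, hk⟩ := ho
  omega

theorem IsOddK4.exists_frame {G : SimpleGraph V} {l : ℕ} {H : K4Sub G} (hH : IsOddK4 G H)
    (hg : NearGirth G (2 * l + 1)) : ∃ S φ f L, K4Frame G l S φ f L := by
  obtain ⟨h1, h2, h3, h4⟩ := hH
  have hole : ∀ {v : V} {c : G.Walk v v}, IsOddHole G c → c.length = 2 * l + 1 :=
    fun h => hg.eq _ _ h.1.1 h.1.2.2 h.2
  have e1 := hole h1
  have e2 := hole h2
  have e3 := hole h3
  have e4 := hole h4
  have hu := H.hu
  simp only [List.nodup_cons, List.mem_cons, List.not_mem_nil, or_false, not_or,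
    not_false_eq_true, List.nodup_nil, and_true] at hu
  obtain ⟨⟨h12, h13, h14⟩, ⟨h23, h24⟩, h34⟩ := hu
  obtain ⟨a1, a2, a3⟩ := arcs_of_isCycle h1.1.1 h12 h13 h23
  obtain ⟨b1, b2, b3⟩ := arcs_of_isCycle h2.1.1 h12 h14 h24
  obtain ⟨c1, c2, c3⟩ := arcs_of_isCycle h3.1.1 h23 h24 h34
  obtain ⟨d1, d2, d3⟩ := arcs_of_isCycle h4.1.1 h13 h14 h34
  simp only [K4Sub.C1, K4Sub.C2, K4Sub.C3, K4Sub.C4, Walk.length_append, Walk.length_reverse]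
    at e1 e2 e3 e4
  have pos : ∀ {x y : V} (P : G.Walk x y), x ≠ y → 1 ≤ P.length := fun P h =>
    Nat.one_le_iff_ne_zero.2 fun e => h (Walk.eq_of_length_eq_zero e)
  set φ : ℕ → V := fun x => match x with
    | 0 => H.u1
    | 1 => H.u2
    | 2 => H.u3
    | _ => H.u4 with hφ
  set T : ℕ → ℕ → V → Prop := fun x y v => match x, y with
    | 0, 1 => v ∈ H.P1.support
    | 2, 3 => v ∈ H.P2.support
    | 1, 2 => v ∈ H.Q1.support
    | 0, 3 => v ∈ H.Q2.support
    | 0, 2 => v ∈ H.L1.support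
    | _, _ => v ∈ H.L2.support with hT
  set N : ℕ → ℕ → ℕ := fun x y => match x, y with
    | 0, 1 => H.P1.length
    | 2, 3 => H.P2.length
    | 1, 2 => H.Q1.length
    | 0, 3 => H.Q2.length
    | 0, 2 => H.L1.length
    | _, _ => H.L2.length with hN
  obtain ⟨S, f, K⟩ := K4Frame.exists_of_paths (G := G) (l := l) (φ := φ) T N (by
      intro x y hxy hy
      interval_cases y <;> interval_cases x
      · exact ⟨H.P1, H.hP1, rfl, fun _ => Iff.rfl⟩
      · exact ⟨H.L1, H.hL1, rfl, fun _ => Iff.rfl⟩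
      · exact ⟨H.Q1, H.hQ1, rfl, fun _ => Iff.rfl⟩
      · exact ⟨H.Q2, H.hQ2, rfl, fun _ => Iff.rfl⟩
      · exact ⟨H.L2, H.hL2, rfl, fun _ => Iff.rfl⟩
      · exact ⟨H.P2, H.hP2, rfl, fun _ => Iff.rfl⟩) (by
      intro x y hxy hy
      interval_cases y <;> interval_cases x
      · exact pos H.P1 h12
      · exact pos H.L1 h13
      · exact pos H.Q1 h23
      · exact pos H.Q2 h14
      · exact pos H.L2 h24
      · exact pos H.P2 h34) (by
      intro x y x' y' i1 i2 i3 i4 i5 v hv hv'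
      interval_cases y' <;> interval_cases x' <;> interval_cases y <;> interval_cases x <;>
        first | omega | skip
      · exact ⟨0, a2 v hv hv', by simp⟩
      · exact ⟨1, a1 v hv hv', by simp⟩
      · exact ⟨2, a3 v hv' hv, by simp⟩
      · exact absurd hv (H.hQ v hv')
      · exact ⟨0, b2 v hv hv', by simp⟩
      · exact ⟨0, d2 v hv hv', by simp⟩
      · exact ⟨1, b1 v hv hv', by simp⟩
      · exact absurd hv' (H.hL v hv)
      · exact ⟨1, c2 v hv hv', by simp⟩
      · exact ⟨3, b3 v hv' hv, by simp⟩
      · exact absurd hv' (H.hP v hv)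
      · exact ⟨2, d1 v hv hv', by simp⟩
      · exact ⟨2, c1 v hv hv', by simp⟩
      · exact ⟨3, d3 v hv' hv, by simp⟩
      · exact ⟨3, c3 v hv' hv, by simp⟩) (by simp [hN]; omega) (by simp [hN]; omega) (by simp [hN]; omega)
      (by simp [hN]; omega)
  exact ⟨S, φ, f, _, K⟩

/-- For `l ≥ 4`, a 4-vertex-critical graph in `𝒢ₗ` contains no odd
`K4`-subdivision. -/
theorem four_critical_no_odd_K4 {V : Type*} [Fintype V]
    (l : ℕ) (hl : 4 ≤ l) (G : SimpleGraph V) (hG : MemGFam G l)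
    (hcrit : IsVertexCritical G 4) : ¬ HasOddK4 G := by
  rintro ⟨H, hH⟩
  have hg := hG.nearGirth hl
  obtain ⟨S, φ, f, L, K⟩ := hH.exists_frame hg
  refine K.false_of_critical hg hl (fun h => ?_) fun v => ?_
  · have := h.chromaticNumber_le
    rw [hcrit.1] at this
    exact absurd this (by decide)
  · have h := hcrit.2 v
    have h' : (G.induce {u | u ≠ v}).chromaticNumber ≤ 3 :=
      Order.le_of_lt_add_one (h.trans_eq (by norm_num))
    exact chromaticNumber_le_iff_colorable.1 h'
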